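/- Let n ≥ 1, r > 0, k₁ ∈ [0,1] and k₂ ≥ 0. Let μ be the measure on ℝⁿ with density e^{−V}, where V : ℝⁿ → ℝ is an even convex C² function with ∇²V(x) ≽ k₁·Id for all x, and with ∫_M ΔV dμ ≤ k₂ n μ(M) for every origin-symmetric convex body M containing r·B₂ⁿ. Let p ∈ [0,1] and q ∈ [0,p] satisfy (1−p)·( 2√n·√(1+k₂)·√(1+k₁) + √k₁ )/(2r) + q(1+k₂)(1+k₁) ≤ 2k₁. Then μ satisfies the (p,q)-inequality for every pair of origin-symmetric convex bodies K, L with K ⊆ L and both containing r·B₂ⁿ. -/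

import Mathlib

open MeasureTheory
open scoped RealInnerProductSpace ENNReal

noncomputable section

abbrev Euc (n : ℕ) : Type := EuclideanSpace ℝ (Fin n)

/-- A convex body: a compact convex set with nonempty interior. -/
def IsConvexBody {n : ℕ} (K : Set (Euc n)) : Prop :=
  IsCompact K ∧ Convex ℝ K ∧ (interior K).Nonempty

/-- The support function `h_K(u) = sup_{y ∈ K} ⟨u, y⟩`. -/
def suppFn {n : ℕ} (K : Set (Euc n)) (u : Euc n) : ℝ :=
  sSup ((fun y => ⟪u, y⟫) '' K)

/-- `lpComb p lam K L` is the `L_p` combination `lam·K +_p (1−lam)·L`;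
for `p = 0` it is the logarithmic combination. -/
def lpComb {n : ℕ} (p lam : ℝ) (K L : Set (Euc n)) : Set (Euc n) :=
  if p = 0 then
    {x | ∀ u : Euc n, ‖u‖ = 1 → ⟪x, u⟫ ≤ suppFn K u ^ lam * suppFn L u ^ (1 - lam)}
  else
    {x | ∀ u : Euc n, ‖u‖ = 1 →
      ⟪x, u⟫ ≤ (lam * suppFn K u ^ p + (1 - lam) * suppFn L u ^ p) ^ (1 / p)}


/-- The `(p,q)`-inequality of Conjecture 1.2 for the measure `μ` and the pair `K, L`:
for `q = 0` the multiplicative form, for `q ≠ 0` the additive `q/n`-form. -/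
def PQIneq {n : ℕ} (μ : Measure (Euc n)) (p q : ℝ) (K L : Set (Euc n)) : Prop :=
  ∀ lam ∈ Set.Icc (0:ℝ) 1,
    (q = 0 → μ K ^ lam * μ L ^ (1 - lam) ≤ μ (lpComb p lam K L)) ∧
    (q ≠ 0 →
      ENNReal.ofReal lam * μ K ^ (q / (n : ℝ)) + ENNReal.ofReal (1 - lam) * μ L ^ (q / (n : ℝ))
        ≤ μ (lpComb p lam K L) ^ (q / (n : ℝ)))

/-- The Laplacian `Δ V` of a function on `ℝⁿ`, as the trace of its Hessian. -/
def lapl {n : ℕ} (V : Euc n → ℝ) (x : Euc n) : ℝ :=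
  ∑ i : Fin n,
    iteratedFDeriv ℝ 2 V x ![EuclideanSpace.single i 1, EuclideanSpace.single i 1]

section helpers

open Set Filter Topology

/-- The `i`-th partial derivative on `ℝⁿ`. -/
def pd {n : ℕ} (i : Fin n) (f : Euc n → ℝ) (x : Euc n) : ℝ :=
  fderiv ℝ f x (EuclideanSpace.single i 1)

/-- The cube `[-R, R]ⁿ`. -/
def box (n : ℕ) (R : ℝ) : Set (Euc n) := {x | ∀ i, |x i| ≤ R}

lemma box_eq_preimage (n : ℕ) (R : ℝ) :
    box n R = WithLp.ofLp ⁻¹' Icc (fun _ : Fin n => -R) (fun _ => R) := by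
  ext x
  simp [box, abs_le, Pi.le_def, forall_and]

lemma isCompact_box (n : ℕ) (R : ℝ) : IsCompact (box n R) := by
  rw [box_eq_preimage]
  have h := (isCompact_Icc (a := (fun _ : Fin n => -R)) (b := fun _ => R)).image
    (PiLp.continuous_toLp 2 (fun _ : Fin n => ℝ))
  convert h using 1
  ext x
  constructor
  · intro hx
    exact ⟨WithLp.ofLp x, hx, rfl⟩
  · rintro ⟨y, hy, rfl⟩
    exact hy

lemma measurableSet_box (n : ℕ) (R : ℝ) : MeasurableSet (box n R) :=
  (isCompact_box n R).measurableSet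

lemma setIntegral_box {n : ℕ} (R : ℝ) (g : Euc n → ℝ) :
    ∫ x in box n R, g x =
      ∫ y in Icc (fun _ : Fin n => -R) (fun _ => R), g (WithLp.toLp 2 y) := by
  rw [← (PiLp.volume_preserving_toLp (Fin n)).setIntegral_preimage_emb
    (MeasurableEquiv.toLp 2 (Fin n → ℝ)).measurableEmbedding g (box n R)]
  rw [box_eq_preimage]
  rfl

section pdCalculus

variable {n : ℕ} {f g : Euc n → ℝ} {i : Fin n}

lemma ContDiff.pd {k m : WithTop ℕ∞} (hf : ContDiff ℝ k f) (h : m + 1 ≤ k) :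
    ContDiff ℝ m (pd i f) :=
  (hf.fderiv_right h).clm_apply contDiff_const

lemma continuous_pd (hf : ContDiff ℝ 1 f) : Continuous (pd i f) :=
  (ContDiff.pd (m := 0) hf (by norm_num)).continuous

lemma pd_mul (hf : ContDiff ℝ 1 f) (hg : ContDiff ℝ 1 g) (x : Euc n) :
    pd i (fun x => f x * g x) x = pd i f x * g x + f x * pd i g x := by
  have h := ((hf.differentiable one_ne_zero x).hasFDerivAt.mul
    (hg.differentiable one_ne_zero x).hasFDerivAt).fderiv
  have h' : fderiv ℝ (fun x => f x * g x) x = f x • fderiv ℝ g x + g x • fderiv ℝ f x := h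
  simp only [pd, h', _root_.add_apply, _root_.smul_apply, smul_eq_mul]
  ring

lemma pd_add (hf : ContDiff ℝ 1 f) (hg : ContDiff ℝ 1 g) (x : Euc n) :
    pd i (fun x => f x + g x) x = pd i f x + pd i g x := by
  have h := ((hf.differentiable one_ne_zero x).hasFDerivAt.add
    (hg.differentiable one_ne_zero x).hasFDerivAt).fderiv
  have h' : fderiv ℝ (fun x => f x + g x) x = fderiv ℝ f x + fderiv ℝ g x := h
  simp [pd, h']

lemma pd_sub (hf : ContDiff ℝ 1 f) (hg : ContDiff ℝ 1 g) (x : Euc n) :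
    pd i (fun x => f x - g x) x = pd i f x - pd i g x := by
  have h := ((hf.differentiable one_ne_zero x).hasFDerivAt.sub
    (hg.differentiable one_ne_zero x).hasFDerivAt).fderiv
  have h' : fderiv ℝ (fun x => f x - g x) x = fderiv ℝ f x - fderiv ℝ g x := h
  simp [pd, h']

lemma pd_const (c : ℝ) (x : Euc n) : pd i (fun _ => c) x = 0 := by
  simp [pd]

lemma pd_const_mul (c : ℝ) (hf : ContDiff ℝ 1 f) (x : Euc n) :
    pd i (fun x => c * f x) x = c * pd i f x := by
  rw [pd_mul contDiff_const hf, pd_const]; ring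

lemma pd_sum {ι : Type*} (s : Finset ι) {F : ι → Euc n → ℝ} (hF : ∀ j ∈ s, ContDiff ℝ 1 (F j))
    (x : Euc n) : pd i (fun x => ∑ j ∈ s, F j x) x = ∑ j ∈ s, pd i (F j) x := by
  have h : HasFDerivAt (fun x => ∑ j ∈ s, F j x) (∑ j ∈ s, fderiv ℝ (F j) x) x :=
    HasFDerivAt.fun_sum fun j hj => ((hF j hj).differentiable one_ne_zero x).hasFDerivAt
  simp [pd, h.fderiv]

lemma pd_comp (φ : ℝ → ℝ) {φ' : ℝ} (hf : ContDiff ℝ 1 f) (x : Euc n)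
    (hφ : HasDerivAt φ φ' (f x)) : pd i (fun x => φ (f x)) x = φ' * pd i f x := by
  have h := (hφ.comp_hasFDerivAt x (hf.differentiable one_ne_zero x).hasFDerivAt).fderiv
  have h' : fderiv ℝ (fun x => φ (f x)) x = φ' • fderiv ℝ f x := h
  simp [pd, h']

lemma pd_exp_neg (hf : ContDiff ℝ 1 f) (x : Euc n) :
    pd i (fun x => Real.exp (-f x)) x = -pd i f x * Real.exp (-f x) := by
  have h : HasDerivAt (fun t : ℝ => Real.exp (-t)) (-Real.exp (-f x)) (f x) := by
    simpa using (hasDerivAt_neg (f x)).exp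
  rw [pd_comp (fun t => Real.exp (-t)) hf x h]; ring

lemma pd_coord (j : Fin n) (x : Euc n) :
    pd i (fun x : Euc n => x j) x = if i = j then 1 else 0 := by
  have h : HasFDerivAt (fun x : Euc n => x j) (EuclideanSpace.proj j : Euc n →L[ℝ] ℝ) x :=
    (EuclideanSpace.proj j : Euc n →L[ℝ] ℝ).hasFDerivAt
  simp [pd, h.fderiv, eq_comm]

lemma contDiff_coord (j : Fin n) {k : WithTop ℕ∞} : ContDiff ℝ k (fun x : Euc n => x j) :=
  (EuclideanSpace.proj j : Euc n →L[ℝ] ℝ).contDiff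

lemma pd_pd_apply (hf : ContDiff ℝ 2 f) (j : Fin n) (x : Euc n) :
    pd i (pd j f) x =
      fderiv ℝ (fderiv ℝ f) x (EuclideanSpace.single i 1) (EuclideanSpace.single j 1) := by
  have h1 : ContDiff ℝ 1 (fderiv ℝ f) := hf.fderiv_right (by norm_num)
  have h := ((h1.differentiable one_ne_zero x).hasFDerivAt.clm_apply
    (hasFDerivAt_const (EuclideanSpace.single j (1:ℝ) : Euc n) x)).fderiv
  have h' : fderiv ℝ (pd j f) x = _ := h
  rw [pd, h']
  simp

lemma pd_comm (hf : ContDiff ℝ 2 f) (j : Fin n) (x : Euc n) :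
    pd i (pd j f) x = pd j (pd i f) x := by
  rw [pd_pd_apply hf, pd_pd_apply hf]
  exact (hf.contDiffAt.isSymmSndFDerivAt (by simp)).eq _ _

end pdCalculus

lemma integral_pd_nonneg {n : ℕ} {R : ℝ} (hR : 0 ≤ R) (i : Fin n) {F : Euc n → ℝ}
    (hF : ContDiff ℝ 1 F) (h1 : ∀ x, x i = R → 0 ≤ F x) (h2 : ∀ x, x i = -R → F x ≤ 0) :
    0 ≤ ∫ x in box n R, pd i F x := by
  obtain ⟨m, rfl⟩ : ∃ m, n = m + 1 := ⟨n - 1, by have := i.pos; omega⟩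
  rw [setIntegral_box]
  let T : (Fin (m+1) → ℝ) →L[ℝ] Euc (m+1) :=
    ((PiLp.continuousLinearEquiv 2 ℝ (fun _ : Fin (m+1) => ℝ)).symm : _ →L[ℝ] _)
  have hT : ∀ y, T y = WithLp.toLp 2 y := fun y => rfl
  have key := MeasureTheory.integral_divergence_of_hasFDerivAt_off_countable'
    (fun _ : Fin (m+1) => -R) (fun _ => R) (fun _ => by linarith)
    (fun j y => if j = i then F (T y) else 0)
    (fun j y => if j = i then (fderiv ℝ F (T y)).comp T else 0) ∅ countable_empty
    (by
      intro j
      by_cases h : j = i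
      · simp only [h, if_true]; exact (hF.continuous.comp T.continuous).continuousOn
      · simp only [h, if_false]; exact continuousOn_const)
    (by
      intro x _ j
      by_cases h : j = i
      · simp only [h, if_true]
        exact ((hF.differentiable one_ne_zero (T x)).hasFDerivAt).comp x T.hasFDerivAt
      · simp only [h, if_false]; exact hasFDerivAt_const _ _)
    (by
      apply ContinuousOn.integrableOn_compact isCompact_Icc
      apply Continuous.continuousOn
      apply continuous_finsetSum
      intro j _
      by_cases h : j = i
      · simp only [h, if_true]
        have := hF.continuous_fderiv one_ne_zero
        exact ((this.comp T.continuous).clm_comp continuous_const).clm_apply continuous_const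
      · simp only [h, if_false]; exact continuous_const)
  have e1 : ∀ y, (∑ j, (if j = i then (fderiv ℝ F (T y)).comp T else 0)
      (Pi.single j (1:ℝ))) = pd i F (WithLp.toLp 2 y) := by
    intro y
    rw [Finset.sum_eq_single i (by intro j _ hj; simp [hj]) (by simp)]
    simp only [if_true, pd, ContinuousLinearMap.comp_apply]
    rfl
  simp only [e1] at key
  rw [key, Finset.sum_eq_single i (by intro j _ hj; simp [hj]) (by simp)]
  simp only [if_true]
  have a1 : 0 ≤ ∫ (x : Fin m → ℝ) in Icc ((fun _ : Fin (m+1) => -R) ∘ i.succAbove)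
      ((fun _ => R) ∘ i.succAbove), F (T (i.insertNth R x)) := by
    apply integral_nonneg
    intro x
    exact h1 _ (by simp [hT])
  have a2 : ∫ (x : Fin m → ℝ) in Icc ((fun _ : Fin (m+1) => -R) ∘ i.succAbove)
      ((fun _ => R) ∘ i.succAbove), F (T (i.insertNth (-R) x)) ≤ 0 := by
    apply integral_nonpos
    intro x
    exact h2 _ (by simp [hT])
  linarith

lemma integral_pd_eq_zero {n : ℕ} {R : ℝ} (hR : 0 ≤ R) (i : Fin n) {F : Euc n → ℝ}
    (hF : ContDiff ℝ 1 F) (h : ∀ x, |x i| = R → F x = 0) :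
    ∫ x in box n R, pd i F x = 0 := by
  have a1 : ∀ x : Euc n, x i = R → F x = 0 := fun x hx => h x (by rw [hx, abs_of_nonneg hR])
  have a2 : ∀ x : Euc n, x i = -R → F x = 0 :=
    fun x hx => h x (by rw [hx, abs_neg, abs_of_nonneg hR])
  apply le_antisymm
  · have := integral_pd_nonneg hR i (F := fun x => (-1) * F x) (contDiff_const.mul hF)
      (fun x hx => by rw [a1 x hx]; simp) (fun x hx => by rw [a2 x hx]; simp)
    simp only [pd_const_mul _ hF] at this
    rw [integral_const_mul] at this
    linarith
  · exact integral_pd_nonneg hR i hF (fun x hx => (a1 x hx).ge) (fun x hx => (a2 x hx).le)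

/-- The integral of `f` over the cube with respect to the weight `e^{-W}`. -/
def wint {n : ℕ} (R : ℝ) (W f : Euc n → ℝ) : ℝ :=
  ∫ x in box n R, f x * Real.exp (-W x)

section wintCalculus

variable {n : ℕ} {R : ℝ} {W f g : Euc n → ℝ}

lemma integrableOn_box (hf : Continuous f) : IntegrableOn f (box n R) :=
  hf.continuousOn.integrableOn_compact (isCompact_box n R)

lemma integrable_wint (hW : Continuous W) (hf : Continuous f) :
    IntegrableOn (fun x => f x * Real.exp (-W x)) (box n R) :=
  integrableOn_box (hf.mul (Real.continuous_exp.comp hW.neg))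

lemma wint_add (hW : Continuous W) (hf : Continuous f) (hg : Continuous g) :
    wint R W (fun x => f x + g x) = wint R W f + wint R W g := by
  simp only [wint, add_mul]
  exact integral_add (integrable_wint hW hf) (integrable_wint hW hg)

lemma wint_sub (hW : Continuous W) (hf : Continuous f) (hg : Continuous g) :
    wint R W (fun x => f x - g x) = wint R W f - wint R W g := by
  simp only [wint, sub_mul]
  exact integral_sub (integrable_wint hW hf) (integrable_wint hW hg)

lemma wint_const_mul (c : ℝ) : wint R W (fun x => c * f x) = c * wint R W f := by
  simp only [wint, mul_assoc]
  exact integral_const_mul _ _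

lemma wint_neg : wint R W (fun x => -f x) = -wint R W f := by
  simp only [wint, neg_mul]
  exact integral_neg _

lemma wint_sum (hW : Continuous W) {ι : Type*} (s : Finset ι) {F : ι → Euc n → ℝ}
    (hF : ∀ j ∈ s, Continuous (F j)) :
    wint R W (fun x => ∑ j ∈ s, F j x) = ∑ j ∈ s, wint R W (F j) := by
  simp only [wint, Finset.sum_mul]
  exact integral_finsetSum _ fun j hj => integrable_wint hW (hF j hj)

lemma wint_mono (hW : Continuous W) (hf : Continuous f) (hg : Continuous g)
    (h : ∀ x ∈ box n R, f x ≤ g x) : wint R W f ≤ wint R W g := by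
  apply setIntegral_mono_on (integrable_wint hW hf) (integrable_wint hW hg) (measurableSet_box n R)
  intro x hx
  exact mul_le_mul_of_nonneg_right (h x hx) (Real.exp_pos _).le

lemma wint_nonneg (h : ∀ x ∈ box n R, 0 ≤ f x) : 0 ≤ wint R W f :=
  setIntegral_nonneg (measurableSet_box n R) fun x hx => mul_nonneg (h x hx) (Real.exp_pos _).le

lemma wint_sq_nonneg : 0 ≤ wint R W (fun x => f x ^ 2) := wint_nonneg fun _ _ => sq_nonneg _

lemma wint_const (c : ℝ) : wint R W (fun _ => c) = c * wint R W (fun _ => 1) := by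
  rw [← wint_const_mul]; simp

lemma wint_mul_sq_le (hW : Continuous W) (hf : Continuous f) (hg : Continuous g) :
    wint R W (fun x => f x * g x) ^ 2 ≤
      wint R W (fun x => f x ^ 2) * wint R W (fun x => g x ^ 2) := by
  have key : ∀ t : ℝ, 0 ≤ wint R W (fun x => g x ^ 2) * (t * t) +
      (-2 * wint R W (fun x => f x * g x)) * t + wint R W (fun x => f x ^ 2) := by
    intro t
    have h : wint R W (fun x => (f x - t * g x) ^ 2) =
        wint R W (fun x => g x ^ 2) * (t * t) +
      (-2 * wint R W (fun x => f x * g x)) * t + wint R W (fun x => f x ^ 2) := by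
      have e : (fun x => (f x - t * g x) ^ 2) =
          fun x => ((t * t) * g x ^ 2 + (-2 * t) * (f x * g x)) + f x ^ 2 := by
        ext x; ring
      rw [e, wint_add hW (by fun_prop) (by fun_prop), wint_add hW (by fun_prop) (by fun_prop),
        wint_const_mul, wint_const_mul]
      ring
    rw [← h]; exact wint_sq_nonneg
  have := discrim_le_zero key
  simp only [discrim] at this
  nlinarith

lemma abs_wint_mul_le (hW : Continuous W) (hf : Continuous f) (hg : Continuous g) :
    |wint R W (fun x => f x * g x)| ≤
      √(wint R W (fun x => f x ^ 2)) * √(wint R W (fun x => g x ^ 2)) := by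
  rw [← Real.sqrt_mul wint_sq_nonneg, ← Real.sqrt_sq_eq_abs]
  exact Real.sqrt_le_sqrt (wint_mul_sq_le hW hf hg)

end wintCalculus

/-- `C³` functions satisfying the Neumann condition on the faces of the cube. -/
structure Neu {n : ℕ} (R : ℝ) (u : Euc n → ℝ) : Prop where
  smooth : ContDiff ℝ 3 u
  normal : ∀ i x, |x i| = R → pd i u x = 0

/-- The weighted Laplacian `Δu - ⟨∇W, ∇u⟩`. -/
def wlap {n : ℕ} (W u : Euc n → ℝ) (x : Euc n) : ℝ :=
  ∑ i, (pd i (pd i u) x - pd i W x * pd i u x)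

section parts

variable {n : ℕ} {R : ℝ} {W f g u : Euc n → ℝ}

lemma Neu.pd_contDiff (hu : Neu R u) (i : Fin n) : ContDiff ℝ 2 (pd i u) :=
  hu.smooth.pd (by norm_num)

lemma Neu.pd_pd_contDiff (hu : Neu R u) (i j : Fin n) : ContDiff ℝ 1 (pd i (pd j u)) :=
  (hu.pd_contDiff j).pd (by norm_num)

lemma wlap_contDiff (hW : ContDiff ℝ 2 W) (hu : Neu R u) : ContDiff ℝ 1 (wlap W u) := by
  unfold wlap
  refine ContDiff.sum fun i _ => ?_
  exact (hu.pd_pd_contDiff i i).sub ((hW.pd (by norm_num)).mul ((hu.pd_contDiff i).of_le (by norm_num)))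

lemma wint_parts (hR : 0 ≤ R) (hW : ContDiff ℝ 1 W) (i : Fin n) (hf : ContDiff ℝ 1 f)
    (hg : ContDiff ℝ 1 g) (h : ∀ x, |x i| = R → f x * g x = 0) :
    wint R W (fun x => pd i f x * g x) =
      -wint R W (fun x => f x * (pd i g x - pd i W x * g x)) := by
  have hE : ContDiff ℝ 1 (fun x => Real.exp (-W x)) := hW.neg.exp
  have key := integral_pd_eq_zero hR i (F := fun x => (f x * g x) * Real.exp (-W x))
    ((hf.mul hg).mul hE) (fun x hx => by rw [h x hx, zero_mul])
  have e : ∀ x, pd i (fun x => (f x * g x) * Real.exp (-W x)) x =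
      (pd i f x * g x + f x * (pd i g x - pd i W x * g x)) * Real.exp (-W x) := by
    intro x
    rw [pd_mul (hf.mul hg) hE, pd_mul hf hg, pd_exp_neg hW]
    ring
  simp only [e] at key
  have c1 := continuous_pd (i := i) hf
  have c2 := continuous_pd (i := i) hg
  have c3 := continuous_pd (i := i) hW
  have c4 := hf.continuous
  have c5 := hg.continuous
  have := wint_add (R := R) (W := W) hW.continuous (f := fun x => pd i f x * g x)
    (g := fun x => f x * (pd i g x - pd i W x * g x)) (by fun_prop) (by fun_prop)
  rw [wint, key] at this
  linarith

lemma wint_mul_wlap (hR : 0 ≤ R) (hW : ContDiff ℝ 2 W) (hf : ContDiff ℝ 1 f) (hu : Neu R u) :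
    wint R W (fun x => f x * wlap W u x) = -wint R W (fun x => ∑ i, pd i f x * pd i u x) := by
  have hW1 : ContDiff ℝ 1 W := hW.of_le (by norm_num)
  have cf := hf.continuous
  have c1 : ∀ i, Continuous (pd i f) := fun i => continuous_pd hf
  have c2 : ∀ i, Continuous (pd i u) := fun i => (hu.pd_contDiff i).continuous
  have c3 : ∀ i, Continuous (pd i (pd i u)) := fun i => (hu.pd_pd_contDiff i i).continuous
  have c4 : ∀ i, Continuous (pd i W) := fun i => continuous_pd hW1
  simp only [wlap, Finset.mul_sum]
  rw [wint_sum hW.continuous _ (fun i _ => by fun_prop),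
    wint_sum hW.continuous _ (fun i _ => by fun_prop), ← Finset.sum_neg_distrib]
  refine Finset.sum_congr rfl fun i _ => ?_
  rw [wint_parts hR hW1 i hf ((hu.pd_contDiff i).of_le (by norm_num))
    (fun x hx => by rw [hu.normal i x hx, mul_zero]), neg_neg]

lemma wint_wlap (hR : 0 ≤ R) (hW : ContDiff ℝ 2 W) (hu : Neu R u) :
    wint R W (wlap W u) = 0 := by
  have := wint_mul_wlap hR hW (f := fun _ => 1) contDiff_const hu
  simpa [pd_const, wint] using this

lemma fderiv_apply_of_line {h : Euc n → ℝ} {x : Euc n} (hd : DifferentiableAt ℝ h x)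
    (e : Euc n) (hz : ∀ t : ℝ, h (x + t • e) = 0) : fderiv ℝ h x e = 0 := by
  have h1 : HasDerivAt (fun t : ℝ => x + t • e) e 0 := by
    simpa using ((hasDerivAt_id (0:ℝ)).smul_const e).const_add x
  have h2 : HasFDerivAt h (fderiv ℝ h x) (x + (0:ℝ) • e) := by
    simpa using hd.hasFDerivAt
  have h3 := h2.comp_hasDerivAt (0:ℝ) h1
  have h4 : (h ∘ fun t : ℝ => x + t • e) = fun _ => 0 := by
    ext t; exact hz t
  rw [h4] at h3
  exact h3.unique (hasDerivAt_const _ _)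

lemma Neu.mixed (hu : Neu R u) {i j : Fin n} (hij : i ≠ j) {x : Euc n} (hx : |x j| = R) :
    pd i (pd j u) x = 0 := by
  refine fderiv_apply_of_line (((hu.pd_contDiff j).differentiable (by norm_num)) x) _ fun t => ?_
  apply hu.normal
  simp [hij.symm, hx]

/-- Bochner's identity on the cube. -/
lemma bochner (hR : 0 ≤ R) (hW : ContDiff ℝ 2 W) (hu : Neu R u) :
    wint R W (fun x => wlap W u x ^ 2) =
      wint R W (fun x => ∑ i, ∑ j, pd i (pd j u) x ^ 2) +
      wint R W (fun x => ∑ i, ∑ j, pd i (pd j W) x * (pd i u x * pd j u x)) := by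
  have hW1 : ContDiff ℝ 1 W := hW.of_le (by norm_num)
  have d1 : ∀ i, ContDiff ℝ 1 (pd i u) := fun i => (hu.pd_contDiff i).of_le (by norm_num)
  have d2 : ∀ i j, ContDiff ℝ 1 (pd i (pd j u)) := hu.pd_pd_contDiff
  have dW : ∀ i, ContDiff ℝ 1 (pd i W) := fun i => hW.pd (by norm_num)
  have c2 : ∀ i, Continuous (pd i u) := fun i => (d1 i).continuous
  have c3 : ∀ i j, Continuous (pd i (pd j u)) := fun i j => (d2 i j).continuous
  have c4 : ∀ i, Continuous (pd i W) := fun i => (dW i).continuous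
  have c5 : ∀ i j, Continuous (pd i (pd j W)) := fun i j => continuous_pd (dW j)
  have c6 : ∀ i j k, Continuous (pd i (pd j (pd k u))) := fun i j k => continuous_pd (d2 j k)
  have hcont := hW.continuous
  have e0 : (fun x => wlap W u x ^ 2) = fun x => wlap W u x * wlap W u x := by
    ext x; ring
  rw [e0, wint_mul_wlap hR hW (wlap_contDiff hW hu) hu]
  have e1 : ∀ i x, pd i (wlap W u) x =
      ∑ j, (pd j (pd j (pd i u)) x - pd j W x * pd j (pd i u) x - pd i (pd j W) x * pd j u x) := by
    intro i x
    unfold wlap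
    rw [pd_sum _ (fun j _ => (d2 j j).sub ((dW j).mul (d1 j)))]
    refine Finset.sum_congr rfl fun j _ => ?_
    rw [pd_sub (d2 j j) ((dW j).mul (d1 j)), pd_mul (dW j) (d1 j),
      pd_comm (hu.pd_contDiff j) j]
    have : pd i (pd j u) = pd j (pd i u) := by
      ext y; exact pd_comm (hu.smooth.of_le (by norm_num)) j y
    rw [this]
    ring
  have e2 : (fun x => ∑ i, pd i (wlap W u) x * pd i u x) = fun x =>
      ∑ i, ∑ j, (pd i u x * (pd j (pd j (pd i u)) x - pd j W x * pd j (pd i u) x)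
        - pd i (pd j W) x * (pd i u x * pd j u x)) := by
    ext x
    simp only [e1, Finset.sum_mul]
    refine Finset.sum_congr rfl fun i _ => Finset.sum_congr rfl fun j _ => ?_
    ring
  have e3 : ∀ i j, wint R W (fun x => pd i u x *
      (pd j (pd j (pd i u)) x - pd j W x * pd j (pd i u) x)) =
      -wint R W (fun x => pd j (pd i u) x ^ 2) := by
    intro i j
    have := wint_parts hR hW1 j (d1 i) (d2 j i) (fun x hx => by
      by_cases hij : i = j
      · subst hij; rw [hu.normal i x hx, zero_mul]
      · rw [pd_comm (hu.smooth.of_le (by norm_num)), hu.mixed hij hx, mul_zero])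
    have e : (fun x => pd j (pd i u) x ^ 2) = fun x => pd j (pd i u) x * pd j (pd i u) x := by
      ext x; ring
    rw [e, this, neg_neg]
  rw [e2]
  rw [wint_sum hcont _ (fun i _ => by fun_prop), wint_sum hcont _ (fun i _ => by fun_prop),
    wint_sum hcont _ (fun i _ => by fun_prop), ← Finset.sum_neg_distrib, ← Finset.sum_add_distrib]
  have s1 : ∀ i, wint R W (fun x => ∑ j, (pd i u x *
      (pd j (pd j (pd i u)) x - pd j W x * pd j (pd i u) x)
        - pd i (pd j W) x * (pd i u x * pd j u x))) =
      -∑ j, wint R W (fun x => pd j (pd i u) x ^ 2) -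
        wint R W (fun x => ∑ j, pd i (pd j W) x * (pd i u x * pd j u x)) := by
    intro i
    rw [wint_sum hcont _ (fun i _ => by fun_prop), wint_sum hcont _ (fun i _ => by fun_prop),
      ← Finset.sum_neg_distrib, ← Finset.sum_sub_distrib]
    refine Finset.sum_congr rfl fun j _ => ?_
    rw [wint_sub hcont (by fun_prop) (by fun_prop), e3]
  have s2 : ∀ i, wint R W (fun x => ∑ j, pd i (pd j u) x ^ 2) =
      ∑ j, wint R W (fun x => pd j (pd i u) x ^ 2) := by
    intro i
    rw [wint_sum hcont _ (fun i _ => by fun_prop)]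
    refine Finset.sum_congr rfl fun j _ => ?_
    congr 1; ext x
    rw [pd_comm (hu.smooth.of_le (by norm_num))]
  refine Finset.sum_congr rfl fun i _ => ?_
  rw [s1, s2]
  ring

end parts

section neuSpace

variable {n : ℕ} {R : ℝ} {W u v : Euc n → ℝ}

lemma Neu.zero : Neu R (fun _ : Euc n => 0) :=
  ⟨contDiff_const, fun _ x _ => pd_const 0 x⟩

lemma Neu.smooth_one (hu : Neu R u) : ContDiff ℝ 1 u := hu.smooth.of_le (by norm_num)

lemma Neu.add (hu : Neu R u) (hv : Neu R v) : Neu R (fun x => u x + v x) :=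
  ⟨hu.smooth.add hv.smooth, fun i x hx => by
    rw [pd_add hu.smooth_one hv.smooth_one, hu.normal i x hx, hv.normal i x hx, add_zero]⟩

lemma Neu.const_mul (c : ℝ) (hu : Neu R u) : Neu R (fun x => c * u x) :=
  ⟨contDiff_const.mul hu.smooth, fun i x hx => by
    rw [pd_const_mul c hu.smooth_one, hu.normal i x hx, mul_zero]⟩

lemma wlap_zero_right (x : Euc n) : wlap W (fun _ => 0) x = 0 := by
  have : ∀ i : Fin n, pd i (fun _ : Euc n => (0:ℝ)) = fun _ => 0 := fun i => by
    ext y; exact pd_const 0 y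
  simp [wlap, this]

lemma wlap_add (hu : Neu R u) (hv : Neu R v) (x : Euc n) :
    wlap W (fun x => u x + v x) x = wlap W u x + wlap W v x := by
  have h : ∀ i, pd i (fun x => u x + v x) = fun x => pd i u x + pd i v x := fun i => by
    ext y; exact pd_add hu.smooth_one hv.smooth_one y
  simp only [wlap, h, ← Finset.sum_add_distrib]
  refine Finset.sum_congr rfl fun i _ => ?_
  rw [pd_add ((hu.pd_contDiff i).of_le (by norm_num)) ((hv.pd_contDiff i).of_le (by norm_num))]
  ring

lemma wlap_const_mul (c : ℝ) (hu : Neu R u) (x : Euc n) :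
    wlap W (fun x => c * u x) x = c * wlap W u x := by
  have h : ∀ i, pd i (fun x => c * u x) = fun x => c * pd i u x := fun i => by
    ext y; exact pd_const_mul c hu.smooth_one y
  simp only [wlap, h, Finset.mul_sum]
  refine Finset.sum_congr rfl fun i _ => ?_
  rw [pd_const_mul c ((hu.pd_contDiff i).of_le (by norm_num))]
  ring

end neuSpace

section cosine

variable {n : ℕ} {R : ℝ}

/-- Products of cosines: Neumann eigenfunctions of the cube `[-R, R]ⁿ`. -/
def cosProd (R : ℝ) (m : Fin n → ℤ) (x : Euc n) : ℝ :=
  ∏ i, Real.cos (m i * (Real.pi / (2 * R) * (x i + R)))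

lemma contDiff_cosProd (m : Fin n → ℤ) {k : WithTop ℕ∞} : ContDiff ℝ k (cosProd R m) := by
  unfold cosProd
  refine contDiff_prod fun i _ => ?_
  exact (contDiff_const.mul (contDiff_const.mul ((contDiff_coord i).add contDiff_const))).cos

lemma pd_prod_eq_zero {ι : Type*} (i : Fin n) (s : Finset ι) {F : ι → Euc n → ℝ}
    (hF : ∀ j ∈ s, ContDiff ℝ 1 (F j)) (h : ∀ j ∈ s, ∀ x, pd i (F j) x = 0) (x : Euc n) :
    pd i (fun x => ∏ j ∈ s, F j x) x = 0 := by
  classical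
  induction s using Finset.induction_on with
  | empty => simpa using pd_const 1 x
  | insert a s ha ih =>
    simp only [Finset.prod_insert ha]
    rw [pd_mul (hF a (by simp)) (contDiff_prod fun j hj => hF j (by simp [hj])),
      h a (by simp), ih (fun j hj => hF j (by simp [hj])) (fun j hj => h j (by simp [hj]))]
    simp

lemma contDiff_affine (i : Fin n) (a b : ℝ) {k : WithTop ℕ∞} :
    ContDiff ℝ k (fun x : Euc n => a * (b * (x i + R))) :=
  contDiff_const.mul (contDiff_const.mul ((contDiff_coord i).add contDiff_const))

lemma pd_affine (i j : Fin n) (a b : ℝ) (x : Euc n) :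
    pd i (fun x : Euc n => a * (b * (x j + R))) x = if i = j then a * b else 0 := by
  rw [pd_const_mul a (contDiff_const.mul ((contDiff_coord j).add contDiff_const)),
    pd_const_mul b ((contDiff_coord j).add contDiff_const),
    pd_add (contDiff_coord j) contDiff_const, pd_coord, pd_const]
  split_ifs <;> simp

lemma pd_cosProd (m : Fin n → ℤ) (i : Fin n) (x : Euc n) :
    pd i (cosProd R m) x = -(m i * (Real.pi / (2 * R))) *
      Real.sin (m i * (Real.pi / (2 * R) * (x i + R))) *
        ∏ j ∈ Finset.univ.erase i, Real.cos (m j * (Real.pi / (2 * R) * (x j + R))) := by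
  have e : cosProd R m = fun x => Real.cos (m i * (Real.pi / (2 * R) * (x i + R))) *
      ∏ j ∈ Finset.univ.erase i, Real.cos (m j * (Real.pi / (2 * R) * (x j + R))) := by
    ext x
    exact (Finset.mul_prod_erase _ _ (Finset.mem_univ i)).symm
  rw [e, pd_mul (contDiff_affine i _ _).cos
    (contDiff_prod fun j _ => (contDiff_affine j _ _).cos),
    pd_prod_eq_zero i _ (fun j _ => (contDiff_affine j _ _).cos) (fun j hj x => by
      rw [pd_comp Real.cos (contDiff_affine j _ _) x (Real.hasDerivAt_cos _), pd_affine,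
        if_neg (by simpa [eq_comm] using hj), mul_zero]),
    pd_comp Real.cos (contDiff_affine i _ _) x (Real.hasDerivAt_cos _), pd_affine]
  simp only [if_true]
  ring

lemma pd_pd_cosProd (m : Fin n → ℤ) (i : Fin n) (x : Euc n) :
    pd i (pd i (cosProd R m)) x = -(m i * (Real.pi / (2 * R))) ^ 2 * cosProd R m x := by
  have e : pd i (cosProd R m) = fun x => (-(m i * (Real.pi / (2 * R))) *
      Real.sin (m i * (Real.pi / (2 * R) * (x i + R)))) *
        ∏ j ∈ Finset.univ.erase i, Real.cos (m j * (Real.pi / (2 * R) * (x j + R))) := by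
    ext x; exact pd_cosProd m i x
  rw [e, pd_mul (contDiff_const.mul (contDiff_affine i _ _).sin)
    (contDiff_prod fun j _ => (contDiff_affine j _ _).cos),
    pd_prod_eq_zero i _ (fun j _ => (contDiff_affine j _ _).cos) (fun j hj x => by
      rw [pd_comp Real.cos (contDiff_affine j _ _) x (Real.hasDerivAt_cos _), pd_affine,
        if_neg (by simpa [eq_comm] using hj), mul_zero]),
    pd_const_mul _ (contDiff_affine i _ _).sin,
    pd_comp Real.sin (contDiff_affine i _ _) x (Real.hasDerivAt_sin _), pd_affine,
    cosProd, ← Finset.mul_prod_erase _ _ (Finset.mem_univ i)]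
  simp
  ring

lemma neu_cosProd (hR : 0 < R) (m : Fin n → ℤ) : Neu R (cosProd R m) := by
  refine ⟨contDiff_cosProd m, fun i x hx => ?_⟩
  rw [pd_cosProd]
  have : Real.sin (m i * (Real.pi / (2 * R) * (x i + R))) = 0 := by
    rcases (abs_eq hR.le).1 hx with h | h
    · rw [h]
      have : (m i : ℝ) * (Real.pi / (2 * R) * (R + R)) = m i * Real.pi := by
        field_simp; ring
      rw [this]; exact Real.sin_int_mul_pi _
    · rw [h]; simp
  rw [this]; ring

lemma cosProd_eq_lap (hR : 0 < R) (m : Fin n → ℤ) :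
    ∃ u c, Neu R u ∧ ∀ x, cosProd R m x = (∑ i, pd i (pd i u) x) + c := by
  by_cases hm : ∀ i, m i = 0
  · refine ⟨_, 1, Neu.zero, fun x => ?_⟩
    have : ∀ i : Fin n, pd i (fun _ : Euc n => (0:ℝ)) = fun _ => 0 := fun i => by
      ext y; exact pd_const 0 y
    simp [cosProd, hm, this]
  · push Not at hm
    obtain ⟨i₀, hi₀⟩ := hm
    set lam := ∑ i, (m i * (Real.pi / (2 * R))) ^ 2 with hlam
    have hpos : 0 < lam := by
      refine Finset.sum_pos' (fun i _ => sq_nonneg _) ⟨i₀, Finset.mem_univ _, ?_⟩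
      have : (m i₀ : ℝ) ≠ 0 := by exact_mod_cast hi₀
      have := Real.pi_pos
      positivity
    refine ⟨_, 0, (neu_cosProd hR m).const_mul (-lam⁻¹), fun x => ?_⟩
    have e : ∀ i, pd i (pd i fun x => -lam⁻¹ * cosProd R m x) x =
        (lam⁻¹ * cosProd R m x) * (m i * (Real.pi / (2 * R))) ^ 2 := by
      intro i
      have h : pd i (fun x => -lam⁻¹ * cosProd R m x) = fun x => -lam⁻¹ * pd i (cosProd R m) x := by
        ext y; exact pd_const_mul _ (contDiff_cosProd m) y
      rw [h, pd_const_mul _ (ContDiff.pd (contDiff_cosProd m (k := 2)) (by norm_num)),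
        pd_pd_cosProd]
      ring
    simp only [e, ← Finset.mul_sum, ← hlam]
    field_simp
    simp

/-- `cosProd` as a continuous function on the cube. -/
def cosProdC (R : ℝ) (m : Fin n → ℤ) : C(box n R, ℝ) :=
  ⟨fun x => cosProd R m x, (contDiff_cosProd (k := 0) m).continuous.comp continuous_subtype_val⟩

lemma cos_mul_cosProd (m : Fin n → ℤ) (j : Fin n) (x : Euc n) :
    cosProd R (Pi.single j 1) x * cosProd R m x =
      (1 / 2) * (cosProd R (m + Pi.single j 1) x + cosProd R (m - Pi.single j 1) x) := by
  have e1 : cosProd R (Pi.single j 1) x = Real.cos (Real.pi / (2 * R) * (x j + R)) := by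
    rw [cosProd, Finset.prod_eq_single j]
    · simp
    · intro i _ hi; simp [hi]
    · simp
  have e2 : ∀ m' : Fin n → ℤ, (∀ i, i ≠ j → m' i = m i) → cosProd R m' x =
      Real.cos (m' j * (Real.pi / (2 * R) * (x j + R))) *
        ∏ i ∈ Finset.univ.erase j, Real.cos (m i * (Real.pi / (2 * R) * (x i + R))) := by
    intro m' h
    rw [cosProd, ← Finset.mul_prod_erase _ _ (Finset.mem_univ j)]
    congr 1
    refine Finset.prod_congr rfl fun i hi => ?_
    rw [h i (by simpa using hi)]
  rw [e1, e2 m (fun _ _ => rfl), e2 (m + Pi.single j 1) (fun i hi => by simp [hi]),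
    e2 (m - Pi.single j 1) (fun i hi => by simp [hi])]
  simp only [Pi.add_apply, Pi.sub_apply, Pi.single_eq_same, Int.cast_add, Int.cast_sub,
    Int.cast_one, add_mul, sub_mul, one_mul]
  rw [Real.cos_add, Real.cos_sub]
  ring

lemma adjoin_cos_mul_mem (a : C(box n R, ℝ))
    (ha : a ∈ Algebra.adjoin ℝ (range fun j : Fin n => cosProdC R (Pi.single j 1))) :
    ∀ s ∈ Submodule.span ℝ (range (cosProdC (n := n) R)),
      a * s ∈ Submodule.span ℝ (range (cosProdC (n := n) R)) := by
  induction ha using Algebra.adjoin_induction with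
  | mem a ha =>
    obtain ⟨j, rfl⟩ := ha
    intro s hs
    induction hs using Submodule.span_induction with
    | mem s hs =>
      obtain ⟨m, rfl⟩ := hs
      have : cosProdC R (Pi.single j 1) * cosProdC R m = (1 / 2 : ℝ) •
          (cosProdC R (m + Pi.single j 1) + cosProdC R (m - Pi.single j 1)) := by
        ext x; exact cos_mul_cosProd m j x
      simp only [this]
      exact Submodule.smul_mem _ _ (Submodule.add_mem _ (Submodule.subset_span ⟨_, rfl⟩)
        (Submodule.subset_span ⟨_, rfl⟩))
    | zero => simp
    | add s t _ _ h1 h2 => rw [mul_add]; exact Submodule.add_mem _ h1 h2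
    | smul c s _ h => rw [mul_smul_comm]; exact Submodule.smul_mem _ _ h
  | algebraMap c =>
    intro s hs
    rw [← Algebra.smul_def]; exact Submodule.smul_mem _ _ hs
  | add a b _ _ h1 h2 =>
    intro s hs
    rw [add_mul]; exact Submodule.add_mem _ (h1 s hs) (h2 s hs)
  | mul a b _ _ h1 h2 =>
    intro s hs
    rw [mul_assoc]; exact h1 _ (h2 s hs)

/-- Uniform density of `Δu + c`, with `u` Neumann, on the cube. -/
lemma exists_neu_lap_near (hR : 0 < R) {G : Euc n → ℝ} (hG : Continuous G) {ε : ℝ} (hε : 0 < ε) :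
    ∃ u c, Neu R u ∧ ∀ x ∈ box n R, |(∑ i, pd i (pd i u) x) + c - G x| < ε := by
  have : CompactSpace (box n R) := isCompact_iff_compactSpace.1 (isCompact_box n R)
  have hsep : (Algebra.adjoin ℝ
      (range fun j : Fin n => cosProdC R (Pi.single j 1))).SeparatesPoints := by
    intro x y hxy
    obtain ⟨j, hj⟩ : ∃ j, x.1 j ≠ y.1 j := by
      by_contra! h
      exact hxy (Subtype.ext (by ext j; exact h j))
    refine ⟨_, ⟨_, Algebra.subset_adjoin ⟨j, rfl⟩, rfl⟩, ?_⟩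
    have e1 : ∀ x : Euc n, cosProd R (Pi.single j 1) x =
        Real.cos (Real.pi / (2 * R) * (x j + R)) := by
      intro x
      rw [cosProd, Finset.prod_eq_single j]
      · simp
      · intro i _ hi; simp [hi]
      · simp
    have hmem : ∀ z : box n R, Real.pi / (2 * R) * (z.1 j + R) ∈ Icc 0 Real.pi := by
      intro z
      have hz := abs_le.1 (z.2 j)
      have hpi := Real.pi_pos
      constructor
      · exact mul_nonneg (by positivity) (by linarith)
      · rw [div_mul_eq_mul_div, div_le_iff₀ (by positivity)]
        nlinarith
    intro h
    have h' : cosProd R (Pi.single j 1) x.1 = cosProd R (Pi.single j 1) y.1 := h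
    rw [e1, e1] at h'
    have h2 := Real.injOn_cos (hmem x) (hmem y) h'
    have hpi : Real.pi / (2 * R) ≠ 0 := by have := Real.pi_pos; positivity
    exact hj (by have := mul_left_cancel₀ hpi h2; linarith)
  obtain ⟨g, hg⟩ := ContinuousMap.exists_mem_subalgebra_near_continuous_of_separatesPoints _ hsep
    (fun x : box n R => G x) (hG.comp continuous_subtype_val) ε hε
  have hone : (1 : C(box n R, ℝ)) ∈ Submodule.span ℝ (range (cosProdC (n := n) R)) := by
    refine Submodule.subset_span ⟨0, ?_⟩
    ext x; simp [cosProdC, cosProd]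
  have hgm := adjoin_cos_mul_mem g.1 g.2 1 hone
  rw [mul_one] at hgm
  have key : ∀ f ∈ Submodule.span ℝ (range (cosProdC (n := n) R)),
      ∃ (u : Euc n → ℝ) (c : ℝ), Neu R u ∧ ∀ x : box n R, f x = (∑ i, pd i (pd i u) x.1) + c := by
    have hz : ∀ (u : Euc n → ℝ) x, wlap (fun _ => 0) u x = ∑ i, pd i (pd i u) x := by
      intro u x
      simp [wlap, pd_const]
    simp only [← hz]
    intro f hf
    induction hf using Submodule.span_induction with
    | mem f hf =>
      obtain ⟨m, rfl⟩ := hf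
      obtain ⟨u, c, h1, h2⟩ := cosProd_eq_lap hR m
      exact ⟨u, c, h1, fun x => by rw [hz]; exact h2 x⟩
    | zero => exact ⟨_, 0, Neu.zero, fun x => by rw [wlap_zero_right]; simp⟩
    | add f g _ _ h1 h2 =>
      obtain ⟨u, c, hu, hf⟩ := h1
      obtain ⟨v, d, hv, hg⟩ := h2
      refine ⟨_, c + d, hu.add hv, fun x => ?_⟩
      rw [wlap_add hu hv, ContinuousMap.add_apply, hf, hg]; ring
    | smul a f _ h =>
      obtain ⟨u, c, hu, hf⟩ := h
      refine ⟨_, a * c, hu.const_mul a, fun x => ?_⟩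
      rw [wlap_const_mul a hu, ContinuousMap.smul_apply, hf, smul_eq_mul]; ring
  obtain ⟨u, c, hu, h⟩ := key _ hgm
  refine ⟨u, c, hu, fun x hx => ?_⟩
  have := hg ⟨x, hx⟩
  rw [Real.norm_eq_abs] at this
  rw [← h ⟨x, hx⟩]
  exact this

end cosine

section continuityMethod

variable {n : ℕ} {R : ℝ} {W u v f g : Euc n → ℝ}

/-- The Hessian of `W` is positive semidefinite. -/
def HessNonneg {n : ℕ} (W : Euc n → ℝ) : Prop :=
  ∀ (x : Euc n) (v : Fin n → ℝ), 0 ≤ ∑ i, ∑ j, pd i (pd j W) x * (v i * v j)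

/-- The `L²` norm on the cube. -/
def boxNorm (R : ℝ) (f : Euc n → ℝ) : ℝ := √(wint R (fun _ => 0) (fun x => f x ^ 2))

lemma boxNorm_nonneg : 0 ≤ boxNorm R f := Real.sqrt_nonneg _

lemma boxNorm_sq : boxNorm R f ^ 2 = wint R (fun _ => 0) (fun x => f x ^ 2) :=
  Real.sq_sqrt wint_sq_nonneg

lemma boxNorm_add_le (hf : Continuous f) (hg : Continuous g) :
    boxNorm R (fun x => f x + g x) ≤ boxNorm R f + boxNorm R g := by
  refine Real.sqrt_le_iff.2 ⟨add_nonneg boxNorm_nonneg boxNorm_nonneg, ?_⟩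
  have h0 : Continuous (fun _ : Euc n => (0:ℝ)) := continuous_const
  have e : (fun x => (f x + g x) ^ 2) = fun x => (f x ^ 2 + 2 * (f x * g x)) + g x ^ 2 := by
    ext x; ring
  rw [e, wint_add h0 (by fun_prop) (by fun_prop), wint_add h0 (by fun_prop) (by fun_prop),
    wint_const_mul, add_sq, boxNorm_sq, boxNorm_sq]
  have := (le_abs_self _).trans (abs_wint_mul_le (R := R) h0 hf hg)
  change _ ≤ boxNorm R f * boxNorm R g at this
  linarith

lemma boxNorm_const_mul (c : ℝ) : boxNorm R (fun x => c * f x) = |c| * boxNorm R f := by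
  simp only [boxNorm, mul_pow]
  rw [wint_const_mul, Real.sqrt_mul (sq_nonneg c), Real.sqrt_sq_eq_abs]

lemma pd_const_mul_fun (s : ℝ) (hW : ContDiff ℝ 1 W) (i : Fin n) :
    pd i (fun x => s * W x) = fun x => s * pd i W x := by
  ext x; exact pd_const_mul s hW x

lemma HessNonneg.const_mul (hW : ContDiff ℝ 2 W) (h : HessNonneg W) {s : ℝ} (hs : 0 ≤ s) :
    HessNonneg (fun x => s * W x) := by
  intro x v
  have e : ∀ i j, pd i (pd j fun x => s * W x) x = s * pd i (pd j W) x := fun i j => by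
    rw [pd_const_mul_fun s (hW.of_le (by norm_num)), pd_const_mul s (hW.pd (by norm_num))]
  simp only [e, mul_assoc, ← Finset.mul_sum]
  exact mul_nonneg hs (h x v)

/-- A one-dimensional Poincaré inequality for functions vanishing on two opposite faces. -/
lemma wint_sq_le_of_vanish (hR : 0 ≤ R) (i : Fin n) (hf : ContDiff ℝ 1 f)
    (h : ∀ x, |x i| = R → f x = 0) :
    wint R (fun _ => 0) (fun x => f x ^ 2) ≤
      4 * R ^ 2 * wint R (fun _ => 0) (fun x => pd i f x ^ 2) := by
  have h0 : Continuous (fun _ : Euc n => (0:ℝ)) := continuous_const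
  have cf := hf.continuous
  have cd := continuous_pd (i := i) hf
  have cx : Continuous fun x : Euc n => x i := (contDiff_coord (k := 0) i).continuous
  have key := integral_pd_eq_zero hR i (F := fun x => x i * (f x * f x))
    ((contDiff_coord i).mul (hf.mul hf)) (fun x hx => by rw [h x hx]; ring)
  have e : ∀ x : Euc n, pd i (fun x => x i * (f x * f x)) x =
      (f x ^ 2 + 2 * (x i * (f x * pd i f x))) := by
    intro x
    rw [pd_mul (contDiff_coord i) (hf.mul hf), pd_coord, pd_mul hf hf]
    simp; ring
  simp only [e] at key
  have key' : wint R (fun _ => 0) (fun x => f x ^ 2 + 2 * (x i * (f x * pd i f x))) = 0 := by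
    simpa [wint] using key
  have hle : wint R (fun _ => 0) (fun x => 2⁻¹ * f x ^ 2 - 2 * R ^ 2 * pd i f x ^ 2) ≤
      wint R (fun _ => 0) (fun x => f x ^ 2 + 2 * (x i * (f x * pd i f x))) := by
    refine wint_mono h0 (by fun_prop) (by fun_prop) fun x hx => ?_
    have hx2 : (x i) ^ 2 ≤ R ^ 2 := sq_le_sq' (by linarith [(abs_le.1 (hx i)).1]) (abs_le.1 (hx i)).2
    nlinarith [sq_nonneg (f x + 2 * (x i * pd i f x)), mul_le_mul_of_nonneg_right hx2
      (sq_nonneg (pd i f x))]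
  rw [key', wint_sub h0 (by fun_prop) (by fun_prop), wint_const_mul] at hle
  rw [show (fun x => 2 * R ^ 2 * pd i f x ^ 2) = fun x => (2 * R ^ 2) * pd i f x ^ 2 from rfl,
    wint_const_mul] at hle
  linarith

lemma wint_weight_le {B : ℝ} (hW : Continuous W) (hf : Continuous f) (hB : ∀ x ∈ box n R, |W x| ≤ B)
    (h : ∀ x, 0 ≤ f x) :
    wint R W f ≤ Real.exp B * wint R (fun _ => 0) f ∧
      Real.exp (-B) * wint R (fun _ => 0) f ≤ wint R W f := by
  have hE : Continuous fun x => Real.exp (-W x) := Real.continuous_exp.comp hW.neg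
  simp only [wint]
  rw [← integral_const_mul, ← integral_const_mul]
  constructor
  · refine setIntegral_mono_on (integrableOn_box (by fun_prop)) (integrableOn_box (by fun_prop))
      (measurableSet_box n R) fun x hx => ?_
    have := Real.exp_le_exp.2 (show -W x ≤ B by linarith [(abs_le.1 (hB x hx)).1])
    simp only [neg_zero, Real.exp_zero, mul_one]
    nlinarith [h x]
  · refine setIntegral_mono_on (integrableOn_box (by fun_prop)) (integrableOn_box (by fun_prop))
      (measurableSet_box n R) fun x hx => ?_
    have := Real.exp_le_exp.2 (show -B ≤ -W x by linarith [(abs_le.1 (hB x hx)).2])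
    simp only [neg_zero, Real.exp_zero, mul_one]
    nlinarith [h x]

lemma wint_sq_add_const (hW : Continuous W) (hf : Continuous f) (h : wint R W f = 0) (c : ℝ) :
    wint R W (fun x => (f x + c) ^ 2) =
      wint R W (fun x => f x ^ 2) + c ^ 2 * wint R W (fun _ => 1) := by
  have e : (fun x => (f x + c) ^ 2) = fun x => (f x ^ 2 + (2 * c) * f x) + c ^ 2 := by
    ext x; ring
  rw [e, wint_add hW (by fun_prop) (by fun_prop), wint_add hW (by fun_prop) (by fun_prop),
    wint_const_mul, h, wint_const (c ^ 2)]
  ring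

/-- A priori gradient bound. -/
lemma wint_grad_le (hR : 0 < R) (hW : ContDiff ℝ 2 W) (hH : HessNonneg W) (hu : Neu R u) {B : ℝ}
    (hB : ∀ x ∈ box n R, |W x| ≤ B) (c : ℝ) :
    wint R (fun _ => 0) (fun x => ∑ i, pd i u x ^ 2) ≤
      4 * R ^ 2 * Real.exp (2 * B) * boxNorm R (fun x => wlap W u x + c) ^ 2 := by
  have h0 : Continuous (fun _ : Euc n => (0:ℝ)) := continuous_const
  have hc := hW.continuous
  have d1 : ∀ i, ContDiff ℝ 1 (pd i u) := fun i => (hu.pd_contDiff i).of_le (by norm_num)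
  have c2 : ∀ i, Continuous (pd i u) := fun i => (d1 i).continuous
  have c3 : ∀ i j, Continuous (pd i (pd j u)) := fun i j => continuous_pd (d1 j)
  have cl : Continuous (wlap W u) := (wlap_contDiff hW hu).continuous
  have s1 : wint R (fun _ => 0) (fun x => ∑ i, pd i u x ^ 2) ≤
      4 * R ^ 2 * wint R (fun _ => 0) (fun x => ∑ i, pd i (pd i u) x ^ 2) := by
    rw [wint_sum h0 _ (fun i _ => by fun_prop), wint_sum h0 _ (fun i _ => by fun_prop),
      Finset.mul_sum]
    exact Finset.sum_le_sum fun i _ => wint_sq_le_of_vanish hR.le i (d1 i) (hu.normal i)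
  have s2 : wint R (fun _ => 0) (fun x => ∑ i, pd i (pd i u) x ^ 2) ≤
      wint R (fun _ => 0) (fun x => ∑ i, ∑ j, pd i (pd j u) x ^ 2) := by
    refine wint_mono h0 (by fun_prop) (by fun_prop) fun x _ => Finset.sum_le_sum fun i _ => ?_
    exact Finset.single_le_sum (f := fun j => pd i (pd j u) x ^ 2) (fun j _ => sq_nonneg _)
      (Finset.mem_univ i)
  have s3 := (wint_weight_le (R := R) hc (f := fun x => ∑ i, ∑ j, pd i (pd j u) x ^ 2) (by fun_prop)
    hB (fun x => Finset.sum_nonneg fun i _ => Finset.sum_nonneg fun j _ => sq_nonneg _)).2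
  have s4 := bochner hR.le hW hu
  have s5 : 0 ≤ wint R W (fun x => ∑ i, ∑ j, pd i (pd j W) x * (pd i u x * pd j u x)) :=
    wint_nonneg fun x _ => hH x fun i => pd i u x
  have s6 := wint_sq_add_const hc cl (wint_wlap hR.le hW hu) c
  have s6' : 0 ≤ wint R W (fun _ => 1) := wint_nonneg fun _ _ => zero_le_one
  have s7 := (wint_weight_le (R := R) hc (f := fun x => (wlap W u x + c) ^ 2) (by fun_prop)
    hB (fun x => sq_nonneg _)).1
  rw [boxNorm_sq]
  set X := wint R (fun _ => 0) (fun x => ∑ i, ∑ j, pd i (pd j u) x ^ 2)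
  set Y := wint R (fun _ => 0) (fun x => (wlap W u x + c) ^ 2)
  have s8 : Real.exp (-B) * X ≤ Real.exp B * Y := by nlinarith [mul_nonneg (sq_nonneg c) s6']
  have s9 : X ≤ Real.exp (2 * B) * Y := by
    have := mul_le_mul_of_nonneg_left s8 (Real.exp_pos B).le
    rw [← mul_assoc, ← mul_assoc, ← Real.exp_add, ← Real.exp_add] at this
    simpa [two_mul] using this
  calc _ ≤ 4 * R ^ 2 * X := s1.trans (mul_le_mul_of_nonneg_left s2 (by positivity))
    _ ≤ 4 * R ^ 2 * (Real.exp (2 * B) * Y) := mul_le_mul_of_nonneg_left s9 (by positivity)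
    _ = _ := by ring

/-- The range of `u ↦ Δu - ⟨∇W, ∇u⟩ + c` is `L²`-dense. -/
def WlapDense (R : ℝ) (W : Euc n → ℝ) : Prop :=
  ∀ G : Euc n → ℝ, Continuous G → ∀ ε > 0, ∃ u c, Neu R u ∧
    boxNorm R (fun x => wlap W u x + c - G x) ≤ ε

lemma wlap_const_mul_weight (s : ℝ) (hW : ContDiff ℝ 1 W) (x : Euc n) :
    wlap (fun x => s * W x) u x = (∑ i, pd i (pd i u) x) - s * ∑ i, pd i W x * pd i u x := by
  simp only [wlap, pd_const_mul_fun s hW, Finset.sum_sub_distrib, Finset.mul_sum, mul_assoc]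

lemma wlapDense_zero (hR : 0 < R) (hW : ContDiff ℝ 2 W) : WlapDense R (fun x => 0 * W x) := by
  intro G hG ε hε
  have h0 : Continuous (fun _ : Euc n => (0:ℝ)) := continuous_const
  set T := wint R (fun _ => 0) (fun _ : Euc n => 1) with hT
  have hTn : 0 ≤ T := wint_nonneg fun _ _ => zero_le_one
  obtain ⟨u, c, hu, h⟩ := exists_neu_lap_near hR hG (ε := ε / (√T + 1)) (by positivity)
  have c3 : ∀ i j, Continuous (pd i (pd j u)) := fun i j => (hu.pd_pd_contDiff i j).continuous
  refine ⟨u, c, hu, ?_⟩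
  have hle : wint R (fun _ => 0) (fun x => (wlap (fun x => 0 * W x) u x + c - G x) ^ 2) ≤
      wint R (fun _ => 0) (fun _ : Euc n => (ε / (√T + 1)) ^ 2) := by
    have e : ∀ x, wlap (fun x => 0 * W x) u x = ∑ i, pd i (pd i u) x := fun x => by
      rw [wlap_const_mul_weight 0 (hW.of_le (by norm_num)), zero_mul, sub_zero]
    simp only [e]
    refine wint_mono h0 (by fun_prop) (by fun_prop) fun x hx => ?_
    rw [← sq_abs]
    exact pow_le_pow_left₀ (abs_nonneg _) (h x hx).le 2
  rw [wint_const ((ε / (√T + 1)) ^ 2), ← hT] at hle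
  refine Real.sqrt_le_iff.2 ⟨hε.le, hle.trans ?_⟩
  have h1 : T ≤ (√T + 1) ^ 2 := by
    nlinarith [Real.sq_sqrt hTn, Real.sqrt_nonneg T]
  rw [div_pow, div_mul_eq_mul_div, div_le_iff₀ (by positivity)]
  exact mul_le_mul_of_nonneg_left h1 (by positivity)

lemma wlapDense_step (hR : 0 < R) (hW : ContDiff ℝ 2 W) (hH : HessNonneg W) {B D : ℝ}
    (hB : ∀ x ∈ box n R, |W x| ≤ B)
    (hD : ∀ x ∈ box n R, ∑ i, pd i W x ^ 2 ≤ D ^ 2) (hD0 : 0 ≤ D)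
    {s t : ℝ} (hs : s ∈ Icc (0:ℝ) 1)
    (hst : |s - t| * (D * (2 * R * Real.exp B)) ≤ 1 / 2)
    (hP : WlapDense R (fun x => s * W x)) : WlapDense R (fun x => t * W x) := by
  have h0 : Continuous (fun _ : Euc n => (0:ℝ)) := continuous_const
  have hW1 : ContDiff ℝ 1 W := hW.of_le (by norm_num)
  have cW : ∀ i, Continuous (pd i W) := fun i => continuous_pd hW1
  have hsmul : ∀ s : ℝ, ContDiff ℝ 2 (fun x => s * W x) := fun s => contDiff_const.mul hW
  have clap : ∀ (s : ℝ) {u : Euc n → ℝ}, Neu R u → Continuous (wlap (fun x => s * W x) u) :=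
    fun s u hu => (wlap_contDiff (hsmul s) hu).continuous
  have step : ∀ G : Euc n → ℝ, Continuous G → ∃ u c, Neu R u ∧
      boxNorm R (fun x => G x - (wlap (fun x => t * W x) u x + c)) ≤ 3 / 4 * boxNorm R G := by
    intro G hG
    rcases (boxNorm_nonneg (R := R) (f := G)).eq_or_lt with hz | hpos
    · refine ⟨_, 0, Neu.zero, ?_⟩
      simp only [wlap_zero_right, add_zero, sub_zero]
      rw [← hz]; simp
    · obtain ⟨u, c, hu, h⟩ := hP G hG (boxNorm R G / 8) (by positivity)
      refine ⟨u, c, hu, ?_⟩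
      have c2 : ∀ i, Continuous (pd i u) := fun i => (hu.pd_contDiff i).continuous
      have cs := clap s hu
      have ct := clap t hu
      have hBs : ∀ x ∈ box n R, |s * W x| ≤ B := fun x hx => by
        rw [abs_mul, abs_of_nonneg hs.1]
        exact (mul_le_of_le_one_left (abs_nonneg _) hs.2).trans (hB x hx)
      have hgrad := wint_grad_le hR (hsmul s) (hH.const_mul hW hs.1) hu hBs c
      set N := boxNorm R (fun x => wlap (fun x => s * W x) u x + c) with hN
      have hN0 : 0 ≤ N := boxNorm_nonneg
      have hNle : N ≤ 9 / 8 * boxNorm R G := by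
        have := boxNorm_add_le (R := R)
          (f := fun x => wlap (fun x => s * W x) u x + c - G x) (g := G) (by fun_prop) hG
        simp only [sub_add_cancel] at this
        linarith
      have hT : boxNorm R (fun x => ∑ i, pd i W x * pd i u x) ≤ D * (2 * R * Real.exp B) * N := by
        refine Real.sqrt_le_iff.2 ⟨by positivity, ?_⟩
        have h1 : wint R (fun _ => 0) (fun x => (∑ i, pd i W x * pd i u x) ^ 2) ≤
            wint R (fun _ => 0) (fun x => D ^ 2 * ∑ i, pd i u x ^ 2) := by
          refine wint_mono h0 (by fun_prop) (by fun_prop) fun x hx => ?_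
          refine (Finset.sum_mul_sq_le_sq_mul_sq _ _ _).trans ?_
          exact mul_le_mul_of_nonneg_right (hD x hx) (Finset.sum_nonneg fun i _ => sq_nonneg _)
        rw [wint_const_mul] at h1
        have hexp : Real.exp (2 * B) = Real.exp B ^ 2 := by
          rw [← Real.exp_nat_mul]; norm_num
        rw [hexp] at hgrad
        nlinarith [mul_le_mul_of_nonneg_left hgrad (sq_nonneg D)]
      have e : (fun x => G x - (wlap (fun x => t * W x) u x + c)) = fun x =>
          (-1) * (wlap (fun x => s * W x) u x + c - G x) +
            (t - s) * (∑ i, pd i W x * pd i u x) := by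
        ext x
        rw [wlap_const_mul_weight _ hW1, wlap_const_mul_weight _ hW1]; ring
      rw [e]
      refine (boxNorm_add_le (by fun_prop) (by fun_prop)).trans ?_
      rw [boxNorm_const_mul, boxNorm_const_mul]
      have h3 : |t - s| * boxNorm R (fun x => ∑ i, pd i W x * pd i u x) ≤ 1 / 2 * N := by
        refine (mul_le_mul_of_nonneg_left hT (abs_nonneg _)).trans ?_
        rw [← mul_assoc, abs_sub_comm]
        exact mul_le_mul_of_nonneg_right hst hN0
      simp only [abs_neg, abs_one, one_mul]
      linarith
  intro G hG ε hε
  have iter : ∀ k : ℕ, ∃ u c, Neu R u ∧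
      boxNorm R (fun x => G x - (wlap (fun x => t * W x) u x + c)) ≤
        (3 / 4) ^ k * boxNorm R G := by
    intro k
    induction k with
    | zero =>
      refine ⟨_, 0, Neu.zero, ?_⟩
      simp [wlap_zero_right]
    | succ k ih =>
      obtain ⟨u, c, hu, h⟩ := ih
      have ct := clap t hu
      obtain ⟨v, d, hv, h'⟩ := step (fun x => G x - (wlap (fun x => t * W x) u x + c))
        (by fun_prop)
      refine ⟨_, c + d, hu.add hv, ?_⟩
      have e : (fun x => G x - (wlap (fun x => t * W x) (fun x => u x + v x) x + (c + d))) =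
          fun x => G x - (wlap (fun x => t * W x) u x + c) -
            (wlap (fun x => t * W x) v x + d) := by
        ext x; rw [wlap_add hu hv]; ring
      rw [e, pow_succ]
      nlinarith
  have hlim : Tendsto (fun k : ℕ => (3 / 4 : ℝ) ^ k * boxNorm R G) atTop (𝓝 (0 * boxNorm R G)) :=
    (tendsto_pow_atTop_nhds_zero_of_lt_one (by norm_num) (by norm_num)).mul_const _
  rw [zero_mul] at hlim
  obtain ⟨k, hk⟩ := (hlim.eventually_lt_const hε).exists
  obtain ⟨u, c, hu, h⟩ := iter k
  refine ⟨u, c, hu, ?_⟩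
  have e : (fun x => wlap (fun x => t * W x) u x + c - G x) =
      fun x => (-1) * (G x - (wlap (fun x => t * W x) u x + c)) := by ext x; ring
  rw [e, boxNorm_const_mul]
  simp only [abs_neg, abs_one, one_mul]
  linarith

lemma wlapDense_of_hessNonneg (hR : 0 < R) (hW : ContDiff ℝ 2 W) (hH : HessNonneg W) : WlapDense R W := by
  have hW1 : ContDiff ℝ 1 W := hW.of_le (by norm_num)
  have cW : ∀ i, Continuous (pd i W) := fun i => continuous_pd hW1
  obtain ⟨B, hB⟩ := (isCompact_box n R).exists_bound_of_continuousOn hW.continuous.continuousOn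
  obtain ⟨D, hD⟩ := (isCompact_box n R).exists_bound_of_continuousOn
    (f := fun x => √(∑ i, pd i W x ^ 2)) (by fun_prop)
  have hD' : ∀ x ∈ box n R, ∑ i, pd i W x ^ 2 ≤ |D| ^ 2 := by
    intro x hx
    have h1 := hD x hx
    rw [Real.norm_eq_abs, abs_of_nonneg (Real.sqrt_nonneg _)] at h1
    have h2 : √(∑ i, pd i W x ^ 2) ≤ |D| := h1.trans (le_abs_self D)
    exact (Real.sqrt_le_left (abs_nonneg D)).1 h2
  set C := |D| * (2 * R * Real.exp B)
  have hC : 0 ≤ C := by positivity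
  obtain ⟨m, hm⟩ := exists_nat_gt (2 * C)
  have hm0 : (0:ℝ) < m := by linarith
  have main : ∀ k : ℕ, k ≤ m → WlapDense R (fun x => ((k:ℝ) / m) * W x) := by
    intro k
    induction k with
    | zero => intro _; simpa using wlapDense_zero hR hW
    | succ k ih =>
      intro hk
      have hkm : (k:ℝ) ≤ m := by exact_mod_cast (Nat.le_succ k).trans hk
      refine wlapDense_step hR hW hH hB hD' (abs_nonneg D) (s := (k:ℝ) / m)
        ⟨by positivity, (div_le_one hm0).2 hkm⟩ ?_ (ih ((Nat.le_succ k).trans hk))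
      have : (k:ℝ) / m - ((k + 1 : ℕ) : ℝ) / m = -(1 / m) := by push_cast; ring
      rw [this, abs_neg, abs_of_pos (by positivity), div_mul_eq_mul_div, one_mul,
        div_le_iff₀ hm0]
      change C ≤ _
      linarith
  have := main m le_rfl
  rw [div_self hm0.ne'] at this
  simpa using this

end continuityMethod

section poincare

variable {n : ℕ} {R : ℝ} {W u v f g : Euc n → ℝ}

lemma neg_mem_box {x : Euc n} : -x ∈ box n R ↔ x ∈ box n R := by
  simp [box]

lemma setIntegral_box_neg (g : Euc n → ℝ) :
    ∫ x in box n R, g (-x) = ∫ x in box n R, g x := by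
  rw [← (Measure.measurePreserving_neg (volume : Measure (Euc n))).setIntegral_preimage_emb
    (MeasurableEquiv.neg (Euc n)).measurableEmbedding g (box n R)]
  have : Neg.neg ⁻¹' box n R = box n R := by ext x; exact neg_mem_box
  rw [this]

lemma wint_comp_neg (hWe : ∀ x, W (-x) = W x) (f : Euc n → ℝ) :
    wint R W (fun x => f (-x)) = wint R W f := by
  rw [wint, wint, ← setIntegral_box_neg]
  simp only [neg_neg, hWe]

lemma wint_odd (hWe : ∀ x, W (-x) = W x) (hf : ∀ x, f (-x) = -f x) : wint R W f = 0 := by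
  have := wint_comp_neg (R := R) hWe f
  simp only [hf, wint_neg] at this
  linarith

lemma pd_comp_neg (f : Euc n → ℝ) (i : Fin n) (x : Euc n) :
    pd i (fun x => f (-x)) x = -pd i f (-x) := by
  have h := (ContinuousLinearEquiv.neg ℝ (M := Euc n)).comp_right_fderiv (f := f) (x := x)
  have h' : fderiv ℝ (fun x => f (-x)) x = _ := h
  rw [pd, h']
  simp [pd]

lemma pd_neg_of_even (hf : ∀ x, f (-x) = f x) (i : Fin n) (x : Euc n) :
    pd i f (-x) = -pd i f x := by
  have := pd_comp_neg f i x
  simp only [hf] at this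
  linarith

lemma Neu.comp_neg (hu : Neu R u) : Neu R (fun x => u (-x)) :=
  ⟨hu.smooth.comp contDiff_neg, fun i x hx => by
    rw [pd_comp_neg, hu.normal i (-x) (by simpa using hx), neg_zero]⟩

lemma wlap_comp_neg (hWe : ∀ x, W (-x) = W x) (hu : Neu R u) (x : Euc n) :
    wlap W (fun x => u (-x)) x = wlap W u (-x) := by
  have h : ∀ i, pd i (fun x => u (-x)) = fun x => (-1) * (fun y => pd i u (-y)) x := fun i => by
    ext y; rw [pd_comp_neg]; ring
  refine Finset.sum_congr rfl fun i _ => ?_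
  have hs : ContDiff ℝ 1 fun y => pd i u (-y) :=
    ((hu.pd_contDiff i).of_le (by norm_num)).comp contDiff_neg
  rw [h, pd_const_mul _ hs, pd_comp_neg, pd_neg_of_even hWe]
  ring

lemma exists_neu_solution (hR : 0 < R) (hW : ContDiff ℝ 2 W) (hH : HessNonneg W)
    (hg : Continuous g) (hg0 : wint R W g = 0) {ε : ℝ} (hε : 0 < ε) :
    ∃ u, Neu R u ∧ wint R W (fun x => (wlap W u x - g x) ^ 2) ≤ ε := by
  obtain ⟨B, hB⟩ := (isCompact_box n R).exists_bound_of_continuousOn hW.continuous.continuousOn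
  obtain ⟨u, c, hu, h⟩ := wlapDense_of_hessNonneg hR hW hH g hg (√(ε * Real.exp (-B))) (by positivity)
  refine ⟨u, hu, ?_⟩
  have cl : Continuous (wlap W u) := (wlap_contDiff hW hu).continuous
  have h1 : boxNorm R (fun x => wlap W u x + c - g x) ^ 2 ≤ ε * Real.exp (-B) := by
    refine (pow_le_pow_left₀ boxNorm_nonneg h 2).trans (Real.sq_sqrt (by positivity)).le
  rw [boxNorm_sq] at h1
  have h2 := (wint_weight_le (R := R) hW.continuous (f := fun x => (wlap W u x + c - g x) ^ 2)
    (by fun_prop) hB fun x => sq_nonneg _).1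
  have h3 : wint R W (fun x => (wlap W u x + c - g x) ^ 2) ≤ ε := by
    refine h2.trans ((mul_le_mul_of_nonneg_left h1 (Real.exp_pos B).le).trans ?_)
    rw [mul_comm ε, ← mul_assoc, ← Real.exp_add]; simp
  have h4 : wint R W (fun x => wlap W u x - g x) = 0 := by
    rw [wint_sub hW.continuous cl hg, wint_wlap hR.le hW hu, hg0, sub_zero]
  have h5 := wint_sq_add_const (R := R) hW.continuous (f := fun x => wlap W u x - g x)
    (by fun_prop) h4 c
  have e : (fun x => (wlap W u x - g x + c) ^ 2) = fun x => (wlap W u x + c - g x) ^ 2 := by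
    ext x; ring
  rw [e] at h5
  have h6 : 0 ≤ wint R W (fun _ => 1) := wint_nonneg fun _ _ => zero_le_one
  nlinarith [mul_nonneg (sq_nonneg c) h6]

lemma exists_even_neu_solution (hR : 0 < R) (hW : ContDiff ℝ 2 W) (hWe : ∀ x, W (-x) = W x)
    (hH : HessNonneg W) (hg : Continuous g) (hge : ∀ x, g (-x) = g x) (hg0 : wint R W g = 0)
    {ε : ℝ} (hε : 0 < ε) :
    ∃ u, Neu R u ∧ (∀ x, u (-x) = u x) ∧ wint R W (fun x => (wlap W u x - g x) ^ 2) ≤ ε := by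
  obtain ⟨u, hu, h⟩ := exists_neu_solution hR hW hH hg hg0 hε
  have cl : Continuous (wlap W u) := (wlap_contDiff hW hu).continuous
  refine ⟨_, (hu.add hu.comp_neg).const_mul (1 / 2), fun x => by rw [neg_neg, add_comm], ?_⟩
  have h1 := wint_comp_neg (R := R) hWe (fun x => (wlap W u x - g x) ^ 2)
  simp only [hge] at h1
  have hle : wint R W (fun x =>
      (wlap W (fun x => 1 / 2 * (u x + u (-x))) x - g x) ^ 2) ≤
      wint R W (fun x => 1 / 2 * (wlap W u x - g x) ^ 2 + 1 / 2 * (wlap W u (-x) - g x) ^ 2) := by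
    have e : ∀ x, wlap W (fun x => 1 / 2 * (u x + u (-x))) x =
        1 / 2 * (wlap W u x + wlap W u (-x)) := fun x => by
      rw [wlap_const_mul _ (hu.add hu.comp_neg), wlap_add hu hu.comp_neg, wlap_comp_neg hWe hu]
    simp only [e]
    refine wint_mono hW.continuous (by fun_prop) (by fun_prop) fun x _ => ?_
    nlinarith [sq_nonneg (wlap W u x - wlap W u (-x))]
  rw [wint_add hW.continuous (by fun_prop) (by fun_prop), wint_const_mul, wint_const_mul, h1] at hle
  linarith

/-- The Hessian quadratic form of `W`. -/
def hessForm {n : ℕ} (W : Euc n → ℝ) (x : Euc n) (v : Fin n → ℝ) : ℝ :=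
  ∑ i, ∑ j, pd i (pd j W) x * (v i * v j)

lemma continuous_hessForm (hW : ContDiff ℝ 2 W) {v : Fin n → Euc n → ℝ}
    (hv : ∀ i, Continuous (v i)) : Continuous (fun x => hessForm W x (fun i => v i x)) := by
  have c : ∀ i j, Continuous (pd i (pd j W)) := fun i j =>
    continuous_pd (hW.pd (by norm_num))
  unfold hessForm
  fun_prop

/-- A dual criterion for variance bounds. -/
lemma wint_sq_le_of_dual (hR : 0 < R) (hW : ContDiff ℝ 2 W) (hH : HessNonneg W)
    (hf : ContDiff ℝ 1 f) (hf0 : wint R W f = 0) {a : ℝ}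
    (h : ∀ u, Neu R u → 2 * wint R W (fun x => ∑ i, pd i f x * pd i u x) ≤
      a + wint R W (fun x => wlap W u x ^ 2)) :
    wint R W (fun x => f x ^ 2) ≤ a := by
  refine le_of_forall_pos_le_add fun ε hε => ?_
  have cf := hf.continuous
  obtain ⟨u, hu, hue⟩ := exists_neu_solution hR hW hH (g := fun x => -f x) (by fun_prop)
    (by rw [wint_neg, hf0, neg_zero]) hε
  have cl : Continuous (wlap W u) := (wlap_contDiff hW hu).continuous
  have e : (fun x => (wlap W u x - -f x) ^ 2) = fun x =>
      (wlap W u x ^ 2 + 2 * (f x * wlap W u x)) + f x ^ 2 := by ext x; ring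
  rw [e, wint_add hW.continuous (by fun_prop) (by fun_prop),
    wint_add hW.continuous (by fun_prop) (by fun_prop), wint_const_mul,
    wint_mul_wlap hR.le hW hf hu] at hue
  linarith [h u hu]

/-- The Poincaré inequality for a uniformly convex weight on the cube. -/
lemma poincare (hR : 0 < R) (hW : ContDiff ℝ 2 W) {k : ℝ} (hk : 0 < k)
    (hH : ∀ x v, k * ∑ i, v i ^ 2 ≤ hessForm W x v)
    (hf : ContDiff ℝ 1 f) (hf0 : wint R W f = 0) :
    k * wint R W (fun x => f x ^ 2) ≤ wint R W (fun x => ∑ i, pd i f x ^ 2) := by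
  have hH0 : HessNonneg W := fun x v =>
    (mul_nonneg hk.le (Finset.sum_nonneg fun i _ => sq_nonneg _)).trans (hH x v)
  have hc := hW.continuous
  have cf : ∀ i, Continuous (pd i f) := fun i => continuous_pd hf
  have := wint_sq_le_of_dual hR hW hH0 hf hf0
    (a := k⁻¹ * wint R W (fun x => ∑ i, pd i f x ^ 2)) fun u hu => by
      have cu : ∀ i, Continuous (pd i u) := fun i => (hu.pd_contDiff i).continuous
      have ch := continuous_hessForm hW cu
      have c3 : ∀ i j, Continuous (pd i (pd j u)) := fun i j => (hu.pd_pd_contDiff i j).continuous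
      rw [bochner hR.le hW hu, ← wint_const_mul, ← wint_const_mul]
      have h1 : wint R W (fun x => 2 * ∑ i, pd i f x * pd i u x) ≤
          wint R W (fun x => k⁻¹ * (∑ i, pd i f x ^ 2) + hessForm W x (fun i => pd i u x)) := by
        refine wint_mono hc (by fun_prop) (by fun_prop) fun x _ => ?_
        have h2 := hH x fun i => pd i u x
        have h3 : 2 * ∑ i, pd i f x * pd i u x ≤
            k⁻¹ * (∑ i, pd i f x ^ 2) + k * ∑ i, pd i u x ^ 2 := by
          rw [Finset.mul_sum, Finset.mul_sum, Finset.mul_sum, ← Finset.sum_add_distrib]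
          refine Finset.sum_le_sum fun i _ => ?_
          have : k⁻¹ * pd i f x ^ 2 + k * pd i u x ^ 2 - 2 * (pd i f x * pd i u x) =
              k⁻¹ * (pd i f x - k * pd i u x) ^ 2 := by field_simp; ring
          have h4 : 0 ≤ k⁻¹ * (pd i f x - k * pd i u x) ^ 2 := by positivity
          linarith
        linarith
      rw [wint_add hc (by fun_prop) (by fun_prop)] at h1
      have h5 : 0 ≤ wint R W (fun x => ∑ i, ∑ j, pd i (pd j u) x ^ 2) :=
        wint_nonneg fun x _ => Finset.sum_nonneg fun i _ => Finset.sum_nonneg fun j _ => sq_nonneg _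
      simp only [hessForm] at h1
      linarith
  rw [inv_mul_eq_div, le_div_iff₀ hk] at this
  linarith

/-- A Brascamp–Lieb type inequality for the partial derivatives of a potential. -/
lemma brascampLieb_pd (hR : 0 < R) (hW : ContDiff ℝ 2 W) (hWe : ∀ x, W (-x) = W x)
    {U : Euc n → ℝ} (hU : ContDiff ℝ 2 U) (hUe : ∀ x, U (-x) = U x)
    (hU0 : HessNonneg U) (hUW : ∀ x v, hessForm U x v ≤ hessForm W x v) (i : Fin n) :
    wint R W (fun x => pd i U x ^ 2) ≤ wint R W (pd i (pd i U)) := by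
  have hH0 : HessNonneg W := fun x v => (hU0 x v).trans (hUW x v)
  have hc := hW.continuous
  have dU : ContDiff ℝ 1 (pd i U) := hU.pd (by norm_num)
  have cU : ∀ i j, Continuous (pd i (pd j U)) := fun i j => continuous_pd (hU.pd (by norm_num))
  refine wint_sq_le_of_dual hR hW hH0 dU (wint_odd hWe (pd_neg_of_even hUe i)) fun u hu => ?_
  have cu : ∀ i, Continuous (pd i u) := fun i => (hu.pd_contDiff i).continuous
  have ch := continuous_hessForm hW cu
  have ch' := continuous_hessForm hU cu
  have c3 : ∀ i j, Continuous (pd i (pd j u)) := fun i j => (hu.pd_pd_contDiff i j).continuous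
  rw [bochner hR.le hW hu, ← wint_const_mul]
  have h1 : wint R W (fun x => 2 * ∑ j, pd j (pd i U) x * pd j u x) ≤
      wint R W (fun x => pd i (pd i U) x + hessForm W x (fun i => pd i u x)) := by
    refine wint_mono hc (by fun_prop) (by fun_prop) fun x _ => ?_
    refine le_trans ?_ (add_le_add_right (hUW x fun i => pd i u x) _)
    have h2 := hU0 x fun j => (if j = i then 1 else 0) - pd j u x
    have e : ∑ a, ∑ b, pd a (pd b U) x *
        (((if a = i then 1 else 0) - pd a u x) * ((if b = i then 1 else 0) - pd b u x)) =
        pd i (pd i U) x - 2 * ∑ j, pd j (pd i U) x * pd j u x +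
          hessForm U x fun i => pd i u x := by
      have e1 : ∀ a b, pd a (pd b U) x *
        (((if a = i then 1 else 0) - pd a u x) * ((if b = i then 1 else 0) - pd b u x)) =
        (if a = i then (if b = i then pd a (pd b U) x else 0) else 0) -
          (if a = i then pd a (pd b U) x * pd b u x else 0) -
          (if b = i then pd a (pd b U) x * pd a u x else 0) +
          pd a (pd b U) x * (pd a u x * pd b u x) := by
        intro a b
        split_ifs <;> ring
      simp only [e1, Finset.sum_add_distrib, Finset.sum_sub_distrib, Finset.sum_ite_eq',
        Finset.mem_univ, if_true, hessForm]
      have e2 : ∑ a, ∑ b, (if a = i then (if b = i then pd a (pd b U) x else 0) else 0) =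
          pd i (pd i U) x := by
        rw [Finset.sum_eq_single i (by intro b _ hb; simp [hb]) (by simp)]
        simp
      have e3 : ∑ a, ∑ b, (if a = i then pd a (pd b U) x * pd b u x else 0) =
          ∑ j, pd j (pd i U) x * pd j u x := by
        rw [Finset.sum_eq_single i (by intro b _ hb; simp [hb]) (by simp)]
        simp only [if_true]
        exact Finset.sum_congr rfl fun b _ => by rw [pd_comm hU]
      rw [e2, e3]; ring
    rw [e] at h2
    linarith
  rw [wint_add hc (by fun_prop) (by fun_prop)] at h1
  have h5 : 0 ≤ wint R W (fun x => ∑ i, ∑ j, pd i (pd j u) x ^ 2) :=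
    wint_nonneg fun x _ => Finset.sum_nonneg fun i _ => Finset.sum_nonneg fun j _ => sq_nonneg _
  simp only [hessForm] at h1
  have e7 : wint R W (fun x => pd i (pd i U) x) = wint R W (pd i (pd i U)) := rfl
  linarith

end poincare

section penalty

variable {n : ℕ} {R : ℝ} {V u : Euc n → ℝ} {ι : Type*} [Fintype ι] {N : ℝ} {e : ι → Euc n}
  {h d : ι → ℝ}

/-- The exponential penalty for the half-space `⟪e, x⟫ ≤ h`. -/
def hexp {n : ℕ} (N : ℝ) (e : Euc n) (h : ℝ) (x : Euc n) : ℝ := Real.exp (N * (⟪e, x⟫ - h))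

/-- The sum of the exponential penalties of a finite family of half-spaces. -/
def pen {n : ℕ} {ι : Type*} [Fintype ι] (N : ℝ) (e : ι → Euc n) (h : ι → ℝ) (x : Euc n) : ℝ :=
  ∑ i, hexp N (e i) (h i) x

/-- The weighted sum `∑ dᵢ N exp (N (⟪eᵢ, x⟫ - hᵢ))`. -/
def flux {n : ℕ} {ι : Type*} [Fintype ι] (N : ℝ) (e : ι → Euc n) (h d : ι → ℝ) (x : Euc n) : ℝ :=
  ∑ i, d i * (N * hexp N (e i) (h i) x)

lemma hexp_pos (N : ℝ) (e : Euc n) (h : ℝ) (x : Euc n) : 0 < hexp N e h x := Real.exp_pos _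

lemma contDiff_hexp (N : ℝ) (e : Euc n) (h : ℝ) {k : WithTop ℕ∞} : ContDiff ℝ k (hexp N e h) :=
  (contDiff_const.mul ((contDiff_const.inner ℝ contDiff_id).sub contDiff_const)).exp

@[fun_prop] lemma continuous_hexp (N : ℝ) (e : Euc n) (h : ℝ) : Continuous (hexp N e h) :=
  (contDiff_hexp N e h (k := 0)).continuous

lemma pd_hexp (N : ℝ) (e : Euc n) (h : ℝ) (a : Fin n) (x : Euc n) :
    pd a (hexp N e h) x = N * e a * hexp N e h x := by
  have hi : ContDiff ℝ 1 fun x : Euc n => N * (⟪e, x⟫ - h) :=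
    contDiff_const.mul ((contDiff_const.inner ℝ contDiff_id).sub contDiff_const)
  have h1 : pd a (fun x : Euc n => N * (⟪e, x⟫ - h)) x = N * e a := by
    have hin : ContDiff ℝ 1 fun x : Euc n => ⟪e, x⟫ := contDiff_const.inner ℝ contDiff_id
    rw [pd_const_mul N (hin.sub contDiff_const), pd_sub hin contDiff_const, pd_const]
    have : pd a (fun x : Euc n => ⟪e, x⟫) x = e a := by
      have h3 : HasFDerivAt (fun x : Euc n => ⟪e, x⟫) (innerSL ℝ e) x :=
        (innerSL ℝ e).hasFDerivAt
      simp [pd, h3.fderiv, EuclideanSpace.inner_single_right]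
    rw [this]; ring
  have := pd_comp (i := a) Real.exp hi x (Real.hasDerivAt_exp _)
  rw [h1] at this
  rw [show hexp N e h = fun x => Real.exp (N * (⟪e, x⟫ - h)) from rfl, this]
  ring

lemma contDiff_pen {k : WithTop ℕ∞} : ContDiff ℝ k (pen N e h) :=
  ContDiff.sum fun _ _ => contDiff_hexp _ _ _

lemma contDiff_flux {k : WithTop ℕ∞} : ContDiff ℝ k (flux N e h d) :=
  ContDiff.sum fun _ _ => contDiff_const.mul (contDiff_const.mul (contDiff_hexp _ _ _))

lemma continuous_flux : Continuous (flux N e h d) := (contDiff_flux (k := 0)).continuous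

lemma pd_pen (a : Fin n) (x : Euc n) :
    pd a (pen N e h) x = ∑ i, N * e i a * hexp N (e i) (h i) x := by
  have := pd_sum (i := a) Finset.univ (F := fun i => hexp N (e i) (h i))
    (fun i _ => contDiff_hexp _ _ _) x
  rw [show pen N e h = fun x => ∑ i, hexp N (e i) (h i) x from rfl, this]
  simp only [pd_hexp]

lemma pd_flux (a : Fin n) (x : Euc n) :
    pd a (flux N e h d) x = ∑ i, d i * (N * (N * e i a * hexp N (e i) (h i) x)) := by
  have := pd_sum (i := a) Finset.univ (F := fun i x => d i * (N * hexp N (e i) (h i) x))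
    (fun i _ => contDiff_const.mul (contDiff_const.mul (contDiff_hexp _ _ _))) x
  rw [show flux N e h d = fun x => ∑ i, d i * (N * hexp N (e i) (h i) x) from rfl, this]
  refine Finset.sum_congr rfl fun i _ => ?_
  rw [pd_const_mul _ (contDiff_const.mul (contDiff_hexp _ _ _)),
    pd_const_mul _ (contDiff_hexp _ _ _), pd_hexp]

lemma pd_pd_pen (a b : Fin n) (x : Euc n) :
    pd a (pd b (pen N e h)) x = ∑ i, N * e i b * (N * e i a * hexp N (e i) (h i) x) := by
  have h1 : pd b (pen N e h) = fun x => ∑ i, N * e i b * hexp N (e i) (h i) x := by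
    ext y; exact pd_pen b y
  rw [h1, pd_sum _ (fun i _ => contDiff_const.mul (contDiff_hexp _ _ _))]
  refine Finset.sum_congr rfl fun i _ => ?_
  rw [pd_const_mul _ (contDiff_hexp _ _ _), pd_hexp]

lemma hessForm_pen (x : Euc n) (v : Fin n → ℝ) :
    hessForm (pen N e h) x v =
      N * ∑ i, (N * hexp N (e i) (h i) x) * (∑ a, e i a * v a) ^ 2 := by
  simp only [hessForm, pd_pd_pen, Finset.sum_mul, Finset.mul_sum, sq]
  rw [Finset.sum_congr rfl fun a _ => Finset.sum_comm, Finset.sum_comm]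
  refine Finset.sum_congr rfl fun i _ => Finset.sum_congr rfl fun a _ =>
    Finset.sum_congr rfl fun b _ => ?_
  ring

lemma hessForm_add {V U : Euc n → ℝ} (hV : ContDiff ℝ 2 V) (hU : ContDiff ℝ 2 U) (x : Euc n)
    (v : Fin n → ℝ) :
    hessForm (fun x => V x + U x) x v = hessForm V x v + hessForm U x v := by
  have h1 : ∀ j, pd j (fun x => V x + U x) = fun x => pd j V x + pd j U x := fun j => by
    ext y; exact pd_add (hV.of_le (by norm_num)) (hU.of_le (by norm_num)) y
  simp only [hessForm, h1, ← Finset.sum_add_distrib]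
  refine Finset.sum_congr rfl fun i _ => Finset.sum_congr rfl fun j _ => ?_
  rw [pd_add (hV.pd (by norm_num)) (hU.pd (by norm_num))]
  ring

lemma hessForm_pen_nonneg (hN : 0 ≤ N) (x : Euc n) (v : Fin n → ℝ) :
    0 ≤ hessForm (pen N e h) x v := by
  rw [hessForm_pen]
  have := fun i => (hexp_pos N (e i) (h i) x).le
  exact mul_nonneg hN (Finset.sum_nonneg fun i _ =>
    mul_nonneg (mul_nonneg hN (this i)) (sq_nonneg _))

/-- The penalised potential. -/
def penPot {n : ℕ} {ι : Type*} [Fintype ι] (V : Euc n → ℝ) (N : ℝ) (e : ι → Euc n) (h : ι → ℝ)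
    (x : Euc n) : ℝ := V x + pen N e h x

lemma contDiff_penPot (hV : ContDiff ℝ 2 V) : ContDiff ℝ 2 (penPot V N e h) :=
  hV.add contDiff_pen

lemma hessForm_penPot (hV : ContDiff ℝ 2 V) (x : Euc n) (v : Fin n → ℝ) :
    hessForm (penPot V N e h) x v = hessForm V x v +
      N * ∑ i, (N * hexp N (e i) (h i) x) * (∑ a, e i a * v a) ^ 2 := by
  rw [← hessForm_pen]; exact hessForm_add hV contDiff_pen x v

lemma le_hessForm_penPot (hV : ContDiff ℝ 2 V) (hN : 0 ≤ N) (x : Euc n) (v : Fin n → ℝ) :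
    hessForm V x v ≤ hessForm (penPot V N e h) x v := by
  rw [hessForm_penPot hV, ← hessForm_pen]
  linarith [hessForm_pen_nonneg (e := e) (h := h) hN x v]

lemma wint_variance_identity (hR : 0 < R) (hV : ContDiff ℝ 2 V) (hu : Neu R u) (c : ℝ) :
    wint R (penPot V N e h) (fun x => (flux N e h d x - c) ^ 2) -
      N * wint R (penPot V N e h) (flux N e h (fun i => d i ^ 2)) =
    wint R (penPot V N e h) (fun x => (wlap (penPot V N e h) u x - (c - flux N e h d x)) ^ 2) -
      wint R (penPot V N e h) (fun x => ∑ a, ∑ b, pd a (pd b u) x ^ 2) -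
      wint R (penPot V N e h) (fun x => hessForm V x fun a => pd a u x) -
      N * wint R (penPot V N e h) (fun x => ∑ i, (N * hexp N (e i) (h i) x) *
        (d i - ∑ a, e i a * pd a u x) ^ 2) := by
  have hW := contDiff_penPot (N := N) (e := e) (h := h) hV
  set W := penPot V N e h with hWdef
  have hc := hW.continuous
  have cG : Continuous (flux N e h d) := continuous_flux
  have cG2 : Continuous (flux N e h (fun i => d i ^ 2)) := continuous_flux
  have cl : Continuous (wlap W u) := (wlap_contDiff hW hu).continuous
  have cu : ∀ i, Continuous (pd i u) := fun i => (hu.pd_contDiff i).continuous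
  have cV := continuous_hessForm hV cu
  have cf : ∀ a, Continuous (pd a (flux N e h d)) := fun a => continuous_pd contDiff_flux
  have hb := bochner hR.le hW hu
  have e1 : (fun x => (wlap W u x - (c - flux N e h d x)) ^ 2) = fun x =>
      (wlap W u x ^ 2 + 2 * ((flux N e h d x - c) * wlap W u x)) + (flux N e h d x - c) ^ 2 := by
    ext x; ring
  have hp := wint_mul_wlap hR.le hW (f := fun x => flux N e h d x - c)
    (contDiff_flux.sub contDiff_const) hu
  have e2 : ∀ (a : Fin n) x, pd a (fun x => flux N e h d x - c) x = pd a (flux N e h d) x :=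
    fun a x => by rw [pd_sub contDiff_flux contDiff_const, pd_const, sub_zero]
  simp only [e2] at hp
  rw [e1, wint_add hc (by fun_prop) (by fun_prop), wint_add hc (by fun_prop) (by fun_prop),
    wint_const_mul, hp]
  have e3 : wint R W (fun x => ∑ i, ∑ j, pd i (pd j W) x * (pd i u x * pd j u x)) =
      wint R W (fun x => hessForm V x fun a => pd a u x) +
      N * wint R W (fun x => ∑ i, (N * hexp N (e i) (h i) x) * (∑ a, e i a * pd a u x) ^ 2) := by
    rw [← wint_const_mul, ← wint_add hc (by fun_prop) (by fun_prop)]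
    congr 1; ext x
    exact hessForm_penPot hV x _
  have e4 : N * wint R W (fun x => ∑ i, (N * hexp N (e i) (h i) x) *
        (d i - ∑ a, e i a * pd a u x) ^ 2) =
      N * wint R W (flux N e h (fun i => d i ^ 2)) -
        2 * wint R W (fun x => ∑ a, pd a (flux N e h d) x * pd a u x) +
        N * wint R W (fun x => ∑ i, (N * hexp N (e i) (h i) x) * (∑ a, e i a * pd a u x) ^ 2) := by
    rw [← wint_const_mul, ← wint_const_mul, ← wint_const_mul, ← wint_const_mul,
      ← wint_sub hc (by fun_prop) (by fun_prop), ← wint_add hc (by fun_prop) (by fun_prop)]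
    congr 1; ext x
    have e5 : ∑ a, pd a (flux N e h d) x * pd a u x =
        ∑ i, d i * (N * (N * hexp N (e i) (h i) x)) * ∑ a, e i a * pd a u x := by
      simp only [pd_flux, Finset.sum_mul, Finset.mul_sum]
      rw [Finset.sum_comm]
      refine Finset.sum_congr rfl fun i _ => Finset.sum_congr rfl fun a _ => ?_
      ring
    rw [e5]
    simp only [flux, Finset.mul_sum (s := (Finset.univ : Finset ι)), ← Finset.sum_sub_distrib,
      ← Finset.sum_add_distrib]
    refine Finset.sum_congr rfl fun i _ => ?_
    ring
  rw [hb, e3, e4]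
  ring

end penalty

section estimates

variable {n : ℕ} {R : ℝ} {V W u : Euc n → ℝ} {ι : Type*} [Fintype ι] {N : ℝ} {e : ι → Euc n}
  {h d : ι → ℝ}

lemma sum_coord_mul_pd_nonneg (hV : ContDiff ℝ 2 V) (hVc : ConvexOn ℝ univ V)
    (hVe : ∀ x, V (-x) = V x) (x : Euc n) : 0 ≤ ∑ a, x a * pd a V x := by
  have h0 : V 0 ≤ V x := by
    have := hVc.2 (mem_univ x) (mem_univ (-x)) (show (0:ℝ) ≤ 1 / 2 by norm_num)
      (show (0:ℝ) ≤ 1 / 2 by norm_num) (by norm_num)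
    rw [hVe, smul_neg, add_neg_cancel] at this
    simp only [smul_eq_mul] at this
    linarith
  have hconv : ConvexOn ℝ univ (fun t : ℝ => V (t • x)) := by
    have := hVc.comp_linearMap (LinearMap.toSpanSingleton ℝ (Euc n) x)
    rw [preimage_univ] at this
    exact this
  have hd : HasDerivAt (fun t : ℝ => V (t • x)) (fderiv ℝ V x x) 1 := by
    have h1 : HasDerivAt (fun t : ℝ => t • x) x 1 := by
      simpa using (hasDerivAt_id (1:ℝ)).smul_const x
    have h2 : HasFDerivAt V (fderiv ℝ V x) ((1:ℝ) • x) := by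
      rw [one_smul]; exact (hV.differentiable (by norm_num) x).hasFDerivAt
    exact h2.comp_hasDerivAt (1:ℝ) h1
  have hs := hconv.slope_le_of_hasDerivAt (mem_univ 0) (mem_univ 1) zero_lt_one hd
  have e1 : fderiv ℝ V x x = ∑ a, x a * pd a V x := by
    have hx : x = ∑ a, x a • EuclideanSpace.single a (1:ℝ) := by
      ext b
      simp [Finset.sum_apply, Pi.single_apply]
    conv_lhs => rw [hx]
    rw [map_sum, ← hx]
    exact Finset.sum_congr rfl fun a _ => by simp [pd]
  rw [← e1]
  simp [slope_def_field] at hs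
  linarith

lemma wint_flux_one_le (hR : 0 ≤ R) (hV : ContDiff ℝ 2 V) (hVc : ConvexOn ℝ univ V)
    (hVe : ∀ x, V (-x) = V x) (hN : 0 ≤ N) {r : ℝ} (hr : 0 < r) (hh : ∀ i, r ≤ h i) :
    wint R (penPot V N e h) (flux N e h fun _ => 1) ≤
      2 * (n + Fintype.card ι) / r * wint R (penPot V N e h) (fun _ => 1) := by
  have hW := contDiff_penPot (N := N) (e := e) (h := h) hV
  have hW1 : ContDiff ℝ 1 (penPot V N e h) := hW.of_le (by norm_num)
  have hE : ContDiff ℝ 1 (fun x => Real.exp (-penPot V N e h x)) := hW1.neg.exp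
  have hc := hW.continuous
  have cW : ∀ a, Continuous (pd a (penPot V N e h)) := fun a => continuous_pd hW1
  have cx : ∀ a, Continuous fun x : Euc n => x a := fun a => (contDiff_coord (k := 0) a).continuous
  have cf : Continuous (flux N e h fun _ => 1) := continuous_flux
  have h1 : ∀ a : Fin n, 0 ≤ wint R (penPot V N e h) (fun x => 1 - x a * pd a (penPot V N e h) x) := by
    intro a
    have := integral_pd_nonneg hR a (F := fun x => x a * Real.exp (-penPot V N e h x))
      ((contDiff_coord a).mul hE)
      (fun x hx => by rw [hx]; positivity)
      (fun x hx => by rw [hx]; nlinarith [Real.exp_pos (-penPot V N e h x)])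
    refine this.trans_eq (integral_congr_ae (ae_of_all _ fun x => ?_))
    simp only
    rw [pd_mul (contDiff_coord a) hE, pd_coord, pd_exp_neg hW1]
    simp; ring
  have h2 : 0 ≤ wint R (penPot V N e h) (fun x => n - ∑ a, x a * pd a (penPot V N e h) x) := by
    have := Finset.sum_nonneg fun a (_ : a ∈ Finset.univ) => h1 a
    rw [← wint_sum hc _ (fun a _ => by fun_prop)] at this
    simpa using this
  have h3 : wint R (penPot V N e h) (fun x => n - ∑ a, x a * pd a (penPot V N e h) x) ≤
      wint R (penPot V N e h) (fun x => (n + Fintype.card ι) - r / 2 * flux N e h (fun _ => 1) x) := by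
    refine wint_mono hc (by fun_prop) (by fun_prop) fun x _ => ?_
    have e1 : ∀ a, pd a (penPot V N e h) x = pd a V x + pd a (pen N e h) x := fun a =>
      pd_add (hV.of_le (by norm_num)) contDiff_pen x
    have e2 : ∑ a, x a * pd a (penPot V N e h) x = (∑ a, x a * pd a V x) +
        ∑ i, ⟪e i, x⟫ * (N * hexp N (e i) (h i) x) := by
      simp only [e1, mul_add, Finset.sum_add_distrib, pd_pen, Finset.mul_sum]
      congr 1
      rw [Finset.sum_comm]
      refine Finset.sum_congr rfl fun i _ => ?_
      simp only [PiLp.inner_apply, Finset.sum_mul]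
      refine Finset.sum_congr rfl fun a _ => ?_
      simp; ring
    have e3 := sum_coord_mul_pd_nonneg hV hVc hVe x
    have e4 : r / 2 * flux N e h (fun _ => 1) x - Fintype.card ι ≤
        ∑ i, ⟪e i, x⟫ * (N * hexp N (e i) (h i) x) := by
      have : (Fintype.card ι : ℝ) = ∑ _i : ι, (1:ℝ) := by simp
      rw [this, flux, Finset.mul_sum, ← Finset.sum_sub_distrib]
      refine Finset.sum_le_sum fun i _ => ?_
      set y := N * (⟪e i, x⟫ - h i) with hy
      have hpos := hexp_pos N (e i) (h i) x
      have h5 : -1 ≤ y * Real.exp y := by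
        have := Real.add_one_le_exp (-y)
        have h6 : Real.exp (-y) * Real.exp y = 1 := by rw [← Real.exp_add]; simp
        nlinarith [Real.exp_pos y]
      have h7 : y * Real.exp y ≤ (⟪e i, x⟫ - r / 2) * (N * hexp N (e i) (h i) x) := by
        have : hexp N (e i) (h i) x = Real.exp y := rfl
        rw [this, hy]
        have : N * (⟪e i, x⟫ - h i) ≤ N * (⟪e i, x⟫ - r / 2) :=
          mul_le_mul_of_nonneg_left (by linarith [hh i]) hN
        nlinarith [Real.exp_pos (N * (⟪e i, x⟫ - h i))]
      linarith
    linarith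
  have h4 := h2.trans h3
  rw [wint_sub hc (by fun_prop) (by fun_prop), wint_const, wint_const_mul] at h4
  rw [div_mul_eq_mul_div, le_div_iff₀ hr]
  linarith

end estimates

section traceEstimates

variable {n : ℕ} {R : ℝ} {W u : Euc n → ℝ}

lemma trace_poincare (hR : 0 < R) (hW : ContDiff ℝ 2 W) (hWe : ∀ x, W (-x) = W x)
    (h1 : wint R W (fun _ => 1) = 1) {k : ℝ} (hk : 0 < k)
    (hH : ∀ x v, k * ∑ i, v i ^ 2 ≤ hessForm W x v) (hu : Neu R u) (hue : ∀ x, u (-x) = u x) :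
    (wint R W (fun x => ∑ i, pd i (pd i u) x) - k * wint R W (fun x => ∑ i, x i * pd i u x)) ^ 2 ≤
      n * (wint R W (fun x => ∑ a, ∑ b, pd a (pd b u) x ^ 2) -
        k * wint R W (fun x => ∑ i, pd i u x ^ 2)) := by
  have hc := hW.continuous
  have cu : ∀ i, Continuous (pd i u) := fun i => (hu.pd_contDiff i).continuous
  have c2 : ∀ i j, Continuous (pd i (pd j u)) := fun i j => (hu.pd_pd_contDiff i j).continuous
  have cx : ∀ a, Continuous fun x : Euc n => x a := fun a => (contDiff_coord (k := 0) a).continuous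
  set A := wint R W (fun x => ∑ a, ∑ b, pd a (pd b u) x ^ 2)
  set B := wint R W (fun x => ∑ i, pd i u x ^ 2)
  set T := wint R W (fun x => ∑ i, pd i (pd i u) x)
  set X := wint R W (fun x => ∑ i, x i * pd i u x)
  have key : ∀ t : ℝ, 0 ≤ (n : ℝ) * (t * t) + (-2 * (T - k * X)) * t + (A - k * B) := by
    intro t
    have hp : ∀ b, k * wint R W (fun x => (pd b u x - t * x b) ^ 2) ≤
        wint R W (fun x => ∑ a, (pd a (pd b u) x - t * if a = b then 1 else 0) ^ 2) := by
      intro b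
      have d1 : ContDiff ℝ 1 (pd b u) := (hu.pd_contDiff b).of_le (by norm_num)
      have := poincare hR hW hk hH (f := fun x => pd b u x - t * x b)
        (d1.sub (contDiff_const.mul (contDiff_coord b)))
        (wint_odd hWe fun x => by rw [pd_neg_of_even hue]; simp; ring)
      refine this.trans_eq ?_
      congr 1; ext x
      refine Finset.sum_congr rfl fun a _ => ?_
      rw [pd_sub d1 (contDiff_const.mul (contDiff_coord b)), pd_const_mul _ (contDiff_coord b),
        pd_coord]
    have hs := Finset.sum_le_sum fun b (_ : b ∈ Finset.univ) => hp b
    rw [← Finset.mul_sum, ← wint_sum hc _ (fun a _ => by fun_prop),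
      ← wint_sum hc _ (fun a _ => by fun_prop)] at hs
    have e1 : wint R W (fun x => ∑ b, (pd b u x - t * x b) ^ 2) =
        B - 2 * t * X + t ^ 2 * wint R W (fun x => ∑ b, x b ^ 2) := by
      rw [← wint_const_mul, ← wint_const_mul, ← wint_sub hc (by fun_prop) (by fun_prop),
        ← wint_add hc (by fun_prop) (by fun_prop)]
      congr 1; ext x
      simp only [Finset.mul_sum, ← Finset.sum_sub_distrib, ← Finset.sum_add_distrib]
      exact Finset.sum_congr rfl fun b _ => by ring
    have e2 : wint R W (fun x => ∑ b, ∑ a, (pd a (pd b u) x - t * if a = b then 1 else 0) ^ 2) =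
        A - 2 * t * T + t ^ 2 * n := by
      have e3 : (n : ℝ) = wint R W (fun _ => (n : ℝ)) := by rw [wint_const, h1, mul_one]
      rw [e3, ← wint_const_mul, ← wint_const_mul, ← wint_sub hc (by fun_prop) (by fun_prop),
        ← wint_add hc (by fun_prop) (by fun_prop)]
      congr 1; ext x
      have e4 : ∀ a b, (pd a (pd b u) x - t * if a = b then (1:ℝ) else 0) ^ 2 =
          pd a (pd b u) x ^ 2 + (if a = b then t ^ 2 - 2 * t * pd a (pd b u) x else 0) := by
        intro a b; split_ifs <;> ring
      simp only [e4, Finset.sum_add_distrib, Finset.sum_ite_eq', Finset.mem_univ, if_true,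
        Finset.sum_sub_distrib, ← Finset.mul_sum]
      rw [Finset.sum_comm]
      simp; ring
    rw [e1, e2] at hs
    have h2 : 0 ≤ wint R W (fun x => ∑ b, x b ^ 2) :=
      wint_nonneg fun x _ => Finset.sum_nonneg fun b _ => sq_nonneg _
    nlinarith [mul_nonneg hk.le (mul_nonneg (sq_nonneg t) h2)]
  have := discrim_le_zero key
  simp only [discrim] at this
  nlinarith

lemma poincare_gradient (hR : 0 < R) (hW : ContDiff ℝ 2 W) (hWe : ∀ x, W (-x) = W x)
    {k : ℝ} (hk : 0 < k)
    (hH : ∀ x v, k * ∑ i, v i ^ 2 ≤ hessForm W x v) (hu : Neu R u) (hue : ∀ x, u (-x) = u x) :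
    k * wint R W (fun x => ∑ i, pd i u x ^ 2) ≤
      wint R W (fun x => ∑ a, ∑ b, pd a (pd b u) x ^ 2) := by
  have hc := hW.continuous
  have cu : ∀ i, Continuous (pd i u) := fun i => (hu.pd_contDiff i).continuous
  have c2 : ∀ i j, Continuous (pd i (pd j u)) := fun i j => (hu.pd_pd_contDiff i j).continuous
  have := Finset.sum_le_sum fun b (_ : b ∈ Finset.univ) =>
    poincare hR hW hk hH (f := pd b u) ((hu.pd_contDiff b).of_le (by norm_num))
      (wint_odd hWe (pd_neg_of_even hue b))
  rw [← Finset.mul_sum, ← wint_sum hc _ (fun a _ => by fun_prop),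
    ← wint_sum hc _ (fun a _ => by fun_prop)] at this
  refine this.trans_eq ?_
  congr 1; ext x
  exact Finset.sum_comm

lemma abs_wint_sum_mul_le (hW : Continuous W) {f g : Fin n → Euc n → ℝ} (hf : ∀ i, Continuous (f i))
    (hg : ∀ i, Continuous (g i)) :
    |wint R W (fun x => ∑ i, f i x * g i x)| ≤
      √(wint R W (fun x => ∑ i, f i x ^ 2)) * √(wint R W (fun x => ∑ i, g i x ^ 2)) := by
  have h0 : ∀ (f : Fin n → Euc n → ℝ) x, 0 ≤ ∑ i, f i x ^ 2 := fun f x =>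
    Finset.sum_nonneg fun i _ => sq_nonneg _
  have key : ∀ x, |∑ i, f i x * g i x| ≤ √(∑ i, f i x ^ 2) * √(∑ i, g i x ^ 2) := by
    intro x
    rw [← Real.sqrt_mul (h0 f x), ← Real.sqrt_sq_eq_abs]
    exact Real.sqrt_le_sqrt (Finset.sum_mul_sq_le_sq_mul_sq _ _ _)
  have h1 := abs_wint_mul_le (R := R) hW (f := fun x => √(∑ i, f i x ^ 2))
    (g := fun x => √(∑ i, g i x ^ 2)) (by fun_prop) (by fun_prop)
  simp only [Real.sq_sqrt (h0 f _), Real.sq_sqrt (h0 g _)] at h1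
  refine le_trans (abs_le.2 ⟨?_, ?_⟩) h1
  · refine (neg_le_neg (le_abs_self _)).trans ?_
    rw [← wint_neg]
    exact wint_mono hW (by fun_prop) (by fun_prop) fun x _ => (abs_le.1 (key x)).1
  · refine le_trans ?_ (le_abs_self _)
    exact wint_mono hW (by fun_prop) (by fun_prop) fun x _ => (abs_le.1 (key x)).2

end traceEstimates

section penaltyEstimates

variable {n : ℕ} {R : ℝ} {V W u : Euc n → ℝ} {ι : Type*} [Fintype ι] {N : ℝ} {e : ι → Euc n}
  {h d : ι → ℝ}

lemma pd_sq_norm (b : Fin n) (x : Euc n) : pd b (fun x : Euc n => ∑ a, x a ^ 2) x = 2 * x b := by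
  simp only [sq]
  rw [pd_sum _ fun a _ => (contDiff_coord a).mul (contDiff_coord a)]
  simp only [pd_mul (contDiff_coord _) (contDiff_coord _), pd_coord, mul_ite, ite_mul,
    mul_one, one_mul, mul_zero, zero_mul, ← two_mul]
  simp

/-- The linear part of the trace estimate, controlled through a Brascamp–Lieb inequality. -/
lemma neg_wint_grad_mul_le (hR : 0 < R) (hV : ContDiff ℝ 2 V) (hVe : ∀ x, V (-x) = V x)
    (hW : ContDiff ℝ 2 W) (hWe : ∀ x, W (-x) = W x)
    (h1 : wint R W (fun _ => 1) = 1) {k : ℝ}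
    (hH : ∀ x v, k * ∑ i, v i ^ 2 ≤ hessForm V x v)
    (hVW : ∀ x v, hessForm V x v ≤ hessForm W x v) (hu : Neu R u) {m : ℝ}
    (hm : wint R W (fun x => ∑ i, pd i (pd i V) x) ≤ m) (hk : 0 ≤ k) :
    -(wint R W (fun x => ∑ i, pd i V x * pd i u x)) ≤
      √(m - n * k) * √(wint R W (fun x => ∑ i, pd i u x ^ 2)) -
        k * wint R W (fun x => ∑ i, x i * pd i u x) := by
  have hc := hW.continuous
  have cu : ∀ i, Continuous (pd i u) := fun i => (hu.pd_contDiff i).continuous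
  have cV1 : ∀ i, Continuous (pd i V) := fun i => continuous_pd (hV.of_le (by norm_num))
  have cV2 : ∀ i j, Continuous (pd i (pd j V)) := fun i j => continuous_pd (hV.pd (by norm_num))
  have cx : ∀ a, Continuous fun x : Euc n => x a := fun a => (contDiff_coord (k := 0) a).continuous
  have hq : ContDiff ℝ 2 fun x : Euc n => ∑ a, x a ^ 2 :=
    ContDiff.sum fun a _ => (contDiff_coord a).pow 2
  set U : Euc n → ℝ := fun x => V x - k / 2 * ∑ a, x a ^ 2 with hUdef
  have hU : ContDiff ℝ 2 U := hV.sub (contDiff_const.mul hq)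
  have pU : ∀ i, pd i U = fun x => pd i V x - k * x i := fun i => by
    ext x
    rw [hUdef, pd_sub (hV.of_le (by norm_num)) ((contDiff_const.mul hq).of_le (by norm_num)),
      pd_const_mul _ (hq.of_le (by norm_num)), pd_sq_norm]
    ring
  have ppU : ∀ i j x, pd i (pd j U) x = pd i (pd j V) x - k * if i = j then 1 else 0 := by
    intro i j x
    rw [pU, pd_sub (hV.pd (by norm_num)) (contDiff_const.mul (contDiff_coord j)),
      pd_const_mul _ (contDiff_coord j), pd_coord]
  have hfU : ∀ x v, hessForm U x v = hessForm V x v - k * ∑ i, v i ^ 2 := by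
    intro x v
    simp only [hessForm, ppU, sub_mul, Finset.sum_sub_distrib, Finset.mul_sum]
    congr 1
    refine Finset.sum_congr rfl fun i _ => ?_
    simp only [mul_ite, mul_one, mul_zero, ite_mul, zero_mul, Finset.sum_ite_eq, Finset.mem_univ,
      if_true]
    ring
  have hUe : ∀ x, U (-x) = U x := fun x => by simp [hUdef, hVe]
  have hbl := Finset.sum_le_sum fun i (_ : i ∈ Finset.univ) =>
    brascampLieb_pd hR hW hWe hU hUe (fun x v => by have := hfU x v; have := hH x v; rw [← hessForm]; linarith)
      (fun x v => by
        rw [hfU]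
        have : 0 ≤ k * ∑ i, v i ^ 2 := mul_nonneg hk (Finset.sum_nonneg fun i _ => sq_nonneg _)
        linarith [hVW x v]) i
  have cU1 : ∀ i, Continuous (pd i U) := fun i => continuous_pd (hU.of_le (by norm_num))
  have cU2 : ∀ i j, Continuous (pd i (pd j U)) := fun i j => continuous_pd (hU.pd (by norm_num))
  rw [← wint_sum hc _ (fun a _ => by fun_prop)] at hbl
  have e1 : ∑ i, wint R W (pd i (pd i U)) ≤ m - n * k := by
    have : ∀ i, wint R W (pd i (pd i U)) = wint R W (pd i (pd i V)) - k := by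
      intro i
      have : pd i (pd i U) = fun x => pd i (pd i V) x - k := by ext x; rw [ppU]; simp
      rw [this, wint_sub hc (cV2 i i) continuous_const, wint_const, h1, mul_one]
    simp only [this, Finset.sum_sub_distrib]
    rw [← wint_sum hc _ (fun a _ => cV2 a a)]
    simp; linarith
  have h2 := (neg_abs_le _).trans' (neg_le_neg (abs_wint_sum_mul_le (R := R) hc cU1 cu))
  have h3 : √(wint R W (fun x => ∑ i, pd i U x ^ 2)) ≤ √(m - n * k) :=
    Real.sqrt_le_sqrt (hbl.trans e1)
  have e2 : wint R W (fun x => ∑ i, pd i U x * pd i u x) =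
      wint R W (fun x => ∑ i, pd i V x * pd i u x) - k * wint R W (fun x => ∑ i, x i * pd i u x) := by
    rw [← wint_const_mul, ← wint_sub hc (by fun_prop) (by fun_prop)]
    congr 1; ext x
    simp only [pU, Finset.mul_sum, ← Finset.sum_sub_distrib]
    exact Finset.sum_congr rfl fun i _ => by ring
  rw [e2] at h2
  have h4 := mul_le_mul_of_nonneg_right h3 (Real.sqrt_nonneg (wint R W (fun x => ∑ i, pd i u x ^ 2)))
  linarith

/-- The mismatch between `d i` and the normal component of `∇u`, weighted by the penalty. -/
def defect {n : ℕ} {ι : Type*} [Fintype ι] (N : ℝ) (e : ι → Euc n) (h d : ι → ℝ) (u : Euc n → ℝ)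
    (x : Euc n) : ℝ :=
  ∑ i, (N * hexp N (e i) (h i) x) * |d i - ∑ a, e i a * pd a u x|

lemma continuous_defect (hu : Neu R u) : Continuous (defect N e h d u) := by
  have cu : ∀ i, Continuous (pd i u) := fun i => (hu.pd_contDiff i).continuous
  unfold defect
  fun_prop

lemma wint_defect_le (hN : 0 < N) (hW : Continuous W) (hu : Neu R u) {C₀ S : ℝ}
    (h0 : wint R W (flux N e h fun _ => 1) ≤ C₀)
    (hS : N * wint R W (fun x => ∑ i, (N * hexp N (e i) (h i) x) *
        (d i - ∑ a, e i a * pd a u x) ^ 2) = S) :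
    wint R W (defect N e h d u) ≤ (C₀ + S) / (2 * √N) := by
  have cu : ∀ i, Continuous (pd i u) := fun i => (hu.pd_contDiff i).continuous
  have cf : Continuous (flux N e h fun _ => 1) := continuous_flux
  have h1 : wint R W (defect N e h d u) ≤ wint R W (fun x => (1 / (2 * √N)) *
      (flux N e h (fun _ => 1) x + N * ∑ i, (N * hexp N (e i) (h i) x) *
        (d i - ∑ a, e i a * pd a u x) ^ 2)) := by
    refine wint_mono hW (continuous_defect hu) (by fun_prop) fun x _ => ?_
    simp only [defect, flux, Finset.mul_sum (s := (Finset.univ : Finset ι)),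
      ← Finset.sum_add_distrib]
    refine Finset.sum_le_sum fun i _ => ?_
    set δ := d i - ∑ a, e i a * pd a u x
    have hp : 0 ≤ N * hexp N (e i) (h i) x := mul_nonneg hN.le (hexp_pos _ _ _ _).le
    have hs : 0 < √N := Real.sqrt_pos.2 hN
    have hδ : |δ| ≤ 1 / (2 * √N) * (1 + N * δ ^ 2) := by
      rw [one_div, inv_mul_eq_div, le_div_iff₀ (by positivity)]
      have e1 : N * δ ^ 2 = (√N * |δ|) ^ 2 := by rw [mul_pow, Real.sq_sqrt hN.le, sq_abs]
      rw [e1]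
      nlinarith [sq_nonneg (√N * |δ| - 1)]
    calc _ ≤ (N * hexp N (e i) (h i) x) * (1 / (2 * √N) * (1 + N * δ ^ 2)) :=
          mul_le_mul_of_nonneg_left hδ hp
      _ = _ := by ring
  rw [wint_const_mul, wint_add hW (by fun_prop) (by fun_prop), wint_const_mul, hS] at h1
  refine h1.trans ?_
  rw [one_div, inv_mul_eq_div]
  gcongr

lemma wint_flux_le (hR : 0 < R) (hN : 0 ≤ N) (hV : ContDiff ℝ 2 V) (hu : Neu R u) :
    wint R (penPot V N e h) (flux N e h d) ≤
      wint R (penPot V N e h) (fun x => ∑ i, pd i (pd i u) x) -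
        wint R (penPot V N e h) (fun x => ∑ i, pd i V x * pd i u x) +
        wint R (penPot V N e h) (defect N e h d u) := by
  have hW := contDiff_penPot (N := N) (e := e) (h := h) hV
  have hc := hW.continuous
  have cu : ∀ i, Continuous (pd i u) := fun i => (hu.pd_contDiff i).continuous
  have c2 : ∀ i j, Continuous (pd i (pd j u)) := fun i j => (hu.pd_pd_contDiff i j).continuous
  have cV1 : ∀ i, Continuous (pd i V) := fun i => continuous_pd (hV.of_le (by norm_num))
  have cf : Continuous (flux N e h d) := continuous_flux
  have cd : Continuous (defect N e h d u) := continuous_defect hu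
  have cl : Continuous (wlap (penPot V N e h) u) := (wlap_contDiff hW hu).continuous
  have h0 := wint_wlap hR.le hW hu
  have : wint R (penPot V N e h) (fun x => flux N e h d x + wlap (penPot V N e h) u x) ≤
      wint R (penPot V N e h) (fun x => ((∑ i, pd i (pd i u) x) - ∑ i, pd i V x * pd i u x) +
        defect N e h d u x) := by
    refine wint_mono hc (by fun_prop) (by fun_prop) fun x _ => ?_
    have e1 : ∀ a, pd a (penPot V N e h) x = pd a V x + pd a (pen N e h) x := fun a =>
      pd_add (hV.of_le (by norm_num)) contDiff_pen x
    have e2 : wlap (penPot V N e h) u x = (∑ i, pd i (pd i u) x) - (∑ i, pd i V x * pd i u x) -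
        ∑ i, (N * hexp N (e i) (h i) x) * ∑ a, e i a * pd a u x := by
      simp only [wlap, e1, add_mul, Finset.sum_sub_distrib, Finset.sum_add_distrib, pd_pen,
        Finset.mul_sum, Finset.sum_mul]
      rw [Finset.sum_comm (γ := ι)]
      rw [sub_sub]; congr 2
      exact Finset.sum_congr rfl fun i _ => Finset.sum_congr rfl fun a _ => by ring
    have e3 : flux N e h d x - ∑ i, (N * hexp N (e i) (h i) x) * ∑ a, e i a * pd a u x ≤
        defect N e h d u x := by
      simp only [flux, defect, ← Finset.sum_sub_distrib]
      refine Finset.sum_le_sum fun i _ => ?_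
      have hp : 0 ≤ N * hexp N (e i) (h i) x := mul_nonneg hN (hexp_pos _ _ _ _).le
      have := mul_le_mul_of_nonneg_left (le_abs_self (d i - ∑ a, e i a * pd a u x)) hp
      linarith
    linarith
  rw [wint_add hc cf cl, h0, add_zero, wint_add hc (by fun_prop) cd,
    wint_sub hc (by fun_prop) (by fun_prop)] at this
  exact this

end penaltyEstimates

section fluxEstimates

variable {n : ℕ} {R : ℝ} {V W u : Euc n → ℝ} {ι : Type*} [Fintype ι] {N : ℝ} {e : ι → Euc n}
  {h d : ι → ℝ}

lemma flux_sq_le (hN : 0 ≤ N) {C : ℝ} (hd0 : ∀ i, 0 ≤ d i) (hdC : ∀ i, d i ≤ C)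
    (he : ∀ i, ∑ a, e i a ^ 2 = 1) {γ : ℝ} {x : Euc n} (hγ0 : 0 ≤ γ)
    (hγ : ∑ a, pd a u x ^ 2 ≤ γ ^ 2) :
    flux N e h (fun i => d i ^ 2) x ≤ flux N e h d x * γ + C * defect N e h d u x := by
  simp only [flux, defect, Finset.mul_sum, Finset.sum_mul, ← Finset.sum_add_distrib]
  refine Finset.sum_le_sum fun i _ => ?_
  have hp : 0 ≤ N * hexp N (e i) (h i) x := mul_nonneg hN (hexp_pos _ _ _ _).le
  set w := ∑ a, e i a * pd a u x with hw
  have hwγ : w ≤ γ := by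
    refine le_of_sq_le_sq ?_ hγ0
    have := Finset.sum_mul_sq_le_sq_mul_sq Finset.univ (fun a => e i a) (fun a => pd a u x)
    rw [he, one_mul] at this
    exact this.trans hγ
  have h1 : d i ^ 2 ≤ d i * γ + C * |d i - w| := by
    have h2 : d i * w ≤ d i * γ := mul_le_mul_of_nonneg_left hwγ (hd0 i)
    have h3 : d i * (d i - w) ≤ C * |d i - w| :=
      (mul_le_mul_of_nonneg_left (le_abs_self _) (hd0 i)).trans
        (mul_le_mul_of_nonneg_right (hdC i) (abs_nonneg _))
    nlinarith
  nlinarith [mul_le_mul_of_nonneg_left h1 hp]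

/-- A regularised length of the gradient. -/
def gradLen {n : ℕ} (ε : ℝ) (u : Euc n → ℝ) (x : Euc n) : ℝ := √((∑ a, pd a u x ^ 2) + ε ^ 2)

lemma gradLen_sq (ε : ℝ) (x : Euc n) : gradLen ε u x ^ 2 = (∑ a, pd a u x ^ 2) + ε ^ 2 :=
  Real.sq_sqrt (add_nonneg (Finset.sum_nonneg fun _ _ => sq_nonneg _) (sq_nonneg _))

lemma gradLen_pos {ε : ℝ} (hε : 0 < ε) (x : Euc n) : 0 < gradLen ε u x :=
  Real.sqrt_pos.2 (add_pos_of_nonneg_of_pos (Finset.sum_nonneg fun _ _ => sq_nonneg _)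
    (by positivity))

lemma contDiff_gradLen (hu : Neu R u) {ε : ℝ} (hε : 0 < ε) : ContDiff ℝ 1 (gradLen ε u) := by
  refine ContDiff.sqrt ?_ fun x => ?_
  · exact (ContDiff.sum fun a _ =>
      (((hu.pd_contDiff a).of_le (by norm_num)).pow 2)).add contDiff_const
  · have := gradLen_pos (u := u) hε x
    rw [gradLen, Real.sqrt_pos] at this
    exact this.ne'

lemma gradLen_mul_pd (hu : Neu R u) {ε : ℝ} (hε : 0 < ε) (b : Fin n) (x : Euc n) :
    gradLen ε u x * pd b (gradLen ε u) x = ∑ a, pd a u x * pd b (pd a u) x := by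
  have d1 : ∀ a, ContDiff ℝ 1 (pd a u) := fun a => (hu.pd_contDiff a).of_le (by norm_num)
  have hg := contDiff_gradLen hu hε
  have h1 : pd b (fun x => gradLen ε u x * gradLen ε u x) x =
      pd b (fun x => (∑ a, pd a u x * pd a u x) + ε ^ 2) x := by
    congr 1; ext y
    rw [← sq, gradLen_sq]
    simp only [sq]
  rw [pd_mul hg hg, pd_add (ContDiff.sum fun a _ => (d1 a).mul (d1 a)) contDiff_const, pd_const,
    pd_sum _ (fun a _ => (d1 a).mul (d1 a))] at h1
  simp only [pd_mul (d1 _) (d1 _)] at h1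
  have h2 : ∑ a, (pd b (pd a u) x * pd a u x + pd a u x * pd b (pd a u) x) =
      2 * ∑ a, pd a u x * pd b (pd a u) x := by
    rw [Finset.mul_sum]; exact Finset.sum_congr rfl fun a _ => by ring
  rw [h2] at h1
  linarith

lemma sum_pd_gradLen_mul_le (hu : Neu R u) {ε : ℝ} (hε : 0 < ε) (x : Euc n) :
    ∑ b, pd b (gradLen ε u) x * pd b u x ≤
      √(∑ a, pd a u x ^ 2) * √(∑ a, ∑ b, pd a (pd b u) x ^ 2) := by
  have hpos := gradLen_pos (u := u) hε x
  set g := gradLen ε u x with hg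
  set v := √(∑ a, pd a u x ^ 2) with hv
  set H := √(∑ a, ∑ b, pd a (pd b u) x ^ 2) with hH
  have v0 : 0 ≤ v := Real.sqrt_nonneg _
  have hv2 : v ^ 2 = ∑ a, pd a u x ^ 2 :=
    Real.sq_sqrt (Finset.sum_nonneg fun _ _ => sq_nonneg _)
  have H0 : 0 ≤ H := Real.sqrt_nonneg _
  have hH2 : H ^ 2 = ∑ a, ∑ b, pd a (pd b u) x ^ 2 :=
    Real.sq_sqrt (Finset.sum_nonneg fun _ _ => Finset.sum_nonneg fun _ _ => sq_nonneg _)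
  have hvg : v ≤ g := by
    refine le_of_sq_le_sq ?_ hpos.le
    rw [hv2, gradLen_sq]; nlinarith [sq_nonneg ε]
  have h1 : g * ∑ b, pd b (gradLen ε u) x * pd b u x = ∑ b, (∑ a, pd b (pd a u) x * pd a u x) *
      pd b u x := by
    rw [Finset.mul_sum]
    refine Finset.sum_congr rfl fun b _ => ?_
    rw [← mul_assoc, gradLen_mul_pd hu hε]
    congr 1
    exact Finset.sum_congr rfl fun a _ => mul_comm _ _
  have h2 : (∑ b, (∑ a, pd b (pd a u) x * pd a u x) * pd b u x) ^ 2 ≤ (H * v * v) ^ 2 := by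
    refine (Finset.sum_mul_sq_le_sq_mul_sq _ _ _).trans ?_
    rw [mul_pow, hv2, mul_pow, hv2, hH2]
    refine mul_le_mul_of_nonneg_right ?_ (Finset.sum_nonneg fun _ _ => sq_nonneg _)
    rw [Finset.sum_mul]
    exact Finset.sum_le_sum fun b _ => Finset.sum_mul_sq_le_sq_mul_sq _ _ _
  have h3 := le_of_sq_le_sq h2 (by positivity)
  rw [← h1] at h3
  refine le_of_mul_le_mul_left (h3.trans ?_) hpos
  nlinarith [mul_le_mul_of_nonneg_left hvg (mul_nonneg H0 v0)]

/-- A trace estimate for the flux of `d ^ 2`. -/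
lemma wint_flux_sq_le (hR : 0 < R) (hN : 0 ≤ N) (hW : ContDiff ℝ 2 W)
    (h1 : wint R W (fun _ => 1) = 1) (hu : Neu R u) {C ε c : ℝ} (hε : 0 < ε)
    (hd0 : ∀ i, 0 ≤ d i) (hdC : ∀ i, d i ≤ C) (he : ∀ i, ∑ a, e i a ^ 2 = 1) (hc0 : 0 ≤ c)
    (herr : wint R W (fun x => (wlap W u x - (c - flux N e h d x)) ^ 2) ≤ ε ^ 2) :
    wint R W (flux N e h (fun i => d i ^ 2)) ≤
      (c + ε) * (√(wint R W (fun x => ∑ i, pd i u x ^ 2)) + ε) +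
        √(wint R W (fun x => ∑ a, ∑ b, pd a (pd b u) x ^ 2)) *
          √(wint R W (fun x => ∑ i, pd i u x ^ 2)) +
        C * wint R W (defect N e h d u) := by
  have hc := hW.continuous
  have cu : ∀ i, Continuous (pd i u) := fun i => (hu.pd_contDiff i).continuous
  have c2 : ∀ i j, Continuous (pd i (pd j u)) := fun i j => (hu.pd_pd_contDiff i j).continuous
  have cf : ∀ d : ι → ℝ, Continuous (flux N e h d) := fun d => continuous_flux
  have cd : Continuous (defect N e h d u) := continuous_defect hu
  have cl : Continuous (wlap W u) := (wlap_contDiff hW hu).continuous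
  have hg := contDiff_gradLen hu hε
  have cg := hg.continuous
  have cg1 : ∀ i, Continuous (pd i (gradLen ε u)) := fun i => continuous_pd hg
  set B := √(wint R W (fun x => ∑ i, pd i u x ^ 2)) with hB
  have hB0 : 0 ≤ B := Real.sqrt_nonneg _
  have hB2 : B ^ 2 = wint R W (fun x => ∑ i, pd i u x ^ 2) :=
    Real.sq_sqrt (wint_nonneg fun _ _ => Finset.sum_nonneg fun _ _ => sq_nonneg _)
  have hstep : wint R W (flux N e h (fun i => d i ^ 2)) ≤
      wint R W (fun x => flux N e h d x * gradLen ε u x + C * defect N e h d u x) := by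
    refine wint_mono hc (cf _) (by fun_prop) fun x _ =>
      flux_sq_le hN hd0 hdC he (gradLen_pos hε x).le ?_
    rw [gradLen_sq]; nlinarith [sq_nonneg ε]
  have hsplit : wint R W (fun x => flux N e h d x * gradLen ε u x) =
      c * wint R W (gradLen ε u) - wint R W (fun x => gradLen ε u x * wlap W u x) +
      wint R W (fun x => (wlap W u x - (c - flux N e h d x)) * gradLen ε u x) := by
    rw [← wint_const_mul, ← wint_sub hc (by fun_prop) (by fun_prop),
      ← wint_add hc (by fun_prop) (by fun_prop)]
    congr 1; ext x; ring
  have hg2 : wint R W (fun x => gradLen ε u x ^ 2) ≤ (B + ε) ^ 2 := by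
    simp only [gradLen_sq]
    rw [wint_add hc (by fun_prop) (by fun_prop), wint_const, h1, ← hB2]
    nlinarith [mul_nonneg hB0 hε.le]
  have hg2' : √(wint R W (fun x => gradLen ε u x ^ 2)) ≤ B + ε :=
    Real.sqrt_le_iff.2 ⟨by positivity, hg2⟩
  have hg1 : wint R W (gradLen ε u) ≤ B + ε := by
    have := (le_abs_self _).trans (abs_wint_mul_le (R := R) hc (f := fun _ => 1)
      (g := gradLen ε u) continuous_const cg)
    simp only [one_mul, one_pow, h1, Real.sqrt_one] at this
    exact this.trans hg2'
  have herr' : wint R W (fun x => (wlap W u x - (c - flux N e h d x)) * gradLen ε u x) ≤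
      ε * (B + ε) := by
    have := (le_abs_self _).trans (abs_wint_mul_le (R := R) hc
      (f := fun x => wlap W u x - (c - flux N e h d x)) (g := gradLen ε u) (by fun_prop) cg)
    refine this.trans (mul_le_mul ?_ hg2' (Real.sqrt_nonneg _) hε.le)
    exact Real.sqrt_le_iff.2 ⟨hε.le, herr⟩
  have hH0 : ∀ x, 0 ≤ ∑ a, ∑ b, pd a (pd b u) x ^ 2 := fun x =>
    Finset.sum_nonneg fun _ _ => Finset.sum_nonneg fun _ _ => sq_nonneg _
  have hv0 : ∀ x, 0 ≤ ∑ a, pd a u x ^ 2 := fun x => Finset.sum_nonneg fun _ _ => sq_nonneg _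
  have hmix : wint R W (fun x => ∑ b, pd b (gradLen ε u) x * pd b u x) ≤
      √(wint R W (fun x => ∑ a, ∑ b, pd a (pd b u) x ^ 2)) * B := by
    have := (le_abs_self _).trans (abs_wint_mul_le (R := R) hc
      (f := fun x => √(∑ a, pd a u x ^ 2)) (g := fun x => √(∑ a, ∑ b, pd a (pd b u) x ^ 2))
      (by fun_prop) (by fun_prop))
    simp only [Real.sq_sqrt (hH0 _), Real.sq_sqrt (hv0 _)] at this
    rw [mul_comm _ B]
    refine le_trans ?_ this
    exact wint_mono hc (by fun_prop) (by fun_prop) fun x _ => sum_pd_gradLen_mul_le hu hε x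
  rw [wint_add hc (by fun_prop) (by fun_prop), wint_const_mul, hsplit,
    wint_mul_wlap hR.le hW hg hu] at hstep
  have := mul_le_mul_of_nonneg_left hg1 hc0
  linarith

end fluxEstimates

section secondVariation

variable {n : ℕ} {R : ℝ} {V : Euc n → ℝ} {ι : Type*} [Fintype ι] {N : ℝ} {e : ι → Euc n}
  {h d : ι → ℝ}

lemma flux_neg (σ : Equiv.Perm ι) (hσe : ∀ i, e (σ i) = -e i) (hσh : ∀ i, h (σ i) = h i)
    (hσd : ∀ i, d (σ i) = d i) (x : Euc n) : flux N e h d (-x) = flux N e h d x := by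
  unfold flux
  rw [← Equiv.sum_comp σ]
  refine Finset.sum_congr rfl fun i _ => ?_
  simp [hexp, hσe, hσh, hσd]

lemma pen_neg (σ : Equiv.Perm ι) (hσe : ∀ i, e (σ i) = -e i) (hσh : ∀ i, h (σ i) = h i)
    (x : Euc n) : pen N e h (-x) = pen N e h x := by
  unfold pen
  rw [← Equiv.sum_comp σ]
  refine Finset.sum_congr rfl fun i _ => ?_
  simp [hexp, hσe, hσh]

/-- The second variation of a normalised penalised mass, bounded by quantities that satisfy
Poincaré and Brascamp–Lieb type constraints. -/
lemma second_variation_normalized (hR : 0 < R) (hN : 0 < N) (hV : ContDiff ℝ 2 V)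
    (hVe : ∀ x, V (-x) = V x) {k : ℝ} (hk : 0 ≤ k)
    (hH : ∀ x v, k * ∑ i, v i ^ 2 ≤ hessForm V x v)
    (σ : Equiv.Perm ι) (hσe : ∀ i, e (σ i) = -e i) (hσh : ∀ i, h (σ i) = h i)
    (hσd : ∀ i, d (σ i) = d i) (he : ∀ i, ∑ a, e i a ^ 2 = 1)
    {C C₀ κ m ε : ℝ} (hd0 : ∀ i, 0 ≤ d i) (hdC : ∀ i, d i ≤ C) (hC : 0 ≤ C) {d₂ : ι → ℝ}
    (hκ : 0 ≤ κ) (hd₂ : ∀ i, d₂ i ≤ κ * d i ^ 2)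
    (h1 : wint R (penPot V N e h) (fun _ => 1) = 1)
    (hC₀ : wint R (penPot V N e h) (flux N e h fun _ => 1) ≤ C₀)
    (hm : wint R (penPot V N e h) (fun x => ∑ i, pd i (pd i V) x) ≤ m)
    (hε : 0 < ε) :
    ∃ A B S : ℝ, 0 ≤ A ∧ 0 ≤ B ∧ 0 ≤ S ∧
      wint R (penPot V N e h) (flux N e h d₂) +
        wint R (penPot V N e h)
          (fun x => (flux N e h d x - wint R (penPot V N e h) (flux N e h d)) ^ 2) -
        N * wint R (penPot V N e h) (flux N e h fun i => d i ^ 2) ≤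
      κ * ((wint R (penPot V N e h) (flux N e h d) + ε) * (B + ε) + A * B +
        C * ((C₀ + S) / (2 * √N))) - S - A ^ 2 - k * B ^ 2 + ε ^ 2 ∧
      (0 < k → k * B ^ 2 ≤ A ^ 2 ∧
        wint R (penPot V N e h) (flux N e h d) ≤ √n * √(A ^ 2 - k * B ^ 2) + √(m - n * k) * B +
          (C₀ + S) / (2 * √N)) := by
  have hW := contDiff_penPot (N := N) (e := e) (h := h) hV
  have hWe : ∀ x, penPot V N e h (-x) = penPot V N e h x := fun x => by
    rw [penPot, penPot, hVe, pen_neg σ hσe hσh]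
  have hVW := le_hessForm_penPot (e := e) (h := h) hV hN.le
  have hfe := flux_neg (N := N) σ hσe hσh hσd
  have hHW : ∀ x v, k * ∑ i, v i ^ 2 ≤ hessForm (penPot V N e h) x v := fun x v =>
    (hH x v).trans (hVW x v)
  have hVar := fun (u : Euc n → ℝ) (hu : Neu R u) => wint_variance_identity
    (N := N) (e := e) (h := h) (d := d) hR hV hu (wint R (penPot V N e h) (flux N e h d))
  have hFlux := fun (u : Euc n → ℝ) (hu : Neu R u) =>
    wint_flux_le (e := e) (h := h) (d := d) hR hN.le hV hu
  set W := penPot V N e h with hWdef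
  have hc := hW.continuous
  set c := wint R W (flux N e h d) with hcdef
  have cf : ∀ d : ι → ℝ, Continuous (flux N e h d) := fun d => continuous_flux
  have hp : ∀ i x, 0 ≤ N * hexp N (e i) (h i) x := fun i x =>
    mul_nonneg hN.le (hexp_pos _ _ _ _).le
  have hc0 : 0 ≤ c := wint_nonneg fun x _ => Finset.sum_nonneg fun i _ => mul_nonneg (hd0 i) (hp i x)
  obtain ⟨u, hu, hue, herr⟩ := exists_even_neu_solution hR hW hWe
    (fun x v => (mul_nonneg hk (Finset.sum_nonneg fun i _ => sq_nonneg _)).trans (hHW x v))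
    (g := fun x => c - flux N e h d x) (by have := cf d; fun_prop) (fun x => by rw [hfe])
    (by rw [wint_sub hc continuous_const (cf d), wint_const, h1]; simp [hcdef])
    (ε := ε ^ 2) (by positivity)
  have cu : ∀ i, Continuous (pd i u) := fun i => (hu.pd_contDiff i).continuous
  set A2 := wint R W (fun x => ∑ a, ∑ b, pd a (pd b u) x ^ 2) with hA2
  set B2 := wint R W (fun x => ∑ i, pd i u x ^ 2) with hB2
  set S := N * wint R W (fun x => ∑ i, (N * hexp N (e i) (h i) x) *
        (d i - ∑ a, e i a * pd a u x) ^ 2) with hS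
  have hA0 : 0 ≤ A2 := wint_nonneg fun x _ =>
    Finset.sum_nonneg fun _ _ => Finset.sum_nonneg fun _ _ => sq_nonneg _
  have hB0 : 0 ≤ B2 := wint_nonneg fun x _ => Finset.sum_nonneg fun _ _ => sq_nonneg _
  have hS0 : 0 ≤ S := mul_nonneg hN.le (wint_nonneg fun x _ =>
    Finset.sum_nonneg fun i _ => mul_nonneg (hp i x) (sq_nonneg _))
  have hdef := wint_defect_le (d := d) hN hc hu hC₀ hS.symm
  refine ⟨√A2, √B2, S, Real.sqrt_nonneg _, Real.sqrt_nonneg _, hS0, ?_, fun hk0 => ?_⟩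
  · have e1 : wint R W (flux N e h d₂) ≤ κ * wint R W (flux N e h fun i => d i ^ 2) := by
      rw [← wint_const_mul]
      refine wint_mono hc (cf _) (by have := cf fun i => d i ^ 2; fun_prop) fun x _ => ?_
      simp only [flux, Finset.mul_sum]
      refine Finset.sum_le_sum fun i _ => ?_
      rw [← mul_assoc κ]
      exact mul_le_mul_of_nonneg_right (hd₂ i) (hp i x)
    have e2 := wint_flux_sq_le hR hN.le hW h1 hu hε hd0 hdC he hc0 herr
    have e3 : k * B2 ≤ wint R W (fun x => hessForm V x fun a => pd a u x) := by
      rw [hB2, ← wint_const_mul]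
      have := continuous_hessForm hV cu
      exact wint_mono hc (by fun_prop) (by fun_prop) fun x _ => hH x _
    have e4 := hVar u hu
    rw [Real.sq_sqrt hA0, Real.sq_sqrt hB0]
    have e5 := mul_le_mul_of_nonneg_left (e2.trans
      (add_le_add_right (mul_le_mul_of_nonneg_left hdef hC) _)) hκ
    linarith
  · rw [Real.sq_sqrt hA0, Real.sq_sqrt hB0]
    refine ⟨poincare_gradient hR hW hWe hk0 hHW hu hue, ?_⟩
    have e1 := trace_poincare hR hW hWe h1 hk0 hHW hu hue
    have e2 := neg_wint_grad_mul_le hR hV hVe hW hWe h1 hH hVW hu hm hk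
    have e3 := hFlux u hu
    have e4 := Real.abs_le_sqrt e1
    rw [Real.sqrt_mul (Nat.cast_nonneg n)] at e4
    have e5 := (le_abs_self _).trans e4
    linarith

end secondVariation

section realInequality

lemma exists_small_mul_le (G₁ G₂ : ℝ) {a b : ℝ} (h₁ : 0 ≤ G₁) (h₂ : 0 ≤ G₂) (ha : 0 < a)
    (hb : 0 < b) : ∃ τ : ℝ, 0 < τ ∧ τ ≤ 1 ∧ G₁ * τ ≤ a ∧ G₂ * τ ≤ b := by
  refine ⟨min 1 (min (a / (G₁ + 1)) (b / (G₂ + 1))), by positivity, min_le_left _ _, ?_, ?_⟩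
  · have h : min 1 (min (a / (G₁ + 1)) (b / (G₂ + 1))) ≤ a / (G₁ + 1) :=
      (min_le_right _ _).trans (min_le_left _ _)
    have h3 := (le_div_iff₀ (by positivity)).1 h
    have h4 : 0 < min 1 (min (a / (G₁ + 1)) (b / (G₂ + 1))) := by positivity
    nlinarith
  · have h : min 1 (min (a / (G₁ + 1)) (b / (G₂ + 1))) ≤ b / (G₂ + 1) :=
      (min_le_right _ _).trans (min_le_right _ _)
    have h3 := (le_div_iff₀ (by positivity)).1 h
    have h4 : 0 < min 1 (min (a / (G₁ + 1)) (b / (G₂ + 1))) := by positivity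
    nlinarith

lemma trace_product_le {n k₁ k₂ A B P : ℝ} (hn : 1 ≤ n) (hk₁ : 0 < k₁) (hk : k₁ ≤ k₂)
    (hP : A ^ 2 = P ^ 2 + k₁ * B ^ 2) :
    2 * k₁ * ((√n * P + √(n * (k₂ - k₁)) * B) * B + A * B) ≤
      √n * (√(1 + k₂) * √(1 + k₁)) * (A ^ 2 + k₁ * B ^ 2) := by
  have hn1 : 1 ≤ √n := Real.one_le_sqrt.2 hn
  rw [Real.sqrt_mul (by linarith)]
  set w := √n
  obtain ⟨s, hs, hs2⟩ : ∃ s, 0 < s ∧ s ^ 2 = k₁ := ⟨√k₁, Real.sqrt_pos.2 hk₁, Real.sq_sqrt hk₁.le⟩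
  obtain ⟨K, hK, hK2⟩ : ∃ s, 0 < s ∧ s ^ 2 = k₂ :=
    ⟨√k₂, Real.sqrt_pos.2 (by linarith), Real.sq_sqrt (by linarith)⟩
  have hg0 : 0 ≤ √(k₂ - k₁) := Real.sqrt_nonneg _
  have hg2 : √(k₂ - k₁) ^ 2 = k₂ - k₁ := Real.sq_sqrt (by linarith)
  set g := √(k₂ - k₁)
  have hQ : K + s ≤ √(1 + k₂) * √(1 + k₁) := by
    rw [← Real.sqrt_mul (by linarith)]
    refine Real.le_sqrt_of_sq_le ?_
    rw [← hs2, ← hK2]; nlinarith [sq_nonneg (1 - s * K)]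
  have hgK : g ≤ K := le_of_sq_le_sq (by nlinarith) hK.le
  have hD : 0 ≤ A ^ 2 + k₁ * B ^ 2 := by positivity
  have h1 : 2 * k₁ * (P * B + g * B ^ 2) ≤ K * (A ^ 2 + k₁ * B ^ 2) := by
    rw [hP, ← hs2]
    have e1 : s ^ 2 = (K - g) * (K + g) := by nlinarith
    have h2 : s ^ 2 ≤ 2 * K * (K - g) := by nlinarith
    have h3 : K * (2 * s ^ 2 * (P * B + g * B ^ 2)) ≤
        K * (K * (P ^ 2 + s ^ 2 * B ^ 2 + s ^ 2 * B ^ 2)) := by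
      nlinarith [sq_nonneg (K * P - s ^ 2 * B),
        mul_le_mul_of_nonneg_left h2 (mul_nonneg (sq_nonneg s) (sq_nonneg B))]
    exact le_of_mul_le_mul_left h3 hK
  have h4 : 2 * k₁ * (A * B) ≤ s * (A ^ 2 + k₁ * B ^ 2) := by
    rw [← hs2]; nlinarith [mul_nonneg hs.le (sq_nonneg (A - s * B))]
  have h5 : w * (2 * k₁ * (P * B + g * B ^ 2)) + 2 * k₁ * (A * B) ≤
      w * (K + s) * (A ^ 2 + k₁ * B ^ 2) := by
    have := mul_le_mul_of_nonneg_left h1 (by linarith : 0 ≤ w)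
    have h6 : s * (A ^ 2 + k₁ * B ^ 2) ≤ w * (s * (A ^ 2 + k₁ * B ^ 2)) :=
      le_mul_of_one_le_left (by positivity) hn1
    nlinarith
  have h7 := mul_le_mul_of_nonneg_right (mul_le_mul_of_nonneg_left hQ (by linarith : 0 ≤ w)) hD
  nlinarith

lemma trace_square_le {n k₁ k₂ A B P : ℝ} (hn : 0 ≤ n) (hk : k₁ ≤ k₂)
    (hP : A ^ 2 = P ^ 2 + k₁ * B ^ 2) :
    2 * k₁ * (√n * P + √(n * (k₂ - k₁)) * B) ^ 2 ≤
      n * (k₁ + k₂) * (A ^ 2 + k₁ * B ^ 2) := by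
  rw [Real.sqrt_mul hn]
  have hw : √n ^ 2 = n := Real.sq_sqrt hn
  have hg2 : √(k₂ - k₁) ^ 2 = k₂ - k₁ := Real.sq_sqrt (by linarith)
  have h1 : 2 * k₁ * (P + √(k₂ - k₁) * B) ^ 2 ≤ (k₁ + k₂) * (A ^ 2 + k₁ * B ^ 2) := by
    rw [hP]
    set g := √(k₂ - k₁)
    have e : k₂ = k₁ + g ^ 2 := by linarith
    rw [e]
    nlinarith [sq_nonneg (g * P - 2 * k₁ * B)]
  calc _ = √n ^ 2 * (2 * k₁ * (P + √(k₂ - k₁) * B) ^ 2) := by ring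
    _ ≤ n * ((k₁ + k₂) * (A ^ 2 + k₁ * B ^ 2)) := by
      rw [hw]; exact mul_le_mul_of_nonneg_left h1 hn
    _ = _ := by ring

lemma sq_le_sq_add_of_le {c c₁ e M : ℝ} (hc : 0 ≤ c) (hc₁ : 0 ≤ c₁) (he : 0 ≤ e) (h : c ≤ c₁ + e)
    (hM : c ≤ M) : c ^ 2 ≤ c₁ ^ 2 + 2 * M * e := by
  have hM0 : 0 ≤ M := hc.trans hM
  rcases le_total c c₁ with h | h
  · have := pow_le_pow_left₀ hc h 2
    have : 0 ≤ 2 * M * e := by positivity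
    linarith
  · have h1 : (c - c₁) * (c + c₁) ≤ e * (2 * M) :=
      mul_le_mul (by linarith) (by linarith) (by linarith) he
    nlinarith

lemma mul_le_mul_add_of_le {c c₁ e M B η : ℝ} (hc : 0 ≤ c) (hc₁ : 0 ≤ c₁) (he : 0 ≤ e)
    (hB : 0 ≤ B) (hη : 0 < η) (h : c ≤ c₁ + e) (hM : c ≤ M) :
    c * B ≤ c₁ * B + η * B ^ 2 + M / η * e := by
  have hM0 : 0 ≤ M := hc.trans hM
  have hz : 0 ≤ M / η * e := by positivity
  rcases le_total c c₁ with h | h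
  · have := mul_le_mul_of_nonneg_right h hB
    nlinarith [mul_nonneg hη.le (sq_nonneg B)]
  · have h1 : (c - c₁) ^ 2 ≤ M * e := by
      rw [sq]; exact mul_le_mul (by linarith) (by linarith) (by linarith) (by linarith)
    have h2 : (c - c₁) * B ≤ η * B ^ 2 + (c - c₁) ^ 2 / η := by
      have : η * B ^ 2 + (c - c₁) ^ 2 / η - (c - c₁) * B =
        1 / η * ((η * B - (c - c₁) / 2) ^ 2 + 3 / 4 * (c - c₁) ^ 2) := by field_simp; ring
      have h3 : 0 ≤ 1 / η * ((η * B - (c - c₁) / 2) ^ 2 + 3 / 4 * (c - c₁) ^ 2) := by positivity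
      linarith
    have h3 : (c - c₁) ^ 2 / η ≤ M / η * e := by
      rw [div_mul_eq_mul_div]; gcongr
    linarith

lemma sq_add_mul_le {c B η τ : ℝ} (hη : 0 < η) (hτ : 0 ≤ τ) (hτ1 : τ ≤ 1) :
    (c + τ * B) ^ 2 ≤ (1 + η) * c ^ 2 + (1 + 1 / η) * (τ * B ^ 2) := by
  have h1 : τ ^ 2 * B ^ 2 ≤ τ * B ^ 2 := by
    refine mul_le_mul_of_nonneg_right ?_ (sq_nonneg _); nlinarith
  have h2 : 2 * (c * (τ * B)) ≤ η * c ^ 2 + 1 / η * (τ ^ 2 * B ^ 2) := by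
    have : η * c ^ 2 + 1 / η * (τ ^ 2 * B ^ 2) - 2 * (c * (τ * B)) =
      1 / η * (η * c - τ * B) ^ 2 := by field_simp; ring
    have h3 : 0 ≤ 1 / η * (η * c - τ * B) ^ 2 := by positivity
    linarith
  have h3 : (1 + 1 / η) * (τ ^ 2 * B ^ 2) ≤ (1 + 1 / η) * (τ * B ^ 2) :=
    mul_le_mul_of_nonneg_left h1 (by positivity)
  nlinarith

set_option maxHeartbeats 1000000 in
/-- The concavity inequality behind the condition on `κ` and `q`, with room for small errors. -/
lemma second_variation_real {n k₁ k₂ κ q C C₀ ε₀ : ℝ} (hn : 1 ≤ n) (hk₁ : 0 ≤ k₁) (hk : k₁ ≤ k₂)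
    (hκ : 0 ≤ κ) (hq : 0 ≤ q) (hC : 0 ≤ C) (hC₀ : 0 ≤ C₀) (hε₀ : 0 < ε₀)
    (hcond : κ * (2 * √n * √(1 + k₂) * √(1 + k₁) + √k₁) / 2 + q * (1 + k₂) * (1 + k₁) ≤ 2 * k₁) :
    ∃ τ > 0, ∃ N₀ > 0, ∀ N ≥ N₀, ∀ c A B S X : ℝ, 0 ≤ A → 0 ≤ B → 0 ≤ S → 0 ≤ c → c ≤ C * C₀ →
      X ≤ κ * ((c + τ) * (B + τ) + A * B + C * ((C₀ + S) / (2 * √N))) - S - A ^ 2 - k₁ * B ^ 2 +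
        τ ^ 2 →
      (0 < k₁ → k₁ * B ^ 2 ≤ A ^ 2 ∧
        c ≤ √n * √(A ^ 2 - k₁ * B ^ 2) + √(n * k₂ + τ ^ 2 - n * k₁) * B + (C₀ + S) / (2 * √N)) →
      X + q / n * c ^ 2 ≤ ε₀ := by
  by_cases h0 : κ = 0 ∧ q = 0
  · obtain ⟨rfl, rfl⟩ := h0
    refine ⟨√ε₀, Real.sqrt_pos.2 hε₀, 1, one_pos, fun N _ c A B S X _ _ hS _ _ hX _ => ?_⟩
    rw [Real.sq_sqrt hε₀.le] at hX
    have : 0 ≤ k₁ * B ^ 2 := by positivity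
    simp only [zero_div, zero_mul, zero_sub] at hX ⊢
    linarith [sq_nonneg A]
  have hQ1 : 0 ≤ √n * (√(1 + k₂) * √(1 + k₁)) := by positivity
  have hk0 : 0 < k₁ := by
    rcases hk₁.eq_or_lt with h | h
    · exfalso
      subst h
      have h1 : 1 ≤ √n := Real.one_le_sqrt.2 hn
      have h2 : 1 ≤ √(1 + k₂) := Real.one_le_sqrt.2 (by linarith)
      simp only [add_zero, Real.sqrt_one, Real.sqrt_zero, mul_one, mul_zero] at hcond
      have h3 : 1 ≤ √n * √(1 + k₂) := one_le_mul_of_one_le_of_one_le h1 h2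
      have h4 : κ * 1 ≤ κ * (√n * √(1 + k₂)) := mul_le_mul_of_nonneg_left h3 hκ
      have h5 : q * 1 ≤ q * (1 + k₂) := mul_le_mul_of_nonneg_left (by linarith) hq
      exact h0 ⟨by nlinarith, by nlinarith⟩
    · exact h
  obtain ⟨s, hs, hs2⟩ : ∃ s, 0 < s ∧ s = √k₁ := ⟨√k₁, Real.sqrt_pos.2 hk0, rfl⟩
  rw [← hs2] at hcond
  have hς : 0 < κ * s / 2 + q := by
    rcases hκ.eq_or_lt with h | h
    · have : q ≠ 0 := fun h' => h0 ⟨h.symm, h'⟩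
      have : 0 < q := lt_of_le_of_ne hq (Ne.symm this)
      positivity
    · positivity
  set ς := κ * s / 2 + q with hςdef
  clear_value ς
  set L := (k₁ + k₂) / (2 * k₁) with hL
  have hL0 : 0 ≤ L := by have : 0 ≤ k₂ := hk₁.trans hk; rw [hL]; positivity
  clear_value L
  have hqn : 0 ≤ q / n := div_nonneg hq (by linarith)
  -- choice of the parameters
  obtain ⟨η, hη, -, hη1, hη2⟩ := exists_small_mul_le κ (q / n * (n * L) * 2) (a := ς / 4)
    (b := ς / (4 * k₁)) hκ (by positivity) (by positivity) (by positivity)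
  obtain ⟨τ, hτ, hτ1, hτ2, hτ3⟩ := exists_small_mul_le (2 * κ + q / n * (1 + 1 / η))
    (κ * (C * C₀) + 2 * κ + 1) (a := ς / 4) (b := ε₀ / 2) (by positivity) (by positivity)
    (by positivity) (by positivity)
  set Γ := κ * (C * C₀ / η) + κ * C + 2 * (C * C₀) * (q / n) with hΓ
  have hΓ0 : 0 ≤ Γ := by rw [hΓ]; positivity
  clear_value Γ
  refine ⟨τ, hτ, (Γ + 2 * Γ * C₀ / ε₀ + 1) ^ 2, by positivity, ?_⟩
  intro N hN c A B S X hA hB hS hc hcM hX hk'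
  obtain ⟨hBA, hcb⟩ := hk' hk0
  have hNs : Γ + 2 * Γ * C₀ / ε₀ + 1 ≤ √N := Real.le_sqrt_of_sq_le hN
  have hNpos : 0 < √N := lt_of_lt_of_le (by positivity) hNs
  set e₁ := (C₀ + S) / (2 * √N) with he₁
  have he0 : 0 ≤ e₁ := by rw [he₁]; positivity
  clear_value e₁
  have hΓe : Γ * e₁ ≤ S + ε₀ / 2 := by
    rw [he₁, ← mul_div_assoc, div_le_iff₀ (by positivity)]
    have h1 : (S + ε₀ / 2) * (2 * (Γ + 2 * Γ * C₀ / ε₀ + 1)) ≤ (S + ε₀ / 2) * (2 * √N) := by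
      gcongr
    refine le_trans ?_ h1
    obtain ⟨Z, hZ⟩ : ∃ Z, Z = 2 * Γ * C₀ / ε₀ := ⟨_, rfl⟩
    have h2 : ε₀ * Z = 2 * (Γ * C₀) := by rw [hZ]; field_simp
    have h3 : 0 ≤ Z := by rw [hZ]; positivity
    have h4 := mul_nonneg hS h3
    rw [← hZ]
    have h5 := mul_nonneg hS hΓ0
    have h6 := mul_nonneg hε₀.le hΓ0
    have h7 := mul_nonneg hΓ0 hC₀
    linarith
  obtain ⟨P, hP0, hP⟩ : ∃ P, 0 ≤ P ∧ P = √(A ^ 2 - k₁ * B ^ 2) := ⟨_, Real.sqrt_nonneg _, rfl⟩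
  have hP2 : A ^ 2 = P ^ 2 + k₁ * B ^ 2 := by rw [hP, Real.sq_sqrt (by linarith)]; ring
  rw [← hP] at hcb
  have t1 := trace_product_le hn hk0 hk hP2
  have t2 := trace_square_le (by linarith : 0 ≤ n) hk hP2
  set D := A ^ 2 + k₁ * B ^ 2 with hD
  have hD0 : 0 ≤ D := by rw [hD]; positivity
  clear_value D
  have hBD : 2 * k₁ * B ^ 2 ≤ D := by rw [hD]; linarith
  set c₀ := √n * P + √(n * (k₂ - k₁)) * B with hc₀
  have hc₀0 : 0 ≤ c₀ := by rw [hc₀]; positivity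
  clear_value c₀
  have t2' : c₀ ^ 2 ≤ n * L * D := by
    rw [hL]
    have : n * ((k₁ + k₂) / (2 * k₁)) * D = n * (k₁ + k₂) * D / (2 * k₁) := by field_simp
    rw [this, le_div_iff₀ (by positivity)]
    linarith
  have hcb' : c ≤ c₀ + τ * B + e₁ := by
    have : √(n * k₂ + τ ^ 2 - n * k₁) ≤ √(n * (k₂ - k₁)) + τ := by
      refine Real.sqrt_le_iff.2 ⟨by positivity, ?_⟩
      have : √(n * (k₂ - k₁)) ^ 2 = n * (k₂ - k₁) :=
        Real.sq_sqrt (mul_nonneg (by linarith) (by linarith))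
      nlinarith [mul_nonneg (Real.sqrt_nonneg (n * (k₂ - k₁))) hτ.le]
    have := mul_le_mul_of_nonneg_right this hB
    rw [hc₀]; linarith
  set c₁ := c₀ + τ * B with hc₁
  have hc₁0 : 0 ≤ c₁ := by rw [hc₁]; positivity
  clear_value c₁
  -- the main term
  have main : κ * (c₀ * B + A * B) + q / n * c₀ ^ 2 ≤ D - ς / (2 * k₁) * D := by
    have m1 := mul_le_mul_of_nonneg_left t1 hκ
    have m2 := mul_le_mul_of_nonneg_left t2 hqn
    have m3 : q / n * (n * (k₁ + k₂) * D) = q * (k₁ + k₂) * D := by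
      have : n ≠ 0 := by linarith
      field_simp
    rw [m3] at m2
    have m4 := mul_le_mul_of_nonneg_right hcond hD0
    have m5 : ς / (2 * k₁) * D = ς * D / (2 * k₁) := by ring
    have m6 : 0 ≤ q * (k₁ * k₂) * D := by have : 0 ≤ k₂ := hk₁.trans hk; positivity
    rw [m5, le_sub_iff_add_le, ← le_sub_iff_add_le', div_le_iff₀ (by positivity), hςdef]
    linarith
  -- the error terms
  have hc2 := sq_le_sq_add_of_le hc hc₁0 he0 hcb' hcM
  have hc1 : c₁ ^ 2 ≤ (1 + η) * c₀ ^ 2 + (1 + 1 / η) * (τ * B ^ 2) := by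
    rw [hc₁]; exact sq_add_mul_le hη hτ.le hτ1
  have hcB := mul_le_mul_add_of_le hc hc₁0 he0 hB hη hcb' hcM
  have hcτ : (c + τ) * (B + τ) ≤ c * B + τ * (C * C₀) + τ * B ^ 2 + 2 * τ := by
    have h1 : τ * c ≤ τ * (C * C₀) := mul_le_mul_of_nonneg_left hcM hτ.le
    have h2 : τ * B ≤ τ * (B ^ 2 + 1) := mul_le_mul_of_nonneg_left
      (by nlinarith only [sq_nonneg (B - 1), hB]) hτ.le
    nlinarith only [h1, h2, hτ, hτ1]
  have hτsq : τ ^ 2 ≤ τ := by nlinarith only [hτ, hτ1]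
  -- assembling
  have a1 : κ * ((c + τ) * (B + τ) + A * B + C * e₁) ≤
      κ * (c₀ * B + τ * B ^ 2 + η * B ^ 2 + C * C₀ / η * e₁ + τ * (C * C₀) + τ * B ^ 2 + 2 * τ +
        A * B + C * e₁) := by
    refine mul_le_mul_of_nonneg_left ?_ hκ
    have : c₁ * B = c₀ * B + τ * B ^ 2 := by rw [hc₁]; ring
    linarith only [this, hcτ, hcB]
  have a2 : q / n * c ^ 2 ≤ q / n * ((1 + η) * c₀ ^ 2 + (1 + 1 / η) * (τ * B ^ 2) +
      2 * (C * C₀) * e₁) := mul_le_mul_of_nonneg_left (by linarith only [hc2, hc1]) hqn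
  have b1 : κ * η * B ^ 2 ≤ ς / 4 * B ^ 2 := mul_le_mul_of_nonneg_right hη1 (sq_nonneg B)
  have b2 : (2 * κ + q / n * (1 + 1 / η)) * τ * B ^ 2 ≤ ς / 4 * B ^ 2 :=
    mul_le_mul_of_nonneg_right hτ2 (sq_nonneg B)
  have b3 : q / n * (η * c₀ ^ 2) ≤ ς / (8 * k₁) * D := by
    have h1 : q / n * (η * c₀ ^ 2) ≤ q / n * (η * (n * L * D)) := by gcongr
    have h2 := mul_le_mul_of_nonneg_right hη2 hD0
    have h3 : ς / (8 * k₁) = ς / (4 * k₁) / 2 := by field_simp; norm_num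
    rw [h3]
    linarith only [h1, h2]
  have b4 : ς / 2 * B ^ 2 ≤ ς / (4 * k₁) * D := by
    have h1 := mul_le_mul_of_nonneg_left hBD (show 0 ≤ ς / (4 * k₁) by positivity)
    have h2 : ς / (4 * k₁) * (2 * k₁ * B ^ 2) = ς / 2 * B ^ 2 := by field_simp; norm_num
    linarith only [h1, h2]
  have b5 : ς / (8 * k₁) * D + ς / (4 * k₁) * D ≤ ς / (2 * k₁) * D := by
    have h1 : ς / (2 * k₁) * D - (ς / (8 * k₁) * D + ς / (4 * k₁) * D) = ς / (8 * k₁) * D := by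
      field_simp; ring
    have h2 : 0 ≤ ς / (8 * k₁) * D := by positivity
    linarith only [h1, h2]
  rw [hΓ] at hΓe
  have hX' : X ≤ κ * ((c + τ) * (B + τ) + A * B + C * e₁) - S - D + τ ^ 2 := by rw [hD]; linarith only [hX]
  linarith only [hX', a1, a2, b1, b2, b3, b4, b5, hΓe, main, hτ3, hτsq, mul_le_mul_of_nonneg_left hτsq hκ]

end realInequality

section unnormalized

variable {n : ℕ} {R : ℝ} {V : Euc n → ℝ} {ι : Type*} [Fintype ι] {N : ℝ} {e : ι → Euc n}
  {h d : ι → ℝ}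

lemma wint_one_pos (hR : 0 < R) {W : Euc n → ℝ} (hW : Continuous W) :
    0 < wint R W (fun _ => 1) := by
  have hint : (interior (box n R)).Nonempty := by
    refine ⟨0, mem_interior.2 ⟨Metric.ball 0 R, fun x hx i => ?_, Metric.isOpen_ball,
      Metric.mem_ball_self hR⟩⟩
    rw [mem_ball_zero_iff] at hx
    exact ((Real.norm_eq_abs _).symm.le.trans (PiLp.norm_apply_le x i)).trans hx.le
  rw [wint, setIntegral_pos_iff_support_of_nonneg_ae
    (Eventually.of_forall fun x => by positivity) (integrable_wint hW continuous_const)]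
  have hs : Function.support (fun x => 1 * Real.exp (-W x)) = univ := by
    ext x; simp [(Real.exp_pos _).ne']
  rw [hs, univ_inter]
  exact (isOpen_interior.measure_pos _ hint).trans_le (measure_mono interior_subset)

lemma wint_add_const (W f : Euc n → ℝ) {Z : ℝ} (hZ : 0 < Z) :
    wint R (fun x => W x + Real.log Z) f = wint R W f / Z := by
  rw [wint, wint, ← integral_div]
  congr 1; ext x
  rw [neg_add, Real.exp_add, Real.exp_neg (Real.log Z), Real.exp_log hZ]
  ring

/-- Along a symmetric variation of the penalised potentials, the logarithm of the total mass has
an almost nonpositive second derivative, even after adding `q / n` times the square of its first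
derivative. -/
lemma exists_second_variation_le (hn : 1 ≤ n) (hR : 0 < R) (hV : ContDiff ℝ 2 V)
    (hVc : ConvexOn ℝ univ V) (hVe : ∀ x, V (-x) = V x) {k₁ k₂ κ q C ε₀ r : ℝ} (hk₁ : 0 ≤ k₁)
    (hk : k₁ ≤ k₂) (hH : ∀ x v, k₁ * ∑ i, v i ^ 2 ≤ hessForm V x v)
    (hκ : 0 ≤ κ) (hq : 0 ≤ q) (hC : 0 ≤ C) (hr : 0 < r) (hε₀ : 0 < ε₀)
    (hcond : κ * (2 * √n * √(1 + k₂) * √(1 + k₁) + √k₁) / 2 + q * (1 + k₂) * (1 + k₁) ≤ 2 * k₁)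
    (σ : Equiv.Perm ι) (hσe : ∀ i, e (σ i) = -e i) (he : ∀ i, ∑ a, e i a ^ 2 = 1) :
    ∃ τ > 0, ∃ N₀ > 0, ∀ N ≥ N₀, ∀ h d d₂ : ι → ℝ, (∀ i, h (σ i) = h i) → (∀ i, d (σ i) = d i) →
      (∀ i, r ≤ h i) → (∀ i, 0 ≤ d i) → (∀ i, d i ≤ C) → (∀ i, d₂ i ≤ κ * d i ^ 2) →
      wint R (penPot V N e h) (fun x => ∑ i, pd i (pd i V) x) ≤
        (n * k₂ + τ) * wint R (penPot V N e h) (fun _ => 1) →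
      (wint R (penPot V N e h) (flux N e h d₂) +
        wint R (penPot V N e h) (fun x => flux N e h d x ^ 2) -
        N * wint R (penPot V N e h) (flux N e h fun i => d i ^ 2)) /
          wint R (penPot V N e h) (fun _ => 1) -
        (wint R (penPot V N e h) (flux N e h d) / wint R (penPot V N e h) (fun _ => 1)) ^ 2 +
        q / n * (wint R (penPot V N e h) (flux N e h d) /
          wint R (penPot V N e h) (fun _ => 1)) ^ 2 ≤ ε₀ := by
  obtain ⟨τ, hτ, N₀, hN₀, key⟩ := second_variation_real (n := n) (C := C)
    (C₀ := 2 * (n + Fintype.card ι) / r) (by exact_mod_cast hn) hk₁ hk hκ hq hC (by positivity)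
    hε₀ hcond
  refine ⟨τ ^ 2, by positivity, N₀, hN₀, fun N hN h d d₂ hσh hσd hrh hd0 hdC hd₂ hm => ?_⟩
  have hNpos : 0 < N := hN₀.trans_le hN
  have hW : ContDiff ℝ 2 (penPot V N e h) := contDiff_penPot hV
  set Z := wint R (penPot V N e h) (fun _ => 1) with hZdef
  have hZ : 0 < Z := wint_one_pos hR hW.continuous
  set U : Euc n → ℝ := fun x => V x + Real.log Z with hU
  have hU2 : ContDiff ℝ 2 U := hV.add contDiff_const
  have hpot : penPot U N e h = fun x => penPot V N e h x + Real.log Z := by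
    ext x; simp only [penPot, hU]; ring
  have hw : ∀ f, wint R (penPot U N e h) f = wint R (penPot V N e h) f / Z := fun f => by
    rw [hpot, wint_add_const _ _ hZ]
  have hpd : ∀ j, pd j U = pd j V := fun j => by
    ext x
    rw [hU, pd_add (hV.of_le (by norm_num)) contDiff_const, pd_const, add_zero]
  have hUH : ∀ x v, k₁ * ∑ i, v i ^ 2 ≤ hessForm U x v := fun x v => by
    simpa only [hessForm, hpd] using hH x v
  have h1 : wint R (penPot U N e h) (fun _ => 1) = 1 := by rw [hw]; exact div_self hZ.ne'
  have hC₀ : wint R (penPot U N e h) (flux N e h fun _ => 1) ≤ 2 * (n + Fintype.card ι) / r := by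
    rw [hw, div_le_iff₀ hZ]
    exact wint_flux_one_le hR.le hV hVc hVe hNpos.le hr hrh
  have hm' : wint R (penPot U N e h) (fun x => ∑ i, pd i (pd i U) x) ≤ n * k₂ + τ ^ 2 := by
    simp only [hpd]
    rw [hw, div_le_iff₀ hZ]
    exact hm
  obtain ⟨A, B, S, hA, hB, hS, hX, hc⟩ := second_variation_normalized hR hNpos hU2
    (fun x => by simp only [hU, hVe]) hk₁ hUH σ hσe hσh hσd he hd0 hdC hC hκ hd₂ h1 hC₀ hm' hτ
  have hcU : Continuous (penPot U N e h) := (contDiff_penPot hU2).continuous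
  have hfl : Continuous (flux N e h d) := continuous_flux
  have hf1 : Continuous (flux N e h fun _ => 1) := continuous_flux
  set c := wint R (penPot U N e h) (flux N e h d) with hcdef
  have hpos : ∀ i x, 0 ≤ N * hexp N (e i) (h i) x := fun i x =>
    mul_nonneg hNpos.le (hexp_pos _ _ _ _).le
  have hc0 : 0 ≤ c := wint_nonneg fun x _ =>
    Finset.sum_nonneg fun i _ => mul_nonneg (hd0 i) (hpos i x)
  have hcC : c ≤ C * (2 * (n + Fintype.card ι) / r) := by
    refine le_trans ?_ (mul_le_mul_of_nonneg_left hC₀ hC)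
    rw [← wint_const_mul]
    refine wint_mono hcU hfl (continuous_const.mul hf1) fun x _ => ?_
    simp only [flux, Finset.mul_sum, one_mul]
    exact Finset.sum_le_sum fun i _ => mul_le_mul_of_nonneg_right (hdC i) (hpos i x)
  have hvar : wint R (penPot U N e h) (fun x => (flux N e h d x - c) ^ 2) =
      wint R (penPot U N e h) (fun x => flux N e h d x ^ 2) - c ^ 2 := by
    have e1 : (fun x => (flux N e h d x - c) ^ 2) =
        fun x => (flux N e h d x ^ 2 - 2 * c * flux N e h d x) + c ^ 2 := by ext x; ring
    have c1 : Continuous fun x => flux N e h d x ^ 2 := hfl.pow 2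
    have c2 : Continuous fun x => 2 * c * flux N e h d x := continuous_const.mul hfl
    have c3 : Continuous fun x => flux N e h d x ^ 2 - 2 * c * flux N e h d x := c1.sub c2
    rw [e1, wint_add hcU c3 continuous_const, wint_sub hcU c1 c2, wint_const_mul, wint_const, h1, ← hcdef]
    ring
  have := key N hN c A B S _ hA hB hS hc0 hcC hX hc
  rw [hvar] at this
  have e2 : wint R (penPot V N e h) (flux N e h d) / Z = c := (hw _).symm
  rw [e2]
  simp only [hw] at this
  refine le_trans (le_of_eq ?_) this
  ring

end unnormalized

section layerCake

variable {n : ℕ}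

lemma integral_Ioi_indicator_exp_neg {a : ℝ} (ha : 0 ≤ a) :
    ∫ t in Ioi (0 : ℝ), (Ici a).indicator (fun t => Real.exp (-t)) t = Real.exp (-a) := by
  rw [← integral_exp_neg_Ioi a, setIntegral_indicator measurableSet_Ici]
  refine setIntegral_congr_set ?_
  rcases ha.eq_or_lt with rfl | ha
  · rw [inter_eq_left.2 Ioi_subset_Ici_self]
    exact ae_eq_refl _
  · rw [inter_eq_right.2 (Ici_subset_Ioi.2 ha)]
    exact Ioi_ae_eq_Ici.symm

/-- If the integral of `g` over each sublevel set `{φ ≤ t}` with `t ≥ a` is nonpositive, then the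
integral of `g` against `e^{-φ}` is at most `a` times the total mass of `g`. -/
lemma integral_mul_exp_neg_le {α : Type*} [MeasurableSpace α] {ν : Measure α} [SFinite ν]
    {g φ : α → ℝ} (hg : Integrable g ν) (hφ : Measurable φ) (hφ0 : ∀ x, 0 ≤ φ x) {a : ℝ}
    (ha : 0 ≤ a) (hneg : ∀ t ≥ a, ∫ x in {x | φ x ≤ t}, g x ∂ν ≤ 0) :
    ∫ x, g x * Real.exp (-φ x) ∂ν ≤ a * ∫ x, |g x| ∂ν := by
  set F : α → ℝ → ℝ := fun x t => g x * (Ici (φ x)).indicator (fun t => Real.exp (-t)) t with hF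
  have hexp : Integrable (fun t : ℝ => Real.exp (-t)) (volume.restrict (Ioi 0)) := integrableOn_exp_neg_Ioi 0
  have hS : MeasurableSet {z : α × ℝ | φ z.1 ≤ z.2} :=
    measurableSet_le (hφ.comp measurable_fst) measurable_snd
  have hFe : Function.uncurry F =
      {z : α × ℝ | φ z.1 ≤ z.2}.indicator (fun z => g z.1 * Real.exp (-z.2)) := by
    ext ⟨x, t⟩
    by_cases h : φ x ≤ t <;> simp [hF, Function.uncurry, h]
  have hFint : Integrable (Function.uncurry F) (ν.prod (volume.restrict (Ioi (0 : ℝ)))) := by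
    rw [hFe]; exact (hg.mul_prod hexp).indicator hS
  have h1 : ∀ x, ∫ t in Ioi (0 : ℝ), F x t = g x * Real.exp (-φ x) := fun x => by
    simp only [hF]
    rw [integral_const_mul, integral_Ioi_indicator_exp_neg (hφ0 x)]
  have h2 : ∀ t, ∫ x, F x t ∂ν = (∫ x in {x | φ x ≤ t}, g x ∂ν) * Real.exp (-t) := fun t => by
    rw [← integral_indicator (measurableSet_le hφ measurable_const), ← integral_mul_const]
    congr 1; ext x
    by_cases h : φ x ≤ t <;> simp [hF, h]
  have hA : 0 ≤ ∫ x, |g x| ∂ν := integral_nonneg fun _ => abs_nonneg _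
  calc ∫ x, g x * Real.exp (-φ x) ∂ν = ∫ x, (∫ t in Ioi (0 : ℝ), F x t) ∂ν := by simp only [h1]
    _ = ∫ t in Ioi (0 : ℝ), (∫ x, F x t ∂ν) := integral_integral_swap hFint
    _ ≤ ∫ t in Ioi (0 : ℝ), (Iio a).indicator (fun _ => ∫ x, |g x| ∂ν) t := by
        refine setIntegral_mono_on hFint.integral_prod_right ?_ measurableSet_Ioi fun t ht => ?_
        · rw [IntegrableOn, integrable_indicator_iff measurableSet_Iio, IntegrableOn,
            Measure.restrict_restrict measurableSet_Iio]
          refine integrableOn_const (hs := ?_) (hC := by simp)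
          rw [Iio_inter_Ioi]; simp
        · rw [h2]
          by_cases hta : t < a
          · rw [indicator_of_mem (mem_Iio.2 hta)]
            have h3 : ∫ x in {x | φ x ≤ t}, g x ∂ν ≤ ∫ x, |g x| ∂ν :=
              (le_abs_self _).trans ((abs_integral_le_integral_abs).trans
                (setIntegral_le_integral hg.abs (Eventually.of_forall fun _ => abs_nonneg _)))
            have h4 : Real.exp (-t) ≤ 1 := Real.exp_le_one_iff.2 (by linarith [mem_Ioi.1 ht])
            calc _ ≤ (∫ x, |g x| ∂ν) * Real.exp (-t) :=
                  mul_le_mul_of_nonneg_right h3 (Real.exp_pos _).le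
              _ ≤ _ := mul_le_of_le_one_right hA h4
          · rw [indicator_of_notMem (by simpa using hta)]
            exact mul_nonpos_of_nonpos_of_nonneg (hneg t (not_lt.1 hta)) (Real.exp_pos _).le
    _ = a * ∫ x, |g x| ∂ν := by
        rw [setIntegral_indicator measurableSet_Iio, Ioi_inter_Iio]
        simp [ha]

lemma closedBall_subset_box {r R : ℝ} (h : r ≤ R) :
    Metric.closedBall (0 : Euc n) r ⊆ box n R := fun x hx i => by
  rw [mem_closedBall_zero_iff] at hx
  exact ((Real.norm_eq_abs _).symm.le.trans (PiLp.norm_apply_le x i)).trans (hx.trans h)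

lemma convex_box (R : ℝ) : Convex ℝ (box n R) := by
  have : box n R = ⋂ i : Fin n, {x | |x i| ≤ R} := by ext; simp [box]
  rw [this]
  refine convex_iInter fun i => ?_
  have h1 : {x : Euc n | |x i| ≤ R} = (EuclideanSpace.proj (𝕜 := ℝ) i) ⁻¹' Icc (-R) R := by
    ext x; simp [abs_le]
  rw [h1]
  exact (convex_Icc _ _).linear_preimage (EuclideanSpace.proj (𝕜 := ℝ) i).toLinearMap

/-- The upper bound on the mean of `g` over symmetric convex bodies containing a ball passes to the
mean over a box with respect to an even convex perturbation of the measure. -/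
lemma wint_add_le_of_forall_body {V g φ : Euc n → ℝ} {r R a : ℝ} (hr : 0 < r) (hrR : r ≤ R)
    (hV : Continuous V) (hg : Continuous g) (hφ : Continuous φ) (hφc : ConvexOn ℝ univ φ)
    (hφe : ∀ x, φ (-x) = φ x) (hφ0 : ∀ x, 0 ≤ φ x) (ha : 0 ≤ a)
    (hφa : ∀ x ∈ Metric.closedBall (0 : Euc n) r, φ x ≤ a)
    (hM : ∀ M : Set (Euc n), IsConvexBody M → M = -M → Metric.closedBall (0 : Euc n) r ⊆ M →
      ∫ x in M, g x * Real.exp (-V x) ≤ 0) :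
    wint R (fun x => V x + φ x) g ≤ a * wint R V (fun x => |g x|) := by
  have hint := integrable_wint (R := R) hV hg
  have h := integral_mul_exp_neg_le hint hφ.measurable hφ0 ha fun t ht => by
    rw [Measure.restrict_restrict (measurableSet_le hφ.measurable measurable_const)]
    have hb : Metric.closedBall (0 : Euc n) r ⊆ {x | φ x ≤ t} ∩ box n R := fun x hx =>
      ⟨(hφa x hx).trans ht, closedBall_subset_box hrR hx⟩
    refine hM _ ⟨?_, ?_, ?_⟩ ?_ hb
    · exact (isCompact_box n R).inter_left (isClosed_le hφ continuous_const)
    · refine Convex.inter ?_ (convex_box R)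
      simpa using hφc.convex_le t
    · exact ⟨0, mem_interior.2 ⟨Metric.ball 0 r, Metric.ball_subset_closedBall.trans hb,
        Metric.isOpen_ball, Metric.mem_ball_self hr⟩⟩
    · ext x
      simp [hφe, neg_mem_box]
  refine le_trans (le_of_eq ?_) (h.trans (le_of_eq ?_))
  · rw [wint]; congr 1; ext x; rw [neg_add, Real.exp_add]; ring
  · rw [wint]; congr 2; ext x; rw [abs_mul, abs_of_pos (Real.exp_pos _)]

end layerCake

section traceBound

variable {n : ℕ} {R : ℝ} {V : Euc n → ℝ} {ι : Type*} [Fintype ι] {e : ι → Euc n}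

lemma convexOn_hexp (N : ℝ) (e : Euc n) (h : ℝ) : ConvexOn ℝ univ (hexp N e h) := by
  refine ⟨convex_univ, fun x _ y _ a b ha hb hab => ?_⟩
  have := convexOn_exp.2 (mem_univ (N * (⟪e, x⟫ - h))) (mem_univ (N * (⟪e, y⟫ - h))) ha hb hab
  refine le_trans (le_of_eq ?_) this
  simp only [hexp, inner_add_right, inner_smul_right, smul_eq_mul]
  congr 1
  linear_combination N * h * hab

lemma convexOn_pen (N : ℝ) (e : ι → Euc n) (h : ι → ℝ) : ConvexOn ℝ univ (pen N e h) := by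
  refine ⟨convex_univ, fun x _ y _ a b ha hb hab => ?_⟩
  simp only [pen, Finset.smul_sum, ← Finset.sum_add_distrib]
  exact Finset.sum_le_sum fun i _ =>
    (convexOn_hexp N (e i) (h i)).2 (mem_univ x) (mem_univ y) ha hb hab

lemma pen_nonneg (N : ℝ) (e : ι → Euc n) (h : ι → ℝ) (x : Euc n) : 0 ≤ pen N e h x :=
  Finset.sum_nonneg fun _ _ => (hexp_pos _ _ _ _).le

lemma norm_eq_one_of_sum_sq {v : Euc n} (hv : ∑ a, v a ^ 2 = 1) : ‖v‖ = 1 := by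
  rw [EuclideanSpace.norm_eq]
  simp [hv]

lemma pen_le_of_mem_closedBall {N : ℝ} (hN : 0 < N) {h : ι → ℝ} {r : ℝ}
    (he : ∀ i, ∑ a, e i a ^ 2 = 1) (hh : ∀ i, r + 1 / √N ≤ h i) {x : Euc n}
    (hx : x ∈ Metric.closedBall (0 : Euc n) r) :
    pen N e h x ≤ Fintype.card ι * Real.exp (-√N) := by
  rw [mem_closedBall_zero_iff] at hx
  have hs : 0 < √N := Real.sqrt_pos.2 hN
  have key : ∀ i, hexp N (e i) (h i) x ≤ Real.exp (-√N) := fun i => by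
    have h1 : ⟪e i, x⟫ ≤ r := by
      have := real_inner_le_norm (e i) x
      rw [norm_eq_one_of_sum_sq (he i), one_mul] at this
      exact this.trans hx
    have h2 : ⟪e i, x⟫ - h i ≤ -(1 / √N) := by linarith [hh i]
    refine Real.exp_le_exp.2 ((mul_le_mul_of_nonneg_left h2 hN.le).trans (le_of_eq ?_))
    nth_rewrite 1 [← Real.mul_self_sqrt hN.le]
    field_simp
  calc pen N e h x ≤ ∑ _i : ι, Real.exp (-√N) := Finset.sum_le_sum fun i _ => key i
    _ = _ := by simp

/-- The mean of the trace with respect to penalised measures is asymptotically controlled by its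
means over symmetric convex bodies. -/
lemma exists_wint_trace_le {L : Euc n → ℝ} {r m : ℝ} (hr : 0 < r) (hrR : r ≤ R)
    (hV : Continuous V) (hL : Continuous L)
    (hM : ∀ M : Set (Euc n), IsConvexBody M → M = -M → Metric.closedBall (0 : Euc n) r ⊆ M →
      ∫ x in M, (L x - m) * Real.exp (-V x) ≤ 0)
    (σ : Equiv.Perm ι) (hσe : ∀ i, e (σ i) = -e i) (he : ∀ i, ∑ a, e i a ^ 2 = 1)
    {τ : ℝ} (hτ : 0 < τ) :
    ∃ N₀ > 0, ∀ N ≥ N₀, ∀ h : ι → ℝ, (∀ i, h (σ i) = h i) → (∀ i, r + 1 / √N ≤ h i) →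
      wint R (penPot V N e h) L ≤ (m + τ) * wint R (penPot V N e h) (fun _ => 1) := by
  have hLm : Continuous fun x => L x - m := hL.sub continuous_const
  set G := wint R V (fun x => |L x - m|) with hG
  set m₀ := ∫ x in Metric.closedBall (0 : Euc n) r, Real.exp (-V x) with hm₀
  have hcE : Continuous fun x => Real.exp (-V x) := Real.continuous_exp.comp hV.neg
  have hEi : IntegrableOn (fun x => Real.exp (-V x)) (Metric.closedBall (0 : Euc n) r) :=
    hcE.continuousOn.integrableOn_compact (isCompact_closedBall _ _)
  have hm₀pos : 0 < m₀ := by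
    rw [hm₀, setIntegral_pos_iff_support_of_nonneg_ae
      (Eventually.of_forall fun x => (Real.exp_pos _).le) hEi]
    have hs : Function.support (fun x => Real.exp (-V x)) = univ := by
      ext x; simp [(Real.exp_pos _).ne']
    rw [hs, univ_inter]
    exact Metric.measure_closedBall_pos _ _ hr
  have hlim : Tendsto (fun N : ℝ => Fintype.card ι * Real.exp (-√N) * G) atTop (𝓝 0) := by
    have := ((Real.tendsto_exp_neg_atTop_nhds_zero.comp Real.tendsto_sqrt_atTop).const_mul
      (Fintype.card ι : ℝ)).mul_const G
    simpa using this
  have hpos : 0 < τ * (Real.exp (-(Fintype.card ι : ℝ)) * m₀) := by positivity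
  obtain ⟨N₀, hN₀⟩ := eventually_atTop.1 (hlim.eventually (eventually_lt_nhds hpos))
  refine ⟨max N₀ 1, by positivity, fun N hN h hσh hh => ?_⟩
  have hN0 : 0 < N := lt_of_lt_of_le (by positivity) hN
  have hW : Continuous (penPot V N e h) := hV.add (contDiff_pen (k := 0)).continuous
  have ha : 0 ≤ Fintype.card ι * Real.exp (-√N) := by positivity
  have hφa := fun x hx => pen_le_of_mem_closedBall (x := x) hN0 he hh hx
  have h1 := wint_add_le_of_forall_body hr hrR hV hLm (contDiff_pen (k := 0)).continuous
    (convexOn_pen N e h) (pen_neg σ hσe hσh) (pen_nonneg N e h) ha hφa hM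
  have h2 : wint R (penPot V N e h) (fun x => L x - m) =
      wint R (penPot V N e h) L - m * wint R (penPot V N e h) (fun _ => 1) := by
    rw [wint_sub hW hL continuous_const, wint_const]
  have h3 : Real.exp (-(Fintype.card ι : ℝ)) * m₀ ≤ wint R (penPot V N e h) (fun _ => 1) := by
    rw [hm₀, ← integral_const_mul, wint]
    have hint := integrable_wint (R := R) hW (continuous_const (y := (1 : ℝ)))
    refine le_trans ?_ (setIntegral_mono_set hint (Eventually.of_forall fun x => by
      simpa using (Real.exp_pos _).le) (closedBall_subset_box hrR).eventuallyLE)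
    refine setIntegral_mono_on (hEi.const_mul _) (hint.mono_set (closedBall_subset_box hrR))
      Metric.isClosed_closedBall.measurableSet fun x hx => ?_
    rw [one_mul, ← Real.exp_add]
    refine Real.exp_le_exp.2 ?_
    have h4 := hφa x hx
    have h5 : (Fintype.card ι : ℝ) * Real.exp (-√N) ≤ Fintype.card ι :=
      mul_le_of_le_one_right (by positivity) (Real.exp_le_one_iff.2 (by simp))
    simp only [penPot]
    linarith
  have h6 := hN₀ N ((le_max_left _ _).trans hN)
  have h7 := mul_le_mul_of_nonneg_left h3 hτ.le
  have h8 : wint R (penPot V N e h) (fun x => L x - m) ≤ Fintype.card ι * Real.exp (-√N) * G := h1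
  rw [h2] at h8
  linarith

end traceBound

section parametric

variable {n : ℕ} {R : ℝ}

/-- Differentiation under the integral sign over a box. -/
lemma hasDerivAt_setIntegral_box {F F' : ℝ → Euc n → ℝ} {I : Set ℝ} (hI : IsOpen I)
    (hF : ∀ s ∈ I, Continuous (F s)) (hF' : ContinuousOn (Function.uncurry F') (I ×ˢ univ))
    (hd : ∀ s ∈ I, ∀ x, HasDerivAt (fun t => F t x) (F' s x) s) {s : ℝ} (hs : s ∈ I) :
    HasDerivAt (fun t => ∫ x in box n R, F t x) (∫ x in box n R, F' s x) s := by
  obtain ⟨ε, hε, hball⟩ := Metric.nhds_basis_closedBall.mem_iff.1 (hI.mem_nhds hs)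
  have hcomp : IsCompact (Metric.closedBall s ε ×ˢ box n R) :=
    (isCompact_closedBall s ε).prod (isCompact_box n R)
  obtain ⟨C, hC⟩ := hcomp.exists_bound_of_continuousOn
    (hF'.mono (prod_mono hball (subset_univ _)))
  have hF's : ∀ t ∈ I, Continuous (F' t) := fun t ht => by
    rw [← continuousOn_univ]
    exact hF'.comp (by fun_prop : Continuous fun x : Euc n => (t, x)).continuousOn
      fun x _ => ⟨ht, mem_univ _⟩
  refine (hasDerivAt_integral_of_dominated_loc_of_deriv_le (bound := fun _ => C)
    (Metric.closedBall_mem_nhds s hε) ?_ (integrableOn_box (hF s hs))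
    (hF's s hs).aestronglyMeasurable ?_ ?_ ?_).2
  · filter_upwards [hI.mem_nhds hs] with t ht using (hF t ht).aestronglyMeasurable
  · filter_upwards [ae_restrict_mem (measurableSet_box n R)] with x hx t ht
    exact hC (t, x) ⟨ht, hx⟩
  · exact integrableOn_const (isCompact_box n R).measure_lt_top.ne (by simp)
  · exact Eventually.of_forall fun x t ht => hd t (hball ht) x

end parametric

section massDerivative

variable {n : ℕ} {R : ℝ} {V : Euc n → ℝ} {ι : Type*} [Fintype ι] {N : ℝ} {e : ι → Euc n}
  {h d d₂ : ℝ → ι → ℝ} {I : Set ℝ}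

lemma hasDerivAt_hexp {N : ℝ} {e x : Euc n} {g : ℝ → ℝ} {g' s : ℝ} (hg : HasDerivAt g g' s) :
    HasDerivAt (fun t => hexp N e (g t) x) (-(g' * (N * hexp N e (g s) x))) s := by
  have := ((hg.const_sub ⟪e, x⟫).const_mul N).exp
  simp only [hexp]
  refine this.congr_deriv ?_
  ring

lemma hasDerivAt_pen (s : ℝ) (hh : ∀ i, HasDerivAt (fun t => h t i) (d s i) s) (x : Euc n) :
    HasDerivAt (fun t => pen N e (h t) x) (-flux N e (h s) (d s) x) s := by
  have := HasDerivAt.fun_sum (u := Finset.univ) fun i _ =>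
    hasDerivAt_hexp (N := N) (e := e i) (x := x) (hh i)
  simpa only [pen, flux, Finset.sum_neg_distrib] using this

lemma hasDerivAt_flux (s : ℝ) (hh : ∀ i, HasDerivAt (fun t => h t i) (d s i) s)
    (hd : ∀ i, HasDerivAt (fun t => d t i) (d₂ s i) s) (x : Euc n) :
    HasDerivAt (fun t => flux N e (h t) (d t) x)
      (flux N e (h s) (d₂ s) x - N * flux N e (h s) (fun i => d s i ^ 2) x) s := by
  have := HasDerivAt.fun_sum (u := Finset.univ) fun i _ =>
    (hd i).fun_mul ((hasDerivAt_hexp (N := N) (e := e i) (x := x) (hh i)).const_mul N)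
  simp only [flux]
  refine this.congr_deriv ?_
  rw [Finset.mul_sum, ← Finset.sum_sub_distrib]
  refine Finset.sum_congr rfl fun i _ => ?_
  ring

lemma hasDerivAt_exp_neg_penPot (s : ℝ) (hh : ∀ i, HasDerivAt (fun t => h t i) (d s i) s)
    (x : Euc n) :
    HasDerivAt (fun t => Real.exp (-penPot V N e (h t) x))
      (flux N e (h s) (d s) x * Real.exp (-penPot V N e (h s) x)) s := by
  have := ((hasDerivAt_pen (N := N) (e := e) s hh x).const_add (V x)).fun_neg.exp
  simp only [penPot]
  refine this.congr_deriv ?_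
  ring

lemma continuousOn_hexp_prod {g : ℝ → ℝ} (hg : ContinuousOn g I) (N : ℝ) (e : Euc n) :
    ContinuousOn (fun z : ℝ × Euc n => hexp N e (g z.1) z.2) (I ×ˢ univ) := by
  have h1 : ContinuousOn (fun z : ℝ × Euc n => g z.1) (I ×ˢ univ) :=
    hg.comp continuous_fst.continuousOn fun z hz => hz.1
  have h2 : ContinuousOn (fun z : ℝ × Euc n => ⟪e, z.2⟫) (I ×ˢ univ) := by fun_prop
  exact Real.continuous_exp.comp_continuousOn (continuousOn_const.mul (h2.sub h1))

lemma continuousOn_flux_prod (hh : ∀ i, ContinuousOn (fun t => h t i) I)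
    (hd : ∀ i, ContinuousOn (fun t => d t i) I) :
    ContinuousOn (fun z : ℝ × Euc n => flux N e (h z.1) (d z.1) z.2) (I ×ˢ univ) :=
  continuousOn_finsetSum _ fun i _ =>
    ((hd i).comp continuous_fst.continuousOn fun _ hz => hz.1).mul
      (continuousOn_const.mul (continuousOn_hexp_prod (hh i) N (e i)))

lemma continuousOn_exp_neg_penPot_prod (hV : Continuous V)
    (hh : ∀ i, ContinuousOn (fun t => h t i) I) :
    ContinuousOn (fun z : ℝ × Euc n => Real.exp (-penPot V N e (h z.1) z.2)) (I ×ˢ univ) := by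
  refine Real.continuous_exp.comp_continuousOn (ContinuousOn.neg ?_)
  exact (hV.comp continuous_snd).continuousOn.add
    (continuousOn_finsetSum _ fun i _ => continuousOn_hexp_prod (hh i) N (e i))

lemma hasDerivAt_wint_one (hI : IsOpen I) (hV : Continuous V)
    (hh : ∀ s ∈ I, ∀ i, HasDerivAt (fun t => h t i) (d s i) s)
    (hd : ∀ i, ContinuousOn (fun t => d t i) I) {s : ℝ} (hs : s ∈ I) :
    HasDerivAt (fun t => wint R (penPot V N e (h t)) (fun _ => 1))
      (wint R (penPot V N e (h s)) (flux N e (h s) (d s))) s := by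
  have hhc : ∀ i, ContinuousOn (fun t => h t i) I := fun i t ht =>
    (hh t ht i).continuousAt.continuousWithinAt
  simp only [wint, one_mul]
  refine hasDerivAt_setIntegral_box
    (F' := fun s x => flux N e (h s) (d s) x * Real.exp (-penPot V N e (h s) x)) hI
    (fun t _ => ?_) ?_ (fun t ht x => hasDerivAt_exp_neg_penPot t (hh t ht) x) hs
  · exact Real.continuous_exp.comp (hV.add (contDiff_pen (k := 0)).continuous).neg
  · exact (continuousOn_flux_prod hhc hd).mul (continuousOn_exp_neg_penPot_prod hV hhc)

lemma hasDerivAt_wint_flux (hI : IsOpen I) (hV : Continuous V)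
    (hh : ∀ s ∈ I, ∀ i, HasDerivAt (fun t => h t i) (d s i) s)
    (hd : ∀ s ∈ I, ∀ i, HasDerivAt (fun t => d t i) (d₂ s i) s)
    (hd₂ : ∀ i, ContinuousOn (fun t => d₂ t i) I) {s : ℝ} (hs : s ∈ I) :
    HasDerivAt (fun t => wint R (penPot V N e (h t)) (flux N e (h t) (d t)))
      (wint R (penPot V N e (h s)) (flux N e (h s) (d₂ s)) +
        wint R (penPot V N e (h s)) (fun x => flux N e (h s) (d s) x ^ 2) -
        N * wint R (penPot V N e (h s)) (flux N e (h s) fun i => d s i ^ 2)) s := by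
  have hhc : ∀ i, ContinuousOn (fun t => h t i) I := fun i t ht =>
    (hh t ht i).continuousAt.continuousWithinAt
  have hdc : ∀ i, ContinuousOn (fun t => d t i) I := fun i t ht =>
    (hd t ht i).continuousAt.continuousWithinAt
  have hWc : ∀ t, Continuous (penPot V N e (h t)) := fun t =>
    hV.add (contDiff_pen (k := 0)).continuous
  have c1 : Continuous (flux N e (h s) (d₂ s)) := continuous_flux
  have c2 : Continuous fun x => flux N e (h s) (d s) x ^ 2 := continuous_flux.pow 2
  have c3 : Continuous fun x => N * flux N e (h s) (fun i => d s i ^ 2) x :=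
    continuous_const.mul continuous_flux
  have c4 : Continuous fun x => flux N e (h s) (d₂ s) x + flux N e (h s) (d s) x ^ 2 := c1.add c2
  rw [← wint_const_mul, ← wint_add (hWc s) c1 c2, ← wint_sub (hWc s) c4 c3]
  simp only [wint]
  refine hasDerivAt_setIntegral_box
    (F' := fun s x => (flux N e (h s) (d₂ s) x + flux N e (h s) (d s) x ^ 2 -
      N * flux N e (h s) (fun i => d s i ^ 2) x) * Real.exp (-penPot V N e (h s) x)) hI
    (fun t _ => ?_) ?_ (fun t ht x => ?_) hs
  · exact continuous_flux.mul (Real.continuous_exp.comp (hWc t).neg)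
  · exact (((continuousOn_flux_prod hhc hd₂).add ((continuousOn_flux_prod hhc hdc).pow 2)).sub
      (continuousOn_const.mul (continuousOn_flux_prod (d := fun t i => d t i ^ 2) hhc
        fun i => (hdc i).pow 2))).mul (continuousOn_exp_neg_penPot_prod hV hhc)
  · have := (hasDerivAt_flux (N := N) (e := e) t (hh t ht) (hd t ht) x).fun_mul
      (hasDerivAt_exp_neg_penPot (V := V) (N := N) (e := e) t (hh t ht) x)
    refine this.congr_deriv ?_
    ring

lemma abs_exp_neg_penPot_le (x : Euc n) (h : ι → ℝ) :
    ‖Real.exp (-penPot V N e h x)‖ ≤ Real.exp (-V x) := by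
  rw [Real.norm_eq_abs, abs_of_pos (Real.exp_pos _)]
  exact Real.exp_le_exp.2 (neg_le_neg (le_add_of_nonneg_right (pen_nonneg N e h x)))

lemma continuousOn_wint_one {J : Set ℝ} (hV : Continuous V)
    (hh : ∀ i, ContinuousOn (fun t => h t i) J) :
    ContinuousOn (fun t => wint R (penPot V N e (h t)) (fun _ => 1)) J := by
  simp only [wint, one_mul]
  refine continuousOn_of_dominated (bound := fun x => Real.exp (-V x)) (fun t _ => ?_)
    (fun t _ => Eventually.of_forall fun x => abs_exp_neg_penPot_le x _)
    (integrableOn_box (Real.continuous_exp.comp hV.neg)) (Eventually.of_forall fun x => ?_)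
  · exact (Real.continuous_exp.comp
      (hV.add (contDiff_pen (k := 0)).continuous).neg).aestronglyMeasurable
  · have := (continuousOn_exp_neg_penPot_prod (V := V) (N := N) (e := e) hV hh)
    exact this.comp (by fun_prop : Continuous fun t : ℝ => (t, x)).continuousOn
      fun t ht => ⟨ht, mem_univ _⟩

end massDerivative

section almostConcave

/-- A function on `[0, 1]` with second derivative at most `ε` is concave up to an error `ε`. -/
lemma le_add_of_deriv2_le {f f' f'' : ℝ → ℝ} {ε : ℝ} (hε : 0 ≤ ε)
    (hf : ContinuousOn f (Icc 0 1)) (hf' : ∀ s ∈ Ioo (0 : ℝ) 1, HasDerivAt f (f' s) s)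
    (hf'' : ∀ s ∈ Ioo (0 : ℝ) 1, HasDerivAt f' (f'' s) s)
    (hle : ∀ s ∈ Ioo (0 : ℝ) 1, f'' s ≤ ε) {s : ℝ} (hs : s ∈ Icc (0 : ℝ) 1) :
    (1 - s) * f 0 + s * f 1 ≤ f s + ε := by
  have hc : ConcaveOn ℝ (Icc (0 : ℝ) 1) fun t => f t - ε / 2 * t ^ 2 := by
    refine concaveOn_of_hasDerivWithinAt2_nonpos (f' := fun t => f' t - ε * t)
      (f'' := fun t => f'' t - ε) (convex_Icc 0 1) (hf.sub (by fun_prop)) ?_ ?_ ?_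
    · rw [interior_Icc]
      intro t ht
      have h1 : HasDerivAt (fun t : ℝ => ε / 2 * t ^ 2) (ε * t) t := by
        refine ((hasDerivAt_pow 2 t).const_mul (ε / 2)).congr_deriv ?_
        push_cast
        ring
      exact ((hf' t ht).sub h1).hasDerivWithinAt
    · rw [interior_Icc]
      intro t ht
      have h1 : HasDerivAt (fun t : ℝ => ε * t) ε t := by
        simpa using (hasDerivAt_id t).const_mul ε
      exact ((hf'' t ht).sub h1).hasDerivWithinAt
    · rw [interior_Icc]
      intro t ht
      linarith [hle t ht]
  have := hc.2 (left_mem_Icc.2 zero_le_one) (right_mem_Icc.2 zero_le_one)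
    (sub_nonneg.2 hs.2) hs.1 (by ring)
  simp only [smul_eq_mul, mul_zero, mul_one, zero_add] at this
  nlinarith [mul_nonneg hε hs.1, mul_nonneg hε (sq_nonneg s), hs.1, hs.2]

variable {M M' M'' : ℝ → ℝ} {ε : ℝ}

lemma log_le_add_of_deriv2_le (hε : 0 ≤ ε) (hpos : ∀ s, 0 < M s)
    (hM : ContinuousOn M (Icc 0 1)) (hM' : ∀ s ∈ Ioo (0 : ℝ) 1, HasDerivAt M (M' s) s)
    (hM'' : ∀ s ∈ Ioo (0 : ℝ) 1, HasDerivAt M' (M'' s) s)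
    (hle : ∀ s ∈ Ioo (0 : ℝ) 1, M'' s / M s - (M' s / M s) ^ 2 ≤ ε) {s : ℝ}
    (hs : s ∈ Icc (0 : ℝ) 1) :
    (1 - s) * Real.log (M 0) + s * Real.log (M 1) ≤ Real.log (M s) + ε := by
  refine le_add_of_deriv2_le (f := fun s => Real.log (M s)) (f' := fun s => M' s / M s)
    (f'' := fun s => M'' s / M s - (M' s / M s) ^ 2) hε (hM.log fun s _ => (hpos s).ne')
    (fun s hs => (hM' s hs).log (hpos s).ne') (fun s hs => ?_) hle hs
  refine ((hM'' s hs).fun_div (hM' s hs) (hpos s).ne').congr_deriv ?_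
  field_simp [(hpos s).ne']

lemma rpow_le_add_of_deriv2_le {α B : ℝ} (hα : 0 < α) (hε : 0 ≤ ε) (hpos : ∀ s, 0 < M s)
    (hB : ∀ s, M s ≤ B)
    (hM : ContinuousOn M (Icc 0 1)) (hM' : ∀ s ∈ Ioo (0 : ℝ) 1, HasDerivAt M (M' s) s)
    (hM'' : ∀ s ∈ Ioo (0 : ℝ) 1, HasDerivAt M' (M'' s) s)
    (hle : ∀ s ∈ Ioo (0 : ℝ) 1, M'' s / M s - (M' s / M s) ^ 2 + α * (M' s / M s) ^ 2 ≤ ε) {s : ℝ}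
    (hs : s ∈ Icc (0 : ℝ) 1) :
    (1 - s) * M 0 ^ α + s * M 1 ^ α ≤ M s ^ α + α * B ^ α * ε := by
  have hB0 : 0 ≤ B := (hpos 0).le.trans (hB 0)
  refine le_add_of_deriv2_le (f := fun s => M s ^ α) (f' := fun s => M' s * α * M s ^ (α - 1))
    (f'' := fun s => α * M s ^ α * (M'' s / M s - (M' s / M s) ^ 2 + α * (M' s / M s) ^ 2))
    (by positivity) (hM.rpow_const fun s _ => Or.inl (hpos s).ne')
    (fun s hs => (hM' s hs).rpow_const (Or.inl (hpos s).ne')) (fun s hs => ?_) (fun s hs => ?_) hs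
  · have h1 := ((hM'' s hs).mul_const α).fun_mul
      ((hM' s hs).rpow_const (p := α - 1) (Or.inl (hpos s).ne'))
    refine h1.congr_deriv ?_
    simp only [Real.rpow_sub_one (hpos s).ne']
    field_simp [(hpos s).ne']
    ring
  · have h1 : M s ^ α ≤ B ^ α := Real.rpow_le_rpow (hpos s).le (hB s) hα.le
    have h2 : 0 ≤ M s ^ α := Real.rpow_nonneg (hpos s).le _
    calc _ ≤ α * M s ^ α * ε := mul_le_mul_of_nonneg_left (hle s hs) (by positivity)
      _ ≤ _ := by gcongr

end almostConcave

section halfSpaces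

variable {n : ℕ} {R : ℝ} {V : Euc n → ℝ} {ι : Type*} [Fintype ι] {e : ι → Euc n}

/-- The intersection of the half-spaces `⟪eᵢ, x⟫ ≤ hᵢ`. -/
def halfSpaces {n : ℕ} {ι : Type*} (e : ι → Euc n) (h : ι → ℝ) : Set (Euc n) :=
  {x | ∀ i, ⟪e i, x⟫ ≤ h i}

lemma isClosed_halfSpaces {ι : Type*} (e : ι → Euc n) (h : ι → ℝ) :
    IsClosed (halfSpaces e h) := by
  simp only [halfSpaces, ofPred_forall]
  exact isClosed_iInter fun i => isClosed_le (by fun_prop) continuous_const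

lemma tendsto_sqrt_mul_sub {δ : ℝ} (hδ : 0 < δ) :
    Tendsto (fun N : ℝ => N * δ - √N) atTop atTop := by
  have h1 : Tendsto (fun N : ℝ => √N * (√N * δ - 1)) atTop atTop :=
    Real.tendsto_sqrt_atTop.atTop_mul_atTop₀
      (tendsto_atTop_add_const_right _ (-1) (Real.tendsto_sqrt_atTop.atTop_mul_const hδ))
  refine h1.congr' ?_
  filter_upwards [eventually_ge_atTop 0] with N hN
  nth_rewrite 3 [← Real.mul_self_sqrt hN]
  ring

lemma hexp_add_inv_sqrt {N : ℝ} (hN : 0 < N) (e x : Euc n) (h : ℝ) :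
    hexp N e (h + 1 / √N) x = Real.exp (N * (⟪e, x⟫ - h) - √N) := by
  have hs : 0 < √N := Real.sqrt_pos.2 hN
  rw [hexp]
  congr 1
  have : N * (1 / √N) = √N := by
    nth_rewrite 1 [← Real.mul_self_sqrt hN.le]
    field_simp
  linear_combination -this

lemma tendsto_exp_neg_penPot (V : Euc n → ℝ) (e : ι → Euc n) (h : ι → ℝ) (x : Euc n) :
    Tendsto (fun N : ℝ => Real.exp (-penPot V N e (fun i => h i + 1 / √N) x)) atTop
      (𝓝 ((halfSpaces e h).indicator (fun x => Real.exp (-V x)) x)) := by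
  by_cases hx : x ∈ halfSpaces e h
  · rw [indicator_of_mem hx]
    have h1 : Tendsto (fun N : ℝ => pen N e (fun i => h i + 1 / √N) x) atTop (𝓝 0) := by
      have h2 : Tendsto (fun N : ℝ => Fintype.card ι * Real.exp (-√N)) atTop (𝓝 0) := by
        have := (Real.tendsto_exp_neg_atTop_nhds_zero.comp Real.tendsto_sqrt_atTop).const_mul
          (Fintype.card ι : ℝ)
        simpa using this
      refine tendsto_of_tendsto_of_tendsto_of_le_of_le' tendsto_const_nhds h2
        (Eventually.of_forall fun N => pen_nonneg N e _ x) ?_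
      filter_upwards [eventually_gt_atTop 0] with N hN
      calc pen N e (fun i => h i + 1 / √N) x ≤ ∑ _i : ι, Real.exp (-√N) := by
            refine Finset.sum_le_sum fun i _ => ?_
            rw [hexp_add_inv_sqrt hN]
            refine Real.exp_le_exp.2 ?_
            nlinarith [mul_nonneg hN.le (sub_nonneg.2 (hx i))]
        _ = _ := by simp
    have h3 := (h1.const_add (V x)).neg.rexp
    simpa only [penPot, add_zero] using h3
  · rw [indicator_of_notMem hx]
    obtain ⟨i, hi⟩ : ∃ i, h i < ⟪e i, x⟫ := by simpa [halfSpaces] using hx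
    refine Real.tendsto_exp_atBot.comp (tendsto_neg_atTop_atBot.comp ?_)
    refine tendsto_atTop_add_const_left _ (V x) ?_
    have h1 := Real.tendsto_exp_atTop.comp (tendsto_sqrt_mul_sub (sub_pos.2 hi))
    refine tendsto_atTop_mono' _ ?_ h1
    filter_upwards [eventually_gt_atTop 0] with N hN
    rw [Function.comp_apply, ← hexp_add_inv_sqrt hN]
    exact Finset.single_le_sum (f := fun i => hexp N (e i) (h i + 1 / √N) x)
      (fun j _ => (hexp_pos _ _ _ _).le) (Finset.mem_univ i)

lemma tendsto_wint_one (hV : Continuous V) (e : ι → Euc n) (h : ι → ℝ) :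
    Tendsto (fun N : ℝ => wint R (penPot V N e (fun i => h i + 1 / √N)) (fun _ => 1)) atTop
      (𝓝 (∫ x in box n R ∩ halfSpaces e h, Real.exp (-V x))) := by
  rw [← setIntegral_indicator (isClosed_halfSpaces e h).measurableSet]
  simp only [wint, one_mul]
  refine tendsto_integral_filter_of_dominated_convergence (fun x => Real.exp (-V x))
    (Eventually.of_forall fun N => ?_)
    (Eventually.of_forall fun N => Eventually.of_forall fun x => abs_exp_neg_penPot_le x _)
    (integrableOn_box (Real.continuous_exp.comp hV.neg))
    (Eventually.of_forall fun x => tendsto_exp_neg_penPot V e h x)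
  exact (Real.continuous_exp.comp
    (hV.add (contDiff_pen (k := 0)).continuous).neg).aestronglyMeasurable

lemma setIntegral_exp_neg_pos (hV : Continuous V) {S : Set (Euc n)} (hS : IsCompact S) {r : ℝ}
    (hr : 0 < r) (hrS : Metric.closedBall (0 : Euc n) r ⊆ S) :
    0 < ∫ x in S, Real.exp (-V x) := by
  have hc : Continuous fun x => Real.exp (-V x) := Real.continuous_exp.comp hV.neg
  rw [setIntegral_pos_iff_support_of_nonneg_ae
    (Eventually.of_forall fun x => (Real.exp_pos _).le) (hc.continuousOn.integrableOn_compact hS)]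
  have hs : Function.support (fun x => Real.exp (-V x)) = univ := by
    ext x; simp [(Real.exp_pos _).ne']
  rw [hs, univ_inter]
  exact (Metric.measure_closedBall_pos _ _ hr).trans_le (measure_mono hrS)

end halfSpaces

section polytope

variable {n : ℕ} {R : ℝ} {V : Euc n → ℝ} {ι : Type*} [Fintype ι] {e : ι → Euc n}

/-- The `(p, q)`-inequality along a symmetric one-parameter family of polytopes. -/
lemma mass_halfSpaces_concave (hn : 1 ≤ n) (hV : ContDiff ℝ 2 V)
    (hVc : ConvexOn ℝ univ V) (hVe : ∀ x, V (-x) = V x) {k₁ k₂ κ q C r : ℝ} (hk₁ : 0 ≤ k₁)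
    (hk : k₁ ≤ k₂) (hH : ∀ x v, k₁ * ∑ i, v i ^ 2 ≤ hessForm V x v)
    (hκ : 0 ≤ κ) (hq : 0 ≤ q) (hC : 0 ≤ C) (hr : 0 < r) (hrR : r ≤ R)
    (hcond : κ * (2 * √n * √(1 + k₂) * √(1 + k₁) + √k₁) / 2 + q * (1 + k₂) * (1 + k₁) ≤ 2 * k₁)
    (hM : ∀ M : Set (Euc n), IsConvexBody M → M = -M → Metric.closedBall (0 : Euc n) r ⊆ M →
      ∫ x in M, ((∑ i, pd i (pd i V) x) - n * k₂) * Real.exp (-V x) ≤ 0)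
    (σ : Equiv.Perm ι) (hσe : ∀ i, e (σ i) = -e i) (he : ∀ i, ∑ a, e i a ^ 2 = 1)
    {h d d₂ : ℝ → ι → ℝ} (hσh : ∀ s i, h s (σ i) = h s i) (hσd : ∀ s i, d s (σ i) = d s i)
    (hrh : ∀ s ∈ Icc (0 : ℝ) 1, ∀ i, r ≤ h s i)
    (hhc : ∀ i, ContinuousOn (fun s => h s i) (Icc 0 1))
    (hd : ∀ s ∈ Ioo (0 : ℝ) 1, ∀ i, HasDerivAt (fun t => h t i) (d s i) s)
    (hd₂ : ∀ s ∈ Ioo (0 : ℝ) 1, ∀ i, HasDerivAt (fun t => d t i) (d₂ s i) s)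
    (hd₂c : ∀ i, ContinuousOn (fun s => d₂ s i) (Ioo 0 1))
    (hd0 : ∀ s ∈ Ioo (0 : ℝ) 1, ∀ i, 0 ≤ d s i) (hdC : ∀ s ∈ Ioo (0 : ℝ) 1, ∀ i, d s i ≤ C)
    (hdκ : ∀ s ∈ Ioo (0 : ℝ) 1, ∀ i, d₂ s i ≤ κ * d s i ^ 2)
    {m : ℝ → ℝ} (hm : ∀ s, m s = ∫ x in box n R ∩ halfSpaces e (h s), Real.exp (-V x))
    {s : ℝ} (hs : s ∈ Icc (0 : ℝ) 1) :
    (q = 0 → (1 - s) * Real.log (m 0) + s * Real.log (m 1) ≤ Real.log (m s)) ∧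
    (0 < q → (1 - s) * m 0 ^ (q / n) + s * m 1 ^ (q / n) ≤ m s ^ (q / n)) := by
  have hR : 0 < R := hr.trans_le hrR
  have hVcont := hV.continuous
  set M : ℝ → ℝ → ℝ := fun N s => wint R (penPot V N e fun i => h s i + 1 / √N) (fun _ => 1)
    with hMdef
  have hlim : ∀ s, Tendsto (fun N => M N s) atTop (𝓝 (m s)) := fun s => by
    rw [hm]; exact tendsto_wint_one hVcont e (h s)
  have hWc : ∀ N s, Continuous (penPot V N e fun i => h s i + 1 / √N) := fun N s =>
    hVcont.add (contDiff_pen (k := 0)).continuous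
  have hMpos : ∀ N s, 0 < M N s := fun N s => wint_one_pos hR (hWc N s)
  have hMc : ∀ N, ContinuousOn (M N) (Icc 0 1) := fun N =>
    continuousOn_wint_one hVcont fun i => (hhc i).add continuousOn_const
  have hsh : ∀ N : ℝ, ∀ s ∈ Ioo (0 : ℝ) 1, ∀ i,
      HasDerivAt (fun t => h t i + 1 / √N) (d s i) s := fun N s hs i => (hd s hs i).add_const _
  have hdc : ∀ i, ContinuousOn (fun s => d s i) (Ioo 0 1) := fun i t ht =>
    (hd₂ t ht i).continuousAt.continuousWithinAt
  set M' : ℝ → ℝ → ℝ := fun N s => wint R (penPot V N e fun i => h s i + 1 / √N)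
    (flux N e (fun i => h s i + 1 / √N) (d s)) with hM'def
  set M'' : ℝ → ℝ → ℝ := fun N s =>
    wint R (penPot V N e fun i => h s i + 1 / √N) (flux N e (fun i => h s i + 1 / √N) (d₂ s)) +
      wint R (penPot V N e fun i => h s i + 1 / √N)
        (fun x => flux N e (fun i => h s i + 1 / √N) (d s) x ^ 2) -
      N * wint R (penPot V N e fun i => h s i + 1 / √N)
        (flux N e (fun i => h s i + 1 / √N) fun i => d s i ^ 2) with hM''def
  have hM1 : ∀ N, ∀ s ∈ Ioo (0 : ℝ) 1, HasDerivAt (M N) (M' N s) s := fun N s hs =>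
    hasDerivAt_wint_one (h := fun s i => h s i + 1 / √N) isOpen_Ioo hVcont (hsh N) hdc hs
  have hM2 : ∀ N, ∀ s ∈ Ioo (0 : ℝ) 1, HasDerivAt (M' N) (M'' N s) s := fun N s hs =>
    hasDerivAt_wint_flux (h := fun s i => h s i + 1 / √N) isOpen_Ioo hVcont (hsh N) hd₂ hd₂c hs
  have key : ∀ ε > 0, ∃ N₀, ∀ N ≥ N₀, ∀ s ∈ Ioo (0 : ℝ) 1,
      M'' N s / M N s - (M' N s / M N s) ^ 2 + q / n * (M' N s / M N s) ^ 2 ≤ ε := fun ε hε => by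
    obtain ⟨τ, hτ, N₁, hN₁, h1⟩ := exists_second_variation_le (e := e) hn hR hV hVc hVe hk₁ hk hH
      hκ hq hC hr hε hcond σ hσe he
    have hL : Continuous fun x => ∑ i, pd i (pd i V) x := continuous_finsetSum _ fun i _ =>
      continuous_pd (hV.pd (by norm_num))
    obtain ⟨N₂, hN₂, h2⟩ := exists_wint_trace_le (R := R) (e := e) hr hrR hVcont hL hM σ hσe he hτ
    refine ⟨max N₁ N₂, fun N hN s hs => ?_⟩
    have hσ' : ∀ i, h s (σ i) + 1 / √N = h s i + 1 / √N := fun i => by rw [hσh]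
    have hr' : ∀ i, r + 1 / √N ≤ h s i + 1 / √N := fun i =>
      add_le_add_left (hrh s (Ioo_subset_Icc_self hs) i) _
    exact h1 N ((le_max_left _ _).trans hN) (fun i => h s i + 1 / √N) (d s) (d₂ s) hσ' (hσd s)
      (fun i => (hrh s (Ioo_subset_Icc_self hs) i).trans (le_add_of_nonneg_right (by positivity)))
      (hd0 s hs) (hdC s hs) (hdκ s hs) (h2 N ((le_max_right _ _).trans hN) _ hσ' hr')
  have hmpos : ∀ s ∈ Icc (0 : ℝ) 1, 0 < m s := fun s hs => by
    rw [hm]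
    refine setIntegral_exp_neg_pos hVcont
      ((isCompact_box n R).inter_right (isClosed_halfSpaces _ _)) hr
      (subset_inter (closedBall_subset_box hrR) fun x hx i => ?_)
    rw [mem_closedBall_zero_iff] at hx
    have := real_inner_le_norm (e i) x
    rw [norm_eq_one_of_sum_sq (he i), one_mul] at this
    exact (this.trans hx).trans (hrh s hs i)
  have h0 : (0 : ℝ) ∈ Icc (0 : ℝ) 1 := left_mem_Icc.2 zero_le_one
  have h1 : (1 : ℝ) ∈ Icc (0 : ℝ) 1 := right_mem_Icc.2 zero_le_one
  constructor
  · rintro rfl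
    refine le_of_forall_pos_le_add fun ε hε => ?_
    obtain ⟨N₀, hN₀⟩ := key ε hε
    have hl := fun s hs => (hlim s).log (hmpos s hs).ne'
    refine le_of_tendsto_of_tendsto (((hl 0 h0).const_mul (1 - s)).add ((hl 1 h1).const_mul s))
      ((hl s hs).add_const ε) ?_
    filter_upwards [eventually_ge_atTop N₀] with N hN
    refine log_le_add_of_deriv2_le hε.le (hMpos N) (hMc N) (hM1 N) (hM2 N) (fun t ht => ?_) hs
    have := hN₀ N hN t ht
    rwa [zero_div, zero_mul, add_zero] at this
  · intro hq0
    have hn0 : (0 : ℝ) < n := by exact_mod_cast hn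
    have hα : 0 < q / n := div_pos hq0 hn0
    set B := wint R V (fun _ => 1) with hB
    have hBpos : 0 < B := wint_one_pos hR hVcont
    have hMB : ∀ N s, M N s ≤ B := fun N s => by
      refine setIntegral_mono_on (integrable_wint (hWc N s) continuous_const)
        (integrable_wint hVcont continuous_const) (measurableSet_box n R) fun x _ => ?_
      rw [one_mul, one_mul]
      exact (le_abs_self _).trans (abs_exp_neg_penPot_le x _)
    refine le_of_forall_pos_le_add fun ε hε => ?_
    have hc : 0 < q / n * B ^ (q / n) := by positivity
    obtain ⟨N₀, hN₀⟩ := key (ε / (q / n * B ^ (q / n))) (by positivity)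
    have hl := fun s => (hlim s).rpow_const (p := q / n) (Or.inr hα.le)
    refine le_of_tendsto_of_tendsto (((hl 0).const_mul (1 - s)).add ((hl 1).const_mul s))
      ((hl s).add_const ε) ?_
    filter_upwards [eventually_ge_atTop N₀] with N hN
    have := rpow_le_add_of_deriv2_le hα (by positivity) (hMpos N) (hMB N) (hMc N) (hM1 N) (hM2 N)
      (hN₀ N hN) hs
    rwa [mul_div_cancel₀ _ hc.ne'] at this

end polytope

section interpolation

/-- The `p`-mean of `a` and `b` with weights `1 - s` and `s`. -/
def pMean (p a b s : ℝ) : ℝ :=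
  if p = 0 then a ^ (1 - s) * b ^ s else ((1 - s) * a ^ p + s * b ^ p) ^ (1 / p)

/-- The derivative of `pMean p a b`. -/
def pMeanDeriv (p a b s : ℝ) : ℝ :=
  if p = 0 then Real.log (b / a) * pMean p a b s
  else (b ^ p - a ^ p) / p * ((1 - s) * a ^ p + s * b ^ p) ^ (1 / p - 1)

/-- The second derivative of `pMean p a b`. -/
def pMeanDeriv2 (p a b s : ℝ) : ℝ := (1 - p) * pMeanDeriv p a b s ^ 2 / pMean p a b s

variable {p a b s : ℝ}

lemma rpow_le_combo (hp : 0 ≤ p) (ha : 0 < a) (hab : a ≤ b) (hs : s ∈ Icc (0 : ℝ) 1) :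
    a ^ p ≤ (1 - s) * a ^ p + s * b ^ p := by
  have := Real.rpow_le_rpow ha.le hab hp
  nlinarith [hs.1, hs.2]

lemma combo_le_rpow (hp : 0 ≤ p) (ha : 0 < a) (hab : a ≤ b) (hs : s ∈ Icc (0 : ℝ) 1) :
    (1 - s) * a ^ p + s * b ^ p ≤ b ^ p := by
  have := Real.rpow_le_rpow ha.le hab hp
  nlinarith [hs.1, hs.2]

lemma combo_pos (hp : 0 ≤ p) (ha : 0 < a) (hab : a ≤ b) (hs : s ∈ Icc (0 : ℝ) 1) :
    0 < (1 - s) * a ^ p + s * b ^ p :=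
  (Real.rpow_pos_of_pos ha p).trans_le (rpow_le_combo hp ha hab hs)

lemma pMean_zero (ha : 0 < a) : pMean p a b 0 = a := by
  unfold pMean
  split_ifs with h
  · simp
  · simp only [sub_zero, one_mul, zero_mul, add_zero]
    rw [← Real.rpow_mul ha.le, mul_one_div_cancel h, Real.rpow_one]

lemma pMean_one (hb : 0 < b) : pMean p a b 1 = b := by
  unfold pMean
  split_ifs with h
  · simp
  · simp only [sub_self, one_mul, zero_mul, zero_add]
    rw [← Real.rpow_mul hb.le, mul_one_div_cancel h, Real.rpow_one]

lemma le_pMean (hp : 0 ≤ p) (ha : 0 < a) (hab : a ≤ b) (hs : s ∈ Icc (0 : ℝ) 1) :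
    a ≤ pMean p a b s := by
  unfold pMean
  split_ifs with h
  · calc a = a ^ (1 - s) * a ^ s := by rw [← Real.rpow_add ha]; simp
      _ ≤ _ := mul_le_mul_of_nonneg_left (Real.rpow_le_rpow ha.le hab hs.1) (by positivity)
  · calc a = (a ^ p) ^ (1 / p) := by rw [← Real.rpow_mul ha.le, mul_one_div_cancel h, Real.rpow_one]
      _ ≤ _ := Real.rpow_le_rpow (by positivity) (rpow_le_combo hp ha hab hs) (by positivity)

lemma pMean_zero_le (ha : 0 < a) (hab : a ≤ b) (hs : s ∈ Icc (0 : ℝ) 1) :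
    pMean 0 a b s ≤ b := by
  have hb := ha.trans_le hab
  simp only [pMean, if_true]
  calc a ^ (1 - s) * b ^ s ≤ b ^ (1 - s) * b ^ s :=
        mul_le_mul_of_nonneg_right (Real.rpow_le_rpow ha.le hab (sub_nonneg.2 hs.2)) (by positivity)
    _ = b := by rw [← Real.rpow_add hb]; simp

lemma continuousOn_pMean (hp : 0 ≤ p) (ha : 0 < a) (hab : a ≤ b) :
    ContinuousOn (pMean p a b) (Icc 0 1) := by
  have hb := ha.trans_le hab
  unfold pMean
  split_ifs with h
  · exact (continuousOn_const.rpow (by fun_prop) fun _ _ => Or.inl ha.ne').mul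
      (continuousOn_const.rpow (by fun_prop) fun _ _ => Or.inl hb.ne')
  · exact ContinuousOn.rpow_const (by fun_prop) fun s hs => Or.inl (combo_pos hp ha hab hs).ne'

lemma hasDerivAt_pMean (hp : 0 ≤ p) (ha : 0 < a) (hab : a ≤ b) (hs : s ∈ Ioo (0 : ℝ) 1) :
    HasDerivAt (pMean p a b) (pMeanDeriv p a b s) s := by
  have hb := ha.trans_le hab
  unfold pMeanDeriv
  split_ifs with h
  · subst h
    have e1 : pMean 0 a b = fun t => a ^ (1 - t) * b ^ t := by ext t; simp [pMean]
    have h1 := (((hasDerivAt_id s).const_sub 1).const_rpow ha).fun_mul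
      ((hasDerivAt_id s).const_rpow hb)
    rw [e1]
    refine h1.congr_deriv ?_
    rw [Real.log_div hb.ne' ha.ne']
    simp only [id]
    ring
  · have e1 : pMean p a b = fun t => ((1 - t) * a ^ p + t * b ^ p) ^ (1 / p) := by
      ext t; simp [pMean, h]
    have h1 : HasDerivAt (fun t => (1 - t) * a ^ p + t * b ^ p) (b ^ p - a ^ p) s :=
      ((((hasDerivAt_id s).const_sub 1).mul_const (a ^ p)).fun_add
        ((hasDerivAt_id s).mul_const (b ^ p))).congr_deriv (by ring)
    rw [e1]
    refine (h1.rpow_const (p := 1 / p)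
      (Or.inl (combo_pos hp ha hab (Ioo_subset_Icc_self hs)).ne')).congr_deriv ?_
    ring

lemma hasDerivAt_pMeanDeriv (hp : 0 ≤ p) (ha : 0 < a) (hab : a ≤ b) (hs : s ∈ Ioo (0 : ℝ) 1) :
    HasDerivAt (pMeanDeriv p a b) (pMeanDeriv2 p a b s) s := by
  have hs' := Ioo_subset_Icc_self hs
  by_cases h : p = 0
  · subst h
    have e1 : pMeanDeriv 0 a b = fun t => Real.log (b / a) * pMean 0 a b t := by
      ext t; simp [pMeanDeriv]
    have hpos : 0 < pMean 0 a b s := ha.trans_le (le_pMean le_rfl ha hab hs')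
    have h1 := (hasDerivAt_pMean le_rfl ha hab hs).const_mul (Real.log (b / a))
    rw [e1]
    refine h1.congr_deriv ?_
    simp only [pMeanDeriv2, e1]
    field_simp
    ring
  · have hpos := combo_pos hp ha hab hs'
    have e1 : pMeanDeriv p a b =
        fun t => (b ^ p - a ^ p) / p * ((1 - t) * a ^ p + t * b ^ p) ^ (1 / p - 1) := by
      ext t; simp [pMeanDeriv, h]
    have h1 : HasDerivAt (fun t => (1 - t) * a ^ p + t * b ^ p) (b ^ p - a ^ p) s :=
      ((((hasDerivAt_id s).const_sub 1).mul_const (a ^ p)).fun_add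
        ((hasDerivAt_id s).mul_const (b ^ p))).congr_deriv (by ring)
    have h2 := (h1.rpow_const (p := 1 / p - 1) (Or.inl hpos.ne')).const_mul ((b ^ p - a ^ p) / p)
    rw [e1]
    refine h2.congr_deriv ?_
    simp only [pMeanDeriv2, e1, pMean, h, if_false]
    set y := (1 - s) * a ^ p + s * b ^ p with hy
    have hyp : 0 < y ^ (1 / p) := Real.rpow_pos_of_pos hpos _
    simp only [Real.rpow_sub_one hpos.ne']
    field_simp

lemma continuousOn_pMeanDeriv2 (hp : 0 ≤ p) (ha : 0 < a) (hab : a ≤ b) :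
    ContinuousOn (pMeanDeriv2 p a b) (Ioo 0 1) := by
  have h1 : ContinuousOn (pMeanDeriv p a b) (Ioo 0 1) := fun t ht =>
    (hasDerivAt_pMeanDeriv hp ha hab ht).continuousAt.continuousWithinAt
  exact (continuousOn_const.mul (h1.pow 2)).div
    ((continuousOn_pMean hp ha hab).mono Ioo_subset_Icc_self)
    fun t ht => (ha.trans_le (le_pMean hp ha hab (Ioo_subset_Icc_self ht))).ne'

lemma pMeanDeriv_nonneg (hp : 0 ≤ p) (ha : 0 < a) (hab : a ≤ b) (hs : s ∈ Icc (0 : ℝ) 1) :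
    0 ≤ pMeanDeriv p a b s := by
  unfold pMeanDeriv
  split_ifs with h
  · exact mul_nonneg (Real.log_nonneg ((one_le_div ha).2 hab))
      (ha.le.trans (le_pMean hp ha hab hs))
  · have h1 := sub_nonneg.2 (Real.rpow_le_rpow ha.le hab hp)
    exact mul_nonneg (div_nonneg h1 hp) (Real.rpow_nonneg (combo_pos hp ha hab hs).le _)

lemma exists_pMeanDeriv_le (hp : p ∈ Icc (0 : ℝ) 1) (ha : 0 < a) (hab : a ≤ b) :
    ∃ C, 0 ≤ C ∧ ∀ s ∈ Icc (0 : ℝ) 1, pMeanDeriv p a b s ≤ C := by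
  have hb := ha.trans_le hab
  unfold pMeanDeriv
  split_ifs with h
  · subst h
    have h1 := Real.log_nonneg ((one_le_div ha).2 hab)
    exact ⟨Real.log (b / a) * b, by positivity, fun s hs =>
      mul_le_mul_of_nonneg_left (pMean_zero_le ha hab hs) h1⟩
  · have h1 := div_nonneg (sub_nonneg.2 (Real.rpow_le_rpow ha.le hab hp.1)) hp.1
    have hp0 : 0 < p := lt_of_le_of_ne hp.1 (Ne.symm h)
    have h2 : 0 ≤ 1 / p - 1 := sub_nonneg.2 ((one_le_div hp0).2 hp.2)
    exact ⟨(b ^ p - a ^ p) / p * (b ^ p) ^ (1 / p - 1), by positivity, fun s hs =>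
      mul_le_mul_of_nonneg_left (Real.rpow_le_rpow (combo_pos hp.1 ha hab hs).le
        (combo_le_rpow hp.1 ha hab hs) h2) h1⟩

lemma pMeanDeriv2_le {r : ℝ} (hp : p ∈ Icc (0 : ℝ) 1) (hr : 0 < r) (ha : r ≤ a) (hab : a ≤ b)
    (hs : s ∈ Icc (0 : ℝ) 1) :
    pMeanDeriv2 p a b s ≤ (1 - p) / r * pMeanDeriv p a b s ^ 2 := by
  have h1 : r ≤ pMean p a b s := ha.trans (le_pMean hp.1 (hr.trans_le ha) hab hs)
  rw [pMeanDeriv2, div_mul_eq_mul_div]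
  exact div_le_div_of_nonneg_left (mul_nonneg (sub_nonneg.2 hp.2) (sq_nonneg _)) hr h1

end interpolation

section slabs

variable {n : ℕ} {R : ℝ} {V : Euc n → ℝ}

lemma sum_sq_eq_norm_sq (x : Euc n) : ∑ a, x a ^ 2 = ‖x‖ ^ 2 := by
  simp [EuclideanSpace.norm_sq_eq]

/-- The intersection of the symmetric slabs `|⟪uⱼ, x⟫| ≤ hⱼ`. -/
def slabs {n : ℕ} {ι : Type*} (u : ι → Euc n) (h : ι → ℝ) : Set (Euc n) :=
  {x | ∀ j, |⟪u j, x⟫| ≤ h j}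

lemma isClosed_slabs {ι : Type*} (u : ι → Euc n) (h : ι → ℝ) : IsClosed (slabs u h) := by
  simp only [slabs, ofPred_forall]
  exact isClosed_iInter fun i => isClosed_le (by fun_prop) continuous_const

lemma closedBall_subset_slabs {ι : Type*} {u : ι → Euc n} {h : ι → ℝ} {r : ℝ}
    (hu : ∀ j, ‖u j‖ = 1) (hh : ∀ j, r ≤ h j) :
    Metric.closedBall (0 : Euc n) r ⊆ slabs u h := by
  intro x hx j
  have h1 := abs_real_inner_le_norm (u j) x
  rw [hu j, one_mul] at h1
  exact h1.trans ((mem_closedBall_zero_iff.1 hx).trans (hh j))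

lemma mass_slabs_concave {ι : Type*} [Fintype ι] {u : ι → Euc n} (hn : 1 ≤ n)
    (hV : ContDiff ℝ 2 V)
    (hVc : ConvexOn ℝ univ V) (hVe : ∀ x, V (-x) = V x) {k₁ k₂ p q r : ℝ} (hk₁ : 0 ≤ k₁)
    (hk : k₁ ≤ k₂) (hH : ∀ x v, k₁ * ∑ i, v i ^ 2 ≤ hessForm V x v)
    (hp : p ∈ Icc (0 : ℝ) 1) (hq : 0 ≤ q) (hr : 0 < r) (hrR : r ≤ R)
    (hcond : (1 - p) / r * (2 * √n * √(1 + k₂) * √(1 + k₁) + √k₁) / 2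
      + q * (1 + k₂) * (1 + k₁) ≤ 2 * k₁)
    (hM : ∀ M : Set (Euc n), IsConvexBody M → M = -M → Metric.closedBall (0 : Euc n) r ⊆ M →
      ∫ x in M, ((∑ i, pd i (pd i V) x) - n * k₂) * Real.exp (-V x) ≤ 0)
    (hu : ∀ j, ‖u j‖ = 1) {a b : ι → ℝ} (ha : ∀ j, r ≤ a j) (hab : ∀ j, a j ≤ b j)
    {m : ℝ → ℝ}
    (hm : ∀ s, m s = ∫ x in box n R ∩ slabs u (fun j => pMean p (a j) (b j) s), Real.exp (-V x))
    {s : ℝ} (hs : s ∈ Icc (0 : ℝ) 1) :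
    (q = 0 → (1 - s) * Real.log (m 0) + s * Real.log (m 1) ≤ Real.log (m s)) ∧
    (0 < q → (1 - s) * m 0 ^ (q / n) + s * m 1 ^ (q / n) ≤ m s ^ (q / n)) := by
  have ha0 : ∀ j, 0 < a j := fun j => hr.trans_le (ha j)
  choose C hC0 hC using fun j => exists_pMeanDeriv_le hp (ha0 j) (hab j)
  have hsub : Ioo (0 : ℝ) 1 ⊆ Icc 0 1 := Ioo_subset_Icc_self
  refine mass_halfSpaces_concave (κ := (1 - p) / r) (C := ∑ j, C j)
    (e := fun i : ι × Bool => if i.2 then u i.1 else -u i.1)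
    (h := fun s i => pMean p (a i.1) (b i.1) s) (d := fun s i => pMeanDeriv p (a i.1) (b i.1) s)
    (d₂ := fun s i => pMeanDeriv2 p (a i.1) (b i.1) s)
    hn hV hVc hVe hk₁ hk hH (div_nonneg (sub_nonneg.2 hp.2) hr.le) hq
    (Finset.sum_nonneg fun j _ => hC0 j) hr hrR hcond hM
    (Equiv.prodCongr (Equiv.refl ι) Equiv.boolNot) ?_ ?_ (fun _ _ => rfl) (fun _ _ => rfl)
    (fun s hs i => (ha _).trans (le_pMean hp.1 (ha0 _) (hab _) hs))
    (fun i => continuousOn_pMean hp.1 (ha0 _) (hab _))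
    (fun s hs i => hasDerivAt_pMean hp.1 (ha0 _) (hab _) hs)
    (fun s hs i => hasDerivAt_pMeanDeriv hp.1 (ha0 _) (hab _) hs)
    (fun i => continuousOn_pMeanDeriv2 hp.1 (ha0 _) (hab _))
    (fun s hs i => pMeanDeriv_nonneg hp.1 (ha0 _) (hab _) (hsub hs))
    (fun s hs i => (hC i.1 s (hsub hs)).trans
      (Finset.single_le_sum (fun j _ => hC0 j) (Finset.mem_univ _)))
    (fun s hs i => pMeanDeriv2_le hp hr (ha _) (hab _) (hsub hs)) ?_ hs
  · rintro ⟨j, b⟩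
    cases b <;> simp
  · rintro ⟨j, b⟩
    rw [sum_sq_eq_norm_sq]
    cases b <;> simp [hu]
  · intro s
    rw [hm]
    congr 3
    ext x
    simp only [slabs, halfSpaces, mem_ofPred_eq, Prod.forall, Bool.forall_bool, abs_le']
    refine forall_congr' fun j => ?_
    simp [and_comm]

lemma le_mass_slabs {u : ℕ → Euc n} (hn : 1 ≤ n)
    (hV : ContDiff ℝ 2 V)
    (hVc : ConvexOn ℝ univ V) (hVe : ∀ x, V (-x) = V x) {k₁ k₂ p q r : ℝ} (hk₁ : 0 ≤ k₁)
    (hk : k₁ ≤ k₂) (hH : ∀ x v, k₁ * ∑ i, v i ^ 2 ≤ hessForm V x v)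
    (hp : p ∈ Icc (0 : ℝ) 1) (hq : 0 ≤ q) (hr : 0 < r) (hrR : r ≤ R)
    (hcond : (1 - p) / r * (2 * √n * √(1 + k₂) * √(1 + k₁) + √k₁) / 2
      + q * (1 + k₂) * (1 + k₁) ≤ 2 * k₁)
    (hM : ∀ M : Set (Euc n), IsConvexBody M → M = -M → Metric.closedBall (0 : Euc n) r ⊆ M →
      ∫ x in M, ((∑ i, pd i (pd i V) x) - n * k₂) * Real.exp (-V x) ≤ 0)
    (hu : ∀ j, ‖u j‖ = 1) {a b : ℕ → ℝ} (ha : ∀ j, r ≤ a j) (hab : ∀ j, a j ≤ b j)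
    {mK mL : ℝ} (hK0 : 0 < mK) (hL0 : 0 < mL)
    (hK : mK ≤ ∫ x in box n R ∩ slabs u a, Real.exp (-V x))
    (hL : mL ≤ ∫ x in box n R ∩ slabs u b, Real.exp (-V x))
    {s : ℝ} (hs : s ∈ Icc (0 : ℝ) 1) {mT : ℝ}
    (hT : mT = ∫ x in box n R ∩ slabs u (fun j => pMean p (a j) (b j) s), Real.exp (-V x)) :
    (q = 0 → mK ^ (1 - s) * mL ^ s ≤ mT) ∧
    (0 < q → (1 - s) * mK ^ (q / n) + s * mL ^ (q / n) ≤ mT ^ (q / n)) := by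
  have ha0 : ∀ j, 0 < a j := fun j => hr.trans_le (ha j)
  have hb0 : ∀ j, 0 < b j := fun j => (ha0 j).trans_le (hab j)
  have hVcont := hV.continuous
  have hint : IntegrableOn (fun x => Real.exp (-V x)) (box n R) :=
    integrableOn_box (Real.continuous_exp.comp hVcont.neg)
  set S : ℕ → ℝ → Set (Euc n) := fun k s =>
    box n R ∩ slabs (fun j : Fin k => u j) (fun j => pMean p (a j) (b j) s) with hS
  have hSc : ∀ k s, IsClosed (S k s) := fun k s =>
    (isCompact_box n R).isClosed.inter (isClosed_slabs _ _)
  set m : ℕ → ℝ → ℝ := fun k s => ∫ x in S k s, Real.exp (-V x) with hm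
  have hmono : ∀ {A B : Set (Euc n)}, A ⊆ B → B ⊆ box n R →
      ∫ x in A, Real.exp (-V x) ≤ ∫ x in B, Real.exp (-V x) := fun hAB hB =>
    setIntegral_mono_set (hint.mono_set hB) (Eventually.of_forall fun x => (Real.exp_pos _).le)
      (LE.le.eventuallyLE hAB)
  have hmK : ∀ k, mK ≤ m k 0 := fun k => hK.trans <| hmono
    (inter_subset_inter_right _ fun x hx j => by
      simpa only [pMean_zero (ha0 _)] using hx j) inter_subset_left
  have hmL : ∀ k, mL ≤ m k 1 := fun k => hL.trans <| hmono
    (inter_subset_inter_right _ fun x hx j => by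
      simpa only [pMean_one (hb0 _)] using hx j) inter_subset_left
  have hmain := fun k => mass_slabs_concave (u := fun j : Fin k => u j) hn hV hVc hVe hk₁ hk hH hp
    hq hr hrR hcond hM (fun j => hu j) (fun j => ha j) (fun j => hab j) (m := m k)
    (fun _ => rfl) hs
  have hms : ∀ k, 0 < m k s := fun k => setIntegral_exp_neg_pos hVcont
    ((isCompact_box n R).inter_right (isClosed_slabs _ _)) hr
    (subset_inter (closedBall_subset_box hrR) (closedBall_subset_slabs (fun j => hu j)
      fun j => (ha j).trans (le_pMean hp.1 (ha0 j) (hab j) hs)))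
  have hTpos : 0 < mT := by
    rw [hT]
    exact setIntegral_exp_neg_pos hVcont
      ((isCompact_box n R).inter_right (isClosed_slabs _ _)) hr
      (subset_inter (closedBall_subset_box hrR) (closedBall_subset_slabs hu
        fun j => (ha j).trans (le_pMean hp.1 (ha0 j) (hab j) hs)))
  have hlim : Tendsto (fun k => m k s) atTop (𝓝 mT) := by
    have h1 := tendsto_setIntegral_of_antitone (μ := volume) (s := fun k => S k s)
      (f := fun x => Real.exp (-V x)) (fun k => (hSc k s).measurableSet)
      (fun k l hkl x hx => ⟨hx.1, fun j => hx.2 ⟨j, j.2.trans_le hkl⟩⟩)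
      ⟨0, hint.mono_set inter_subset_left⟩
    have h2 : ⋂ k, S k s = box n R ∩ slabs u (fun j => pMean p (a j) (b j) s) := by
      ext x
      simp only [mem_iInter]
      exact ⟨fun h => ⟨(h 0).1, fun j => (h (j + 1)).2 ⟨j, j.lt_succ_self⟩⟩,
        fun h k => ⟨h.1, fun j => h.2 j⟩⟩
    rwa [h2, ← hT] at h1
  have hs0 := hs.1
  have hs1 : 0 ≤ 1 - s := sub_nonneg.2 hs.2
  refine ⟨fun hq0 => ?_, fun hq0 => ?_⟩
  · refine ge_of_tendsto' hlim fun k => ?_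
    have h1 := (hmain k).1 hq0
    have hk0 := hK0.trans_le (hmK k)
    have hk1 := hL0.trans_le (hmL k)
    calc mK ^ (1 - s) * mL ^ s ≤ m k 0 ^ (1 - s) * m k 1 ^ s := by
          gcongr
          exacts [hmK k, hmL k]
      _ = Real.exp ((1 - s) * Real.log (m k 0) + s * Real.log (m k 1)) := by
          rw [Real.exp_add, Real.rpow_def_of_pos hk0, Real.rpow_def_of_pos hk1]
          ring_nf
      _ ≤ m k s := by
          rw [← Real.exp_log (hms k)]
          exact Real.exp_le_exp.2 h1
  · refine ge_of_tendsto' (hlim.rpow_const (Or.inl hTpos.ne')) fun k => ?_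
    refine le_trans ?_ ((hmain k).2 hq0)
    have : 0 ≤ q / n := by positivity
    gcongr
    exacts [hmK k, hmL k]

end slabs

section supportFunction

variable {n : ℕ} {K L : Set (Euc n)}

lemma bddAbove_inner_image (hK : IsCompact K) (u : Euc n) :
    BddAbove ((fun y => ⟪u, y⟫) '' K) :=
  (hK.image (by fun_prop)).bddAbove

lemma inner_le_suppFn (hK : IsCompact K) (u : Euc n) {x : Euc n} (hx : x ∈ K) :
    ⟪u, x⟫ ≤ suppFn K u :=
  le_csSup (bddAbove_inner_image hK u) (mem_image_of_mem _ hx)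

lemma continuous_suppFn (hK : IsCompact K) : Continuous (suppFn K) :=
  hK.continuous_sSup (by fun_prop)

lemma suppFn_mono (hKne : K.Nonempty) (hL : IsCompact L) (hKL : K ⊆ L) (u : Euc n) :
    suppFn K u ≤ suppFn L u :=
  csSup_le_csSup (bddAbove_inner_image hL u) (hKne.image _) (image_mono hKL)

lemma le_suppFn_of_closedBall_subset (hK : IsCompact K) {r : ℝ} (hr : 0 ≤ r)
    (hrK : Metric.closedBall (0 : Euc n) r ⊆ K) {u : Euc n} (hu : ‖u‖ = 1) : r ≤ suppFn K u := by
  have h := inner_le_suppFn hK u (x := r • u)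
    (hrK (by simp [norm_smul, hu, abs_of_nonneg hr]))
  rwa [inner_smul_right, real_inner_self_eq_norm_sq, hu, one_pow, mul_one] at h

lemma subset_slabs_suppFn (hK : IsCompact K) (hKs : K = -K) {ι : Type*} (u : ι → Euc n) :
    K ⊆ slabs u fun j => suppFn K (u j) := by
  intro x hx j
  refine abs_le'.2 ⟨inner_le_suppFn hK _ hx, ?_⟩
  rw [← inner_neg_right]
  exact inner_le_suppFn hK _ (by rw [hKs] at hx; exact hx)

lemma mem_lpComb {p lam : ℝ} {x : Euc n} :
    x ∈ lpComb p lam K L ↔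
      ∀ u : Euc n, ‖u‖ = 1 → ⟪x, u⟫ ≤ pMean p (suppFn K u) (suppFn L u) (1 - lam) := by
  unfold lpComb pMean
  split_ifs <;> simp

lemma slabs_denseSeq_subset_lpComb [Nonempty (Metric.sphere (0 : Euc n) 1)] {p lam : ℝ}
    (hp : 0 ≤ p) (hlam : lam ∈ Icc (0 : ℝ) 1) (hK : IsCompact K) (hL : IsCompact L) {r : ℝ}
    (hr : 0 < r) (hrK : Metric.closedBall (0 : Euc n) r ⊆ K) (hKL : K ⊆ L) :
    slabs (fun j => (TopologicalSpace.denseSeq (Metric.sphere (0 : Euc n) 1) j : Euc n))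
      (fun j => pMean p (suppFn K (TopologicalSpace.denseSeq (Metric.sphere (0 : Euc n) 1) j))
        (suppFn L (TopologicalSpace.denseSeq (Metric.sphere (0 : Euc n) 1) j)) (1 - lam)) ⊆
      lpComb p lam K L := by
  intro x hx
  rw [mem_lpComb]
  have hKne : K.Nonempty := ⟨0, hrK (by simp [hr.le])⟩
  have hpos : ∀ v : Metric.sphere (0 : Euc n) 1, 0 < suppFn K v := fun v =>
    hr.trans_le (le_suppFn_of_closedBall_subset hK hr.le hrK (by simp))
  have hle : ∀ v : Metric.sphere (0 : Euc n) 1, suppFn K v ≤ suppFn L v := fun v =>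
    suppFn_mono hKne hL hKL v
  have hcK : Continuous fun v : Metric.sphere (0 : Euc n) 1 => suppFn K v :=
    (continuous_suppFn hK).comp continuous_subtype_val
  have hcL : Continuous fun v : Metric.sphere (0 : Euc n) 1 => suppFn L v :=
    (continuous_suppFn hL).comp continuous_subtype_val
  have hc : Continuous fun v : Metric.sphere (0 : Euc n) 1 =>
      pMean p (suppFn K v) (suppFn L v) (1 - lam) := by
    have hs : 1 - lam ∈ Icc (0 : ℝ) 1 := ⟨by linarith [hlam.2], by linarith [hlam.1]⟩
    unfold pMean
    split_ifs with h
    · exact (hcK.rpow_const fun v => Or.inl (hpos v).ne').mul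
        (hcL.rpow_const fun v => Or.inl ((hpos v).trans_le (hle v)).ne')
    · exact ((continuous_const.mul (hcK.rpow_const fun v => Or.inr hp)).add
        (continuous_const.mul (hcL.rpow_const fun v => Or.inr hp))).rpow_const
          fun v => Or.inl (combo_pos hp (hpos v) (hle v) hs).ne'
  have hcl : IsClosed {v : Metric.sphere (0 : Euc n) 1 |
      ⟪x, v⟫ ≤ pMean p (suppFn K v) (suppFn L v) (1 - lam)} :=
    isClosed_le (by fun_prop) hc
  have hall := closure_minimal (s := range (TopologicalSpace.denseSeq _)) (by
    rintro _ ⟨j, rfl⟩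
    rw [mem_ofPred_eq, real_inner_comm]
    exact (le_abs_self _).trans (hx j)) hcl
  intro u hu
  exact hall (a := ⟨u, by simpa using hu⟩) (by
    rw [(TopologicalSpace.denseRange_denseSeq _).closure_range]; trivial)

end supportFunction

section hessian

variable {n : ℕ} {V : Euc n → ℝ}

lemma hessForm_eq_iteratedFDeriv (hV : ContDiff ℝ 2 V) (x : Euc n) (v : Fin n → ℝ) :
    hessForm V x v = iteratedFDeriv ℝ 2 V x ![WithLp.toLp 2 v, WithLp.toLp 2 v] := by
  have hv : (WithLp.toLp 2 v : Euc n) = ∑ i, v i • EuclideanSpace.single i (1 : ℝ) := by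
    ext j
    simp [Finset.sum_apply, Pi.single_apply]
  rw [iteratedFDeriv_two_apply]
  simp only [hessForm, pd_pd_apply hV, Matrix.cons_val_zero, Matrix.cons_val_one]
  rw [hv]
  simp only [map_sum, map_smul, sum_apply, smul_apply,
    smul_eq_mul]
  rw [Finset.sum_comm]
  simp only [Finset.mul_sum]
  refine Finset.sum_congr rfl fun i _ => Finset.sum_congr rfl fun j _ => ?_
  ring

lemma lapl_eq_sum_pd (hV : ContDiff ℝ 2 V) (x : Euc n) :
    lapl V x = ∑ i, pd i (pd i V) x := by
  simp [lapl, iteratedFDeriv_two_apply, pd_pd_apply hV]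

lemma continuous_lapl (hV : ContDiff ℝ 2 V) : Continuous (lapl V) := by
  simp only [funext (lapl_eq_sum_pd hV)]
  exact continuous_finsetSum _ fun i _ => continuous_pd (hV.pd le_rfl)

lemma mul_le_lapl (hV : ContDiff ℝ 2 V) {k : ℝ}
    (hH : ∀ x v, k * ∑ i, v i ^ 2 ≤ hessForm V x v) (x : Euc n) : n * k ≤ lapl V x := by
  rw [lapl_eq_sum_pd hV]
  have h : ∀ i, k ≤ pd i (pd i V) x := fun i => by
    have := hH x (Pi.single i 1)
    simpa [hessForm, Pi.single_apply] using this
  simpa using Finset.sum_le_sum fun i (_ : i ∈ Finset.univ) => h i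

end hessian

section weightedMeasure

variable {n : ℕ} {V : Euc n → ℝ} {S : Set (Euc n)}

lemma integrableOn_exp_neg (hV : Continuous V) (hS : IsCompact S) :
    IntegrableOn (fun x => Real.exp (-V x)) S :=
  (Real.continuous_exp.comp hV.neg).continuousOn.integrableOn_compact hS

lemma withDensity_exp_neg_apply (hV : Continuous V) (hS : IsCompact S) :
    (volume.withDensity fun x => ENNReal.ofReal (Real.exp (-V x))) S =
      ENNReal.ofReal (∫ x in S, Real.exp (-V x)) := by
  rw [withDensity_apply _ hS.measurableSet,
    ofReal_integral_eq_lintegral_ofReal (integrableOn_exp_neg hV hS)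
      (Eventually.of_forall fun x => (Real.exp_pos _).le)]

lemma setIntegral_withDensity_exp_neg (hV : Continuous V) (hS : MeasurableSet S)
    (f : Euc n → ℝ) :
    ∫ x in S, f x ∂(volume.withDensity fun x => ENNReal.ofReal (Real.exp (-V x))) =
      ∫ x in S, f x * Real.exp (-V x) := by
  rw [setIntegral_withDensity_eq_setIntegral_toReal_smul
    (by fun_prop : Continuous fun x => Real.exp (-V x)).measurable.ennreal_ofReal
    (Eventually.of_forall fun x => ENNReal.ofReal_lt_top) _ hS]
  simp only [ENNReal.toReal_ofReal (Real.exp_pos _).le, smul_eq_mul, mul_comm]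

end weightedMeasure

end helpers

/-- Proposition 1.6: under the additional assumption `K ⊆ L` and `k₁ ∈ [0,1]`, the
`(p,q)`-inequality holds whenever
`(1-p)(2√n √(1+k₂) √(1+k₁) + √k₁)/(2r) + q(1+k₂)(1+k₁) ≤ 2k₁`. -/
theorem pq_inequality_contained (n : ℕ) (hn : 1 ≤ n) (r k₁ k₂ : ℝ) (hr : 0 < r)
    (hk₁ : k₁ ∈ Set.Icc (0:ℝ) 1) (hk₂ : 0 ≤ k₂)
    (V : Euc n → ℝ) (hV : ContDiff ℝ 2 V) (hVconv : ConvexOn ℝ Set.univ V)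
    (hVeven : ∀ x, V (-x) = V x)
    (hVhess : ∀ x v : Euc n, k₁ * ‖v‖ ^ 2 ≤ iteratedFDeriv ℝ 2 V x ![v, v])
    (μ : Measure (Euc n))
    (hμ : μ = volume.withDensity fun x => ENNReal.ofReal (Real.exp (-V x)))
    (hlapV : ∀ M : Set (Euc n), IsConvexBody M → M = -M →
      Metric.closedBall (0 : Euc n) r ⊆ M →
        ∫ x in M, lapl V x ∂μ ≤ k₂ * n * (μ M).toReal)
    (p q : ℝ) (hp : p ∈ Set.Icc (0:ℝ) 1) (hq : q ∈ Set.Icc (0:ℝ) p)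
    (hcond : (1 - p) *
        (2 * Real.sqrt n * Real.sqrt (1 + k₂) * Real.sqrt (1 + k₁) + Real.sqrt k₁) / (2 * r)
      + q * (1 + k₂) * (1 + k₁) ≤ 2 * k₁) :
    ∀ K L : Set (Euc n), IsConvexBody K → IsConvexBody L → K = -K → L = -L → K ⊆ L →
      Metric.closedBall (0 : Euc n) r ⊆ K → Metric.closedBall (0 : Euc n) r ⊆ L →
        PQIneq μ p q K L := by
  obtain ⟨hk₁0, -⟩ := hk₁
  have hVc := hV.continuous
  have hH : ∀ x v, k₁ * ∑ i, v i ^ 2 ≤ hessForm V x v := fun x v => by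
    rw [hessForm_eq_iteratedFDeriv hV]
    simpa [← sum_sq_eq_norm_sq] using hVhess x (WithLp.toLp 2 v)
  have hμS : ∀ {S : Set (Euc n)}, IsCompact S →
      μ S = ENNReal.ofReal (∫ x in S, Real.exp (-V x)) := fun hS => by
    rw [hμ, withDensity_exp_neg_apply hVc hS]
  have hlint : ∀ {S : Set (Euc n)}, IsCompact S →
      IntegrableOn (fun x => lapl V x * Real.exp (-V x)) S := fun hS =>
    ((continuous_lapl hV).mul (Real.continuous_exp.comp hVc.neg)).continuousOn.integrableOn_compact
      hS
  have hM : ∀ M : Set (Euc n), IsConvexBody M → M = -M → Metric.closedBall (0 : Euc n) r ⊆ M →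
      ∫ x in M, (lapl V x - n * k₂) * Real.exp (-V x) ≤ 0 := by
    intro M hMb hMs hMr
    have h1 := hlapV M hMb hMs hMr
    rw [hμS hMb.1, ENNReal.toReal_ofReal (integral_nonneg fun x => (Real.exp_pos _).le), hμ,
      setIntegral_withDensity_exp_neg hVc hMb.1.measurableSet] at h1
    simp only [sub_mul]
    rw [integral_sub (hlint hMb.1) ((integrableOn_exp_neg hVc hMb.1).const_mul _),
      integral_const_mul]
    linarith
  have hn0 : (0 : ℝ) < n := by exact_mod_cast hn
  have hball : IsConvexBody (Metric.closedBall (0 : Euc n) r) :=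
    ⟨isCompact_closedBall _ _, convex_closedBall _ _,
      ⟨0, mem_interior_iff_mem_nhds.2 (Metric.closedBall_mem_nhds _ hr)⟩⟩
  have hk : k₁ ≤ k₂ := by
    by_contra! hlt
    have h1 := hM _ hball (by ext x; simp) subset_rfl
    have h2 := setIntegral_exp_neg_pos hVc hball.1 hr subset_rfl
    have h3 : n * (k₁ - k₂) * ∫ x in Metric.closedBall (0 : Euc n) r, Real.exp (-V x) ≤
        ∫ x in Metric.closedBall (0 : Euc n) r, (lapl V x - n * k₂) * Real.exp (-V x) := by
      rw [← integral_const_mul]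
      refine integral_mono ((integrableOn_exp_neg hVc hball.1).const_mul _) ?_ fun x => ?_
      · simp only [sub_mul]
        exact (hlint hball.1).sub ((integrableOn_exp_neg hVc hball.1).const_mul _)
      refine mul_le_mul_of_nonneg_right ?_ (Real.exp_pos _).le
      linarith [mul_le_lapl hV hH x]
    have h4 : 0 < n * (k₁ - k₂) * ∫ x in Metric.closedBall (0 : Euc n) r, Real.exp (-V x) :=
      mul_pos (mul_pos hn0 (sub_pos.2 hlt)) h2
    linarith
  simp only [lapl_eq_sum_pd hV] at hM
  intro K L hK hL hKs hLs hKL hrK hrL lam hlam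
  have : Nonempty (Fin n) := ⟨⟨0, hn⟩⟩
  have : Nonempty (Metric.sphere (0 : Euc n) 1) :=
    (NormedSpace.sphere_nonempty.2 zero_le_one).to_subtype
  obtain ⟨R, hLR⟩ := hL.1.isBounded.subset_closedBall 0
  have hrR : r ≤ max r R := le_max_left _ _
  have hLbox : L ⊆ box n (max r R) := hLR.trans (closedBall_subset_box (le_max_right _ _))
  set u : ℕ → Euc n := fun j => TopologicalSpace.denseSeq (Metric.sphere (0 : Euc n) 1) j with hu
  have hu1 : ∀ j, ‖u j‖ = 1 := fun j => by simp [hu]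
  set T := box n (max r R) ∩ slabs u
    (fun j => pMean p (suppFn K (u j)) (suppFn L (u j)) (1 - lam)) with hT
  have hTc : IsCompact T := (isCompact_box _ _).inter_right (isClosed_slabs _ _)
  have hTsub : μ T ≤ μ (lpComb p lam K L) := measure_mono <| Set.inter_subset_right.trans <|
    slabs_denseSeq_subset_lpComb hp.1 hlam hK.1 hL.1 hr hrK hKL
  have hKpos := setIntegral_exp_neg_pos hVc hK.1 hr hrK
  have hLpos := setIntegral_exp_neg_pos hVc hL.1 hr hrL
  have hle : ∀ {A : Set (Euc n)} (h : ℕ → ℝ), A ⊆ box n (max r R) → A ⊆ slabs u h →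
      ∫ x in A, Real.exp (-V x) ≤ ∫ x in box n (max r R) ∩ slabs u h, Real.exp (-V x) :=
    fun h h1 h2 => setIntegral_mono_set
      (integrableOn_exp_neg hVc ((isCompact_box _ _).inter_right (isClosed_slabs _ _)))
      (Filter.Eventually.of_forall fun x => (Real.exp_pos _).le)
      (LE.le.eventuallyLE (Set.subset_inter h1 h2))
  have hmain := le_mass_slabs (p := p) (q := q) (R := max r R) (s := 1 - lam)
    hn hV hVconv hVeven hk₁0 hk hH hp hq.1 hr hrR
    (by refine le_of_eq_of_le ?_ hcond; field_simp) hM hu1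
    (fun j => le_suppFn_of_closedBall_subset hK.1 hr.le hrK (hu1 j))
    (fun j => suppFn_mono ⟨0, hrK (by simp [hr.le])⟩ hL.1 hKL (u j)) hKpos hLpos
    (hle _ (hKL.trans hLbox) (subset_slabs_suppFn hK.1 hKs u))
    (hle _ hLbox (subset_slabs_suppFn hL.1 hLs u))
    ⟨by linarith [hlam.2], by linarith [hlam.1]⟩ rfl
  rw [sub_sub_cancel] at hmain
  have hlam' : 0 ≤ 1 - lam := sub_nonneg.2 hlam.2
  rw [hμS hK.1, hμS hL.1]
  refine ⟨fun hq0 => ?_, fun hq0 => ?_⟩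
  · refine le_trans ?_ hTsub
    rw [hμS hTc, ENNReal.ofReal_rpow_of_pos hKpos, ENNReal.ofReal_rpow_of_pos hLpos,
      ← ENNReal.ofReal_mul (Real.rpow_nonneg hKpos.le _)]
    exact ENNReal.ofReal_le_ofReal (hmain.1 hq0)
  · have hqn : 0 ≤ q / n := div_nonneg hq.1 hn0.le
    refine le_trans ?_ (ENNReal.rpow_le_rpow hTsub hqn)
    rw [hμS hTc, ENNReal.ofReal_rpow_of_pos hKpos, ENNReal.ofReal_rpow_of_pos hLpos,
      ENNReal.ofReal_rpow_of_nonneg (integral_nonneg fun x => (Real.exp_pos _).le) hqn,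
      ← ENNReal.ofReal_mul hlam.1, ← ENNReal.ofReal_mul hlam',
      ← ENNReal.ofReal_add (mul_nonneg hlam.1 (Real.rpow_nonneg hKpos.le _))
        (mul_nonneg hlam' (Real.rpow_nonneg hLpos.le _))]
    exact ENNReal.ofReal_le_ofReal (hmain.2 (lt_of_le_of_ne hq.1 (Ne.symm hq0)))

end
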